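/- arXiv:0904.4814 — 3 statements merged into one kernel-verified Lean document; each statement's English description precedes it below -/
import Mathlib

section
/- Let S be a board with at least two cells, having b black cells and w white cells. Then there exist bijections β : Fin b ≃ {black cells of S} and ω : Fin w ≃ {white cells of S} such that the black-to-white matrix B of S (with respect to β and ω) admits a factorization B = L · D̃ · U, where L is a b × b lower triangular integer matrix with determinant 1 or −1, U is a w × w upper triangular integer matrix with determinant 1 or −1, D̃ is a b × w defective identity matrix, and every entry of L, D̃ and U is equal to 0, 1 or −1. -/
open scoped Matrix

/-- A cell of the integer grid, representing the closed unit square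
`[p₁, p₁+1] × [p₂, p₂+1] ⊆ ℝ²`. -/
abbrev Cell : Type := ℤ × ℤ

/-- The closed unit square in `ℝ²` corresponding to a cell. -/
def unitSquare (p : Cell) : Set (ℝ × ℝ) :=
  (Set.Icc (p.1 : ℝ) ((p.1 : ℝ) + 1)) ×ˢ (Set.Icc (p.2 : ℝ) ((p.2 : ℝ) + 1))

/-- The region of the plane covered by a finite set of cells. -/
def Region (S : Finset Cell) : Set (ℝ × ℝ) := ⋃ p ∈ S, unitSquare p

/-- A board: a finite nonempty set of cells whose region is homeomorphic to the
closed unit disk in `ℝ²`. -/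
def IsBoard (S : Finset Cell) : Prop :=
  S.Nonempty ∧
    Nonempty ((Region S) ≃ₜ (Metric.closedBall (0 : EuclideanSpace ℝ (Fin 2)) 1))

/-- A cell is black if the sum of its coordinates is even. -/
def IsBlackCell (p : Cell) : Prop := Even (p.1 + p.2)

instance (p : Cell) : Decidable (IsBlackCell p) := by
  unfold IsBlackCell; infer_instance

/-- The black cells of `S`. -/
def blackCells (S : Finset Cell) : Finset Cell := S.filter IsBlackCell

/-- The white cells of `S`. -/
def whiteCells (S : Finset Cell) : Finset Cell := S.filter fun p => ¬ IsBlackCell p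

/-- Two cells are adjacent when they share an edge. -/
def Adjacent (p q : Cell) : Prop :=
  p - q = (1, 0) ∨ p - q = (-1, 0) ∨ p - q = (0, 1) ∨ p - q = (0, -1)

instance (p q : Cell) : Decidable (Adjacent p q) := by
  unfold Adjacent; infer_instance

/-- The black-to-white adjacency matrix of a set of cells, with respect to
labelings `β` of the black cells and `ω` of the white cells. -/
def btwMatrix {S : Finset Cell} {b w : ℕ}
    (β : Fin b ≃ blackCells S) (ω : Fin w ≃ whiteCells S) :
    Matrix (Fin b) (Fin w) ℤ :=
  fun i j => if Adjacent (β i : Cell) (ω j : Cell) then 1 else 0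

/-- A defective identity matrix: obtained from an identity matrix by inserting
rows and columns of zeros. -/
def IsDefectiveIdentity {n m : ℕ} (D : Matrix (Fin n) (Fin m) ℤ) : Prop :=
  ∃ (k : ℕ) (f : Fin k → Fin n) (g : Fin k → Fin m),
    StrictMono f ∧ StrictMono g ∧
    (∀ t, D (f t) (g t) = 1) ∧
    (∀ i j, (∀ t, ¬ (f t = i ∧ g t = j)) → D i j = 0)

/-- Every circle-valued map on a space homeomorphic to a disk lifts to the line. -/
theorem exists_lift_of_homeo {X : Type*} [TopologicalSpace X]
    (e : X ≃ₜ (Metric.closedBall (0 : EuclideanSpace ℝ (Fin 2)) 1))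
    (H : X → AddCircle (1 : ℝ)) (hH : Continuous H) :
    ∃ θ : X → ℝ, Continuous θ ∧ ∀ x, ((θ x : ℝ) : AddCircle (1 : ℝ)) = H x := by
  let F := EuclideanSpace ℝ (Fin 2)
  have hmem : ∀ x : F, (max 1 ‖x‖)⁻¹ • x ∈ Metric.closedBall (0 : F) 1 := by
    intro x
    have h1 : (0 : ℝ) < max 1 ‖x‖ := lt_of_lt_of_le one_pos (le_max_left _ _)
    rw [mem_closedBall_zero_iff, norm_smul, norm_inv, Real.norm_eq_abs, abs_of_pos h1]
    rw [inv_mul_le_iff₀ h1, mul_one]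
    exact le_max_right _ _
  let ρ : F → Metric.closedBall (0 : F) 1 := fun x => ⟨(max 1 ‖x‖)⁻¹ • x, hmem x⟩
  have hρ : Continuous ρ := by
    apply Continuous.subtype_mk
    refine Continuous.smul (f := fun x : F => (max 1 ‖x‖)⁻¹) (g := fun x : F => x) ?_ continuous_id
    refine Continuous.inv₀ (by fun_prop) ?_
    intro x
    exact (lt_of_lt_of_le one_pos (le_max_left _ _)).ne'
  have hρid : ∀ y : Metric.closedBall (0 : F) 1, ρ y = y := by
    intro y
    have hy : ‖(y : F)‖ ≤ 1 := mem_closedBall_zero_iff.1 y.2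
    apply Subtype.ext
    simp [ρ, max_eq_left hy]
  let G : C(F, AddCircle (1 : ℝ)) := ⟨fun x => H (e.symm (ρ x)), by fun_prop⟩
  obtain ⟨c, hc⟩ := QuotientAddGroup.mk_surjective (G 0)
  obtain ⟨Θ, ⟨-, hΘ⟩, -⟩ :=
    (AddCircle.isCoveringMap_coe (1 : ℝ)).existsUnique_continuousMap_lifts G 0 c hc
  refine ⟨fun x => Θ (e x : F), by fun_prop, fun x => ?_⟩
  have := congrFun hΘ (e x : F)
  simp only [Function.comp] at this
  rw [this]
  simp [G, hρid]

/-- Combinatorial axiomatization of the "boards" that are stable under the reduction step. -/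
structure Good (V : Finset Cell) (E N : Cell → Cell → Prop) : Prop where
  e_mem : ∀ {x y}, E x y → x ∈ V ∧ y ∈ V
  n_mem : ∀ {x y}, N x y → x ∈ V ∧ y ∈ V
  e_col : ∀ {x y}, E x y → (IsBlackCell x ↔ ¬ IsBlackCell y)
  n_col : ∀ {x y}, N x y → (IsBlackCell x ↔ ¬ IsBlackCell y)
  e_fun : ∀ {x y z}, E x y → E x z → y = z
  e_inj : ∀ {x y z}, E x z → E y z → x = y
  n_fun : ∀ {x y z}, N x y → N x z → y = z
  n_inj : ∀ {x y z}, N x z → N y z → x = y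
  q1 : ∀ {a b c d}, N b c → N a d → E d c → E a b
  q2 : ∀ {a b c d}, E a b → N a d → E d c → N b c
  q3 : ∀ {a b c d}, E a b → N b c → E d c → N a d
  q4 : ∀ {a b c d}, E a b → N b c → N a d → E d c
  h1 : ∀ h v : Cell → Cell → ℤ,
    (∀ a b c d, E a b → N b c → N a d → E d c → h a b + v b c = v a d + h d c) →
    ∃ f : Cell → ℤ, (∀ x y, E x y → h x y = f y - f x) ∧ (∀ x y, N x y → v x y = f y - f x)

namespace Good

variable {V : Finset Cell} {E N : Cell → Cell → Prop}

theorem swap (g : Good V E N) : Good V N E where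
  e_mem := g.n_mem
  n_mem := g.e_mem
  e_col := g.n_col
  n_col := g.e_col
  e_fun := g.n_fun
  e_inj := g.n_inj
  n_fun := g.e_fun
  n_inj := g.e_inj
  q1 := fun h1 h2 h3 => g.q3 h2 h3 h1
  q2 := fun h1 h2 h3 => g.q4 h2 h3 h1
  q3 := fun h1 h2 h3 => g.q1 h3 h1 h2
  q4 := fun h1 h2 h3 => g.q2 h3 h1 h2
  h1 := by
    intro h v H
    obtain ⟨f, hf, hf'⟩ := g.h1 v h (fun a b c d h1 h2 h3 h4 => (H a d c b h3 h4 h1 h2).symm)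
    exact ⟨f, hf', hf⟩

theorem rev (g : Good V E N) : Good V (fun x y => E y x) (fun x y => N y x) where
  e_mem := fun h => (g.e_mem h).symm
  n_mem := fun h => (g.n_mem h).symm
  e_col := fun h => by have := g.e_col h; tauto
  n_col := fun h => by have := g.n_col h; tauto
  e_fun := g.e_inj
  e_inj := g.e_fun
  n_fun := g.n_inj
  n_inj := g.n_fun
  q1 := fun h1 h2 h3 => g.q4 h3 h2 h1
  q2 := fun h1 h2 h3 => g.q3 h3 h2 h1
  q3 := fun h1 h2 h3 => g.q2 h3 h2 h1
  q4 := fun h1 h2 h3 => g.q1 h3 h2 h1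
  h1 := by
    intro h v H
    obtain ⟨f, hf, hf'⟩ := g.h1 (fun x y => - h y x) (fun x y => - v y x)
      (fun a b c d h1 h2 h3 h4 => by have := H c d a b h4 h3 h2 h1; linarith)
    exact ⟨f, fun x y e => by have := hf _ _ e; linarith, fun x y e => by have := hf' _ _ e; linarith⟩

theorem exists_level (g : Good V E N) :
    ∃ lv : Cell → ℤ, (∀ x y, E x y → lv y = lv x + 1) ∧ (∀ x y, N x y → lv y = lv x + 1) := by
  obtain ⟨f, hf, hf'⟩ := g.h1 (fun _ _ => 1) (fun _ _ => 1) (fun _ _ _ _ _ _ _ _ => rfl)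
  exact ⟨f, fun x y e => by have := hf _ _ e; linarith, fun x y e => by have := hf' _ _ e; linarith⟩

theorem en_disj (g : Good V E N) {x y : Cell} (h : E x y) (h' : N x y) : False := by
  obtain ⟨f, hf, hf'⟩ := g.h1 (fun _ _ => 1) (fun _ _ => 0)
    (fun _ _ _ _ _ _ _ _ => by norm_num)
  have := hf _ _ h
  have := hf' _ _ h'
  omega

end Good

open Classical in
/-- The signed adjacency matrix. -/
noncomputable def sgnAdj (E N : Cell → Cell → Prop) (x y : Cell) : ℤ :=
  (if E x y then 1 else 0) + (if E y x then 1 else 0)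
    - (if N x y then 1 else 0) - (if N y x then 1 else 0)

theorem sgnAdj_symm (E N : Cell → Cell → Prop) (x y : Cell) : sgnAdj E N x y = sgnAdj E N y x := by
  unfold sgnAdj; ring

theorem sgnAdj_swap (E N : Cell → Cell → Prop) (x y : Cell) :
    sgnAdj N E x y = - sgnAdj E N x y := by
  unfold sgnAdj; ring

theorem sgnAdj_rev (E N : Cell → Cell → Prop) (x y : Cell) :
    sgnAdj (fun x y => E y x) (fun x y => N y x) x y = sgnAdj E N x y := by
  unfold sgnAdj; ring

/-- Recursive (colour-agnostic) triangular factorization of a symmetric matrix. -/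
inductive Fac : Finset Cell → (Cell → Cell → ℤ) → Prop
  | nil (A : Cell → Cell → ℤ) : Fac ∅ A
  | skip (V : Finset Cell) (A : Cell → Cell → ℤ) (s : Cell) (hs : s ∈ V)
      (h0 : ∀ y ∈ V, A s y = 0 ∧ A y s = 0) (h : Fac (V.erase s) A) : Fac V A
  | step (V : Finset Cell) (A A' : Cell → Cell → ℤ) (s t : Cell) (l u : Cell → ℤ)
      (hs : s ∈ V) (ht : t ∈ V) (hst : IsBlackCell s ↔ ¬ IsBlackCell t)
      (hl : ∀ x, l x = 0 ∨ l x = 1 ∨ l x = -1) (hu : ∀ x, u x = 0 ∨ u x = 1 ∨ u x = -1)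
      (hlt : l t = 1 ∨ l t = -1) (hus : u s = 1 ∨ u s = -1)
      (hlc : ∀ x, l x ≠ 0 → (IsBlackCell x ↔ IsBlackCell t))
      (huc : ∀ x, u x ≠ 0 → (IsBlackCell x ↔ IsBlackCell s))
      (hA : ∀ x ∈ V, ∀ y ∈ V, A x y = l x * u y + u x * l y + A' x y)
      (hs0 : ∀ y ∈ V, A' s y = 0 ∧ A' y s = 0)
      (ht0 : ∀ y ∈ V, A' t y = 0 ∧ A' y t = 0)
      (h : Fac ((V.erase s).erase t) A') : Fac V A

theorem Fac.congr {V : Finset Cell} {A : Cell → Cell → ℤ} (h : Fac V A) :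
    ∀ {B : Cell → Cell → ℤ}, (∀ x ∈ V, ∀ y ∈ V, B x y = A x y) → Fac V B := by
  induction h with
  | nil A => intro B _; exact .nil B
  | skip V A s hs h0 h ih =>
    intro B hB
    refine .skip V B s hs (fun y hy => ?_) (ih fun x hx y hy => ?_)
    · rw [hB s hs y hy, hB y hy s hs]; exact h0 y hy
    · exact hB x (Finset.mem_of_mem_erase hx) y (Finset.mem_of_mem_erase hy)
  | step V A A' s t l u hs ht hst hl hu hlt hus hlc huc hA hs0 ht0 h ih =>
    intro B hB
    exact .step V B A' s t l u hs ht hst hl hu hlt hus hlc huc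
      (fun x hx y hy => by rw [hB x hx y hy, hA x hx y hy]) hs0 ht0 h

theorem Fac.neg {V : Finset Cell} {A : Cell → Cell → ℤ} (h : Fac V A) :
    Fac V (fun x y => - A x y) := by
  induction h with
  | nil A => exact .nil _
  | skip V A s hs h0 h ih =>
    refine .skip V _ s hs (fun y hy => ?_) ih
    simpa using h0 y hy
  | step V A A' s t l u hs ht hst hl hu hlt hus hlc huc hA hs0 ht0 h ih =>
    refine .step V _ _ s t l (fun x => - u x) hs ht hst hl (fun x => ?_) hlt ?_ hlc
      (fun x hx => huc x (by simpa using hx)) (fun x hx y hy => ?_) (fun y hy => ?_)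
      (fun y hy => ?_) ih
    · rcases hu x with h | h | h <;> simp [h]
    · rcases hus with h | h <;> simp [h]
    · rw [hA x hx y hy]; ring
    · simpa using hs0 y hy
    · simpa using ht0 y hy

theorem Fac.multi (n : ℕ) : ∀ (V : Finset Cell) (A A' : Cell → Cell → ℤ) (s t : ℕ → Cell)
    (l u : ℕ → Cell → ℤ)
    (_ : ∀ i < n, s i ∈ V ∧ t i ∈ V ∧ (IsBlackCell (s i) ↔ ¬ IsBlackCell (t i)))
    (_ : ∀ i < n, ∀ x, (l i x = 0 ∨ l i x = 1 ∨ l i x = -1) ∧ (u i x = 0 ∨ u i x = 1 ∨ u i x = -1))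
    (_ : ∀ i < n, (l i (t i) = 1 ∨ l i (t i) = -1) ∧ (u i (s i) = 1 ∨ u i (s i) = -1))
    (_ : ∀ i < n, ∀ x, (l i x ≠ 0 → (IsBlackCell x ↔ IsBlackCell (t i))) ∧
      (u i x ≠ 0 → (IsBlackCell x ↔ IsBlackCell (s i))))
    (_ : ∀ i < n, ∀ j < n, i < j → l j (s i) = 0 ∧ l j (t i) = 0 ∧ u j (s i) = 0 ∧ u j (t i) = 0)
    (_ : ∀ x ∈ V, ∀ y ∈ V,
      A x y = (∑ i ∈ Finset.range n, (l i x * u i y + u i x * l i y)) + A' x y)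
    (_ : ∀ i < n, ∀ y ∈ V, A' (s i) y = 0 ∧ A' y (s i) = 0 ∧ A' (t i) y = 0 ∧ A' y (t i) = 0)
    (_ : Fac (V.filter fun x => ∀ i < n, x ≠ s i ∧ x ≠ t i) A'), Fac V A := by
  induction n with
  | zero =>
    intro V A A' s t l u _ _ _ _ _ hA _ hF
    refine Fac.congr (A := A') (by simpa using hF) ?_
    intro x hx y hy
    simpa using hA x hx y hy
  | succ n ih =>
    intro V A A' s t l u h1 h2 h3 h4 h5 hA h6 hF
    have h0 : 0 < n + 1 := Nat.succ_pos n
    have hz : ∀ i < n, ∀ x, x = s 0 ∨ x = t 0 → l (i+1) x = 0 ∧ u (i+1) x = 0 := by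
      intro i hi x hx
      have := h5 0 h0 (i+1) (by omega) (by omega)
      rcases hx with rfl | rfl <;> tauto
    refine Fac.step V A
      (fun x y => (∑ i ∈ Finset.range n, (l (i+1) x * u (i+1) y + u (i+1) x * l (i+1) y)) + A' x y)
      (s 0) (t 0) (l 0) (u 0) (h1 0 h0).1 (h1 0 h0).2.1 (h1 0 h0).2.2 (fun x => (h2 0 h0 x).1)
      (fun x => (h2 0 h0 x).2) (h3 0 h0).1 (h3 0 h0).2 (fun x => (h4 0 h0 x).1)
      (fun x => (h4 0 h0 x).2) ?_ ?_ ?_ ?_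
    · intro x hx y hy
      rw [hA x hx y hy, Finset.sum_range_succ']
      ring
    · intro y hy
      have := h6 0 h0 y hy
      constructor
      · rw [Finset.sum_eq_zero, this.1, add_zero]
        intro i hi
        have := hz i (Finset.mem_range.1 hi) _ (Or.inl rfl)
        rw [this.1, this.2]; ring
      · rw [Finset.sum_eq_zero, this.2.1, add_zero]
        intro i hi
        have := hz i (Finset.mem_range.1 hi) _ (Or.inl rfl)
        rw [this.1, this.2]; ring
    · intro y hy
      have := h6 0 h0 y hy
      constructor
      · rw [Finset.sum_eq_zero, this.2.2.1, add_zero]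
        intro i hi
        have := hz i (Finset.mem_range.1 hi) _ (Or.inr rfl)
        rw [this.1, this.2]; ring
      · rw [Finset.sum_eq_zero, this.2.2.2, add_zero]
        intro i hi
        have := hz i (Finset.mem_range.1 hi) _ (Or.inr rfl)
        rw [this.1, this.2]; ring
    · refine ih _ _ A' (fun i => s (i+1)) (fun i => t (i+1)) (fun i => l (i+1)) (fun i => u (i+1))
        ?_ (fun i hi => h2 _ (by omega)) (fun i hi => h3 _ (by omega)) (fun i hi => h4 _ (by omega))
        (fun i hi j hj hij => h5 _ (by omega) _ (by omega) (by omega)) (fun x _ y _ => rfl) ?_ ?_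
      · intro i hi
        have h7 := h1 (i+1) (by omega)
        have hs : ¬ (s (i+1) = s 0 ∨ s (i+1) = t 0) := by
          intro h
          have := (hz i hi _ h).2
          have := (h3 (i+1) (by omega)).2
          omega
        have ht : ¬ (t (i+1) = s 0 ∨ t (i+1) = t 0) := by
          intro h
          have := (hz i hi _ h).1
          have := (h3 (i+1) (by omega)).1
          omega
        simp only [Finset.mem_erase]
        tauto
      · intro i hi y hy
        exact h6 (i+1) (by omega) y (Finset.mem_of_mem_erase (Finset.mem_of_mem_erase hy))
      · convert hF using 1
        ext x
        simp only [Finset.mem_erase, Finset.mem_filter]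
        constructor
        · rintro ⟨⟨ht, hs, hx⟩, h⟩
          refine ⟨hx, fun i hi => ?_⟩
          rcases i with _ | i
          · exact ⟨hs, ht⟩
          · exact h i (by omega)
        · rintro ⟨hx, h⟩
          exact ⟨⟨(h 0 h0).2, (h 0 h0).1, hx⟩, fun i hi => h (i+1) (by omega)⟩

/-- Existence of labelings and an LDU factorization. -/
def HasLDU (V : Finset Cell) (A : Cell → Cell → ℤ) : Prop :=
  ∀ n m : ℕ, (blackCells V).card = n → (whiteCells V).card = m →
    ∃ (β : Fin n → Cell) (ω : Fin m → Cell)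
      (L : Matrix (Fin n) (Fin n) ℤ) (D : Matrix (Fin n) (Fin m) ℤ) (U : Matrix (Fin m) (Fin m) ℤ),
      Function.Injective β ∧ Function.Injective ω ∧
      (∀ i, β i ∈ blackCells V) ∧ (∀ i, ω i ∈ whiteCells V) ∧
      (∀ i j, A (β i) (ω j) = (L * D * U) i j) ∧
      (∀ i j : Fin n, i < j → L i j = 0) ∧ (∀ i, L i i = 1 ∨ L i i = -1) ∧
      (∀ i j : Fin m, j < i → U i j = 0) ∧ (∀ i, U i i = 1 ∨ U i i = -1) ∧
      IsDefectiveIdentity D ∧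
      (∀ i j, L i j = 0 ∨ L i j = 1 ∨ L i j = -1) ∧
      (∀ i j, D i j = 0 ∨ D i j = 1 ∨ D i j = -1) ∧
      (∀ i j, U i j = 0 ∨ U i j = 1 ∨ U i j = -1)

theorem IsDefectiveIdentity.consBoth {n m : ℕ} {D : Matrix (Fin n) (Fin m) ℤ}
    (h : IsDefectiveIdentity D) :
    IsDefectiveIdentity (n := n+1) (m := m+1)
      (fun i j => Fin.cases (Fin.cases 1 (fun _ => 0) j) (fun i' => Fin.cases 0 (D i') j) i) := by
  obtain ⟨k, f, g, hf, hg, h1, h0⟩ := h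
  refine ⟨k+1, Fin.cons 0 (fun t => (f t).succ), Fin.cons 0 (fun t => (g t).succ), ?_, ?_, ?_, ?_⟩
  · intro a b hab
    induction b using Fin.cases with
    | zero => simp at hab
    | succ b =>
      induction a using Fin.cases with
      | zero => simp
      | succ a => simpa using hf (by simpa using hab)
  · intro a b hab
    induction b using Fin.cases with
    | zero => simp at hab
    | succ b =>
      induction a using Fin.cases with
      | zero => simp
      | succ a => simpa using hg (by simpa using hab)
  · intro t
    induction t using Fin.cases with
    | zero => simp
    | succ t => simpa using h1 t
  · intro i j hij
    induction i using Fin.cases with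
    | zero =>
      induction j using Fin.cases with
      | zero => exact absurd (hij 0) (by simp)
      | succ j => simp
    | succ i =>
      induction j using Fin.cases with
      | zero => simp
      | succ j =>
        refine h0 i j fun t ht => hij t.succ ?_
        simpa using ht

theorem IsDefectiveIdentity.consRow {n m : ℕ} {D : Matrix (Fin n) (Fin m) ℤ}
    (h : IsDefectiveIdentity D) :
    IsDefectiveIdentity (n := n+1) (m := m)
      (fun i j => Fin.cases 0 (fun i' => D i' j) i) := by
  obtain ⟨k, f, g, hf, hg, h1, h0⟩ := h
  refine ⟨k, (fun t => (f t).succ), g, fun a b hab => by simpa using hf hab, hg,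
    fun t => by simpa using h1 t, ?_⟩
  intro i j hij
  induction i using Fin.cases with
  | zero => simp
  | succ i =>
    refine h0 i j fun t ht => hij t ?_
    simpa using ht

theorem IsDefectiveIdentity.consCol {n m : ℕ} {D : Matrix (Fin n) (Fin m) ℤ}
    (h : IsDefectiveIdentity D) :
    IsDefectiveIdentity (n := n) (m := m+1)
      (fun i j => Fin.cases 0 (D i) j) := by
  obtain ⟨k, f, g, hf, hg, h1, h0⟩ := h
  refine ⟨k, f, (fun t => (g t).succ), hf, fun a b hab => by simpa using hg hab,
    fun t => by simpa using h1 t, ?_⟩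
  intro i j hij
  induction j using Fin.cases with
  | zero => simp
  | succ j =>
    refine h0 i j fun t ht => hij t ?_
    simpa using ht

theorem injective_cons_succ {n : ℕ} {p : Cell} {β : Fin n → Cell} (h : Function.Injective β)
    (hp : ∀ i, β i ≠ p) : Function.Injective (Fin.cons p β : Fin (n+1) → Cell) := by
  rw [Fin.cons_injective_iff]
  exact ⟨fun ⟨i, hi⟩ => hp i hi, h⟩

theorem HasLDU.step {V W : Finset Cell} {A A' : Cell → Cell → ℤ} {p q : Cell} {l u : Cell → ℤ}
    (hW : W = (V.erase p).erase q)
    (hp : p ∈ blackCells V) (hq : q ∈ whiteCells V)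
    (hl : ∀ x, l x = 0 ∨ l x = 1 ∨ l x = -1) (hu : ∀ x, u x = 0 ∨ u x = 1 ∨ u x = -1)
    (hlt : l p = 1 ∨ l p = -1) (hus : u q = 1 ∨ u q = -1)
    (hA : ∀ x ∈ blackCells V, ∀ y ∈ whiteCells V, A x y = l x * u y + A' x y)
    (hp0 : ∀ y ∈ V, A' p y = 0) (hq0 : ∀ y ∈ V, A' y q = 0) (h : HasLDU W A') : HasLDU V A := by
  have hpV : p ∈ V := Finset.mem_of_mem_filter _ hp
  have hqV : q ∈ V := Finset.mem_of_mem_filter _ hq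
  have hpb : IsBlackCell p := (Finset.mem_filter.1 hp).2
  have hqb : ¬ IsBlackCell q := (Finset.mem_filter.1 hq).2
  have e1 : blackCells W = (blackCells V).erase p := by
    subst hW
    ext x
    simp only [blackCells, Finset.mem_filter, Finset.mem_erase]
    have : x = q → ¬ IsBlackCell x := fun h => h ▸ hqb
    tauto
  have e2 : whiteCells W = (whiteCells V).erase q := by
    subst hW
    ext x
    simp only [whiteCells, Finset.mem_filter, Finset.mem_erase]
    have : x = p → IsBlackCell x := fun h => h ▸ hpb
    tauto
  intro n m hn hm
  have hn' : (blackCells W).card + 1 = n := by rw [e1, Finset.card_erase_add_one hp, hn]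
  have hm' : (whiteCells W).card + 1 = m := by rw [e2, Finset.card_erase_add_one hq, hm]
  obtain ⟨β, ω, L, D, U, hβ, hω, hβm, hωm, hLDU, hL, hL1, hU, hU1, hD, hL2, hD2, hU2⟩ :=
    h _ _ rfl rfl
  subst hn' hm'
  replace hβm := fun i => (Finset.ext_iff.1 e1 _).1 (hβm i)
  replace hωm := fun i => (Finset.ext_iff.1 e2 _).1 (hωm i)
  have hβV : ∀ i, β i ∈ V := fun i => Finset.mem_of_mem_filter _ (Finset.mem_of_mem_erase (hβm i))
  have hωV : ∀ i, ω i ∈ V := fun i => Finset.mem_of_mem_filter _ (Finset.mem_of_mem_erase (hωm i))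
  refine ⟨Fin.cons p β, Fin.cons q ω,
    Matrix.of (fun i j => Fin.cases (l ((Fin.cons p β : Fin (_+1) → Cell) i))
      (fun j' => Fin.cases 0 (fun i' => L i' j') i) j),
    Matrix.of (fun i j => Fin.cases (Fin.cases 1 (fun _ => 0) j) (fun i' => Fin.cases 0 (D i') j) i),
    Matrix.of (fun i j => Fin.cases (u ((Fin.cons q ω : Fin (_+1) → Cell) j))
      (fun i' => Fin.cases 0 (fun j' => U i' j') j) i),
    injective_cons_succ hβ (fun i => Finset.ne_of_mem_erase (hβm i)),
    injective_cons_succ hω (fun i => Finset.ne_of_mem_erase (hωm i)),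
    ?_, ?_, ?_, ?_, ?_, ?_, ?_, hD.consBoth, ?_, ?_, ?_⟩
  · intro i
    induction i using Fin.cases with
    | zero => simpa using hp
    | succ i => simpa using Finset.mem_of_mem_erase (hβm i)
  · intro i
    induction i using Fin.cases with
    | zero => simpa using hq
    | succ i => simpa using Finset.mem_of_mem_erase (hωm i)
  · intro i j
    induction i using Fin.cases with
    | zero =>
      induction j using Fin.cases with
      | zero =>
        simp [Matrix.mul_apply, Fin.sum_univ_succ, hA p hp q hq, hp0 q hqV]
      | succ j =>
        simp [Matrix.mul_apply, Fin.sum_univ_succ, hA p hp _ (Finset.mem_of_mem_erase (hωm j)),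
          hp0 _ (hωV j)]
    | succ i =>
      induction j using Fin.cases with
      | zero =>
        simp [Matrix.mul_apply, Fin.sum_univ_succ, hA _ (Finset.mem_of_mem_erase (hβm i)) q hq,
          hq0 _ (hβV i)]
      | succ j =>
        have := hLDU i j
        simp only [Matrix.mul_apply] at this
        simp [Matrix.mul_apply, Fin.sum_univ_succ, hA _ (Finset.mem_of_mem_erase (hβm i)) _
          (Finset.mem_of_mem_erase (hωm j)), this]
  · intro i j hij
    induction j using Fin.cases with
    | zero => simp at hij
    | succ j =>
      induction i using Fin.cases with
      | zero => simp
      | succ i => simpa using hL i j (by simpa using hij)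
  · intro i
    induction i using Fin.cases with
    | zero => simpa using hlt
    | succ i => simpa using hL1 i
  · intro i j hij
    induction i using Fin.cases with
    | zero => simp at hij
    | succ i =>
      induction j using Fin.cases with
      | zero => simp
      | succ j => simpa using hU i j (by simpa using hij)
  · intro i
    induction i using Fin.cases with
    | zero => simpa using hus
    | succ i => simpa using hU1 i
  · intro i j
    induction j using Fin.cases with
    | zero => exact hl _
    | succ j =>
      induction i using Fin.cases with
      | zero => simp
      | succ i => exact hL2 i j
  · intro i j
    induction j using Fin.cases with
    | zero =>
      induction i using Fin.cases with
      | zero => simp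
      | succ i => simp
    | succ j =>
      induction i using Fin.cases with
      | zero => simp
      | succ i => exact hD2 i j
  · intro i j
    induction i using Fin.cases with
    | zero => exact hu _
    | succ i =>
      induction j using Fin.cases with
      | zero => simp
      | succ j => exact hU2 i j

theorem HasLDU.skipBlack {V : Finset Cell} {A : Cell → Cell → ℤ} {p : Cell}
    (hp : p ∈ blackCells V)
    (hp0 : ∀ y ∈ V, A p y = 0) (h : HasLDU (V.erase p) A) : HasLDU V A := by
  have hpV : p ∈ V := Finset.mem_of_mem_filter _ hp
  have hpb : IsBlackCell p := (Finset.mem_filter.1 hp).2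
  have e1 : blackCells (V.erase p) = (blackCells V).erase p := by
    ext x
    simp only [blackCells, Finset.mem_filter, Finset.mem_erase]
    tauto
  have e2 : whiteCells (V.erase p) = whiteCells V := by
    ext x
    simp only [whiteCells, Finset.mem_filter, Finset.mem_erase]
    have : x = p → IsBlackCell x := fun h => h ▸ hpb
    tauto
  intro n m hn hm
  have hn' : (blackCells (V.erase p)).card + 1 = n := by
    rw [e1, Finset.card_erase_add_one hp, hn]
  obtain ⟨β, ω, L, D, U, hβ, hω, hβm, hωm, hLDU, hL, hL1, hU, hU1, hD, hL2, hD2, hU2⟩ :=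
    h _ m rfl (by rw [e2, hm])
  subst hn'
  replace hβm := fun i => (Finset.ext_iff.1 e1 _).1 (hβm i)
  replace hωm := fun i => (Finset.ext_iff.1 e2 _).1 (hωm i)
  have hωV : ∀ i, ω i ∈ V := fun i => Finset.mem_of_mem_filter _ (hωm i)
  refine ⟨Fin.cons p β, ω,
    Matrix.of (fun i j => Fin.cases (Fin.cases 1 (fun _ => 0) i)
      (fun j' => Fin.cases 0 (fun i' => L i' j') i) j),
    Matrix.of (fun i j => Fin.cases (motive := fun _ => ℤ) 0 (fun i' => D i' j) i), U,
    injective_cons_succ hβ (fun i => Finset.ne_of_mem_erase (hβm i)), hω,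
    ?_, hωm, ?_, ?_, ?_, hU, hU1, ?_, ?_, ?_, hU2⟩
  · intro i
    induction i using Fin.cases with
    | zero => simpa using hp
    | succ i => simpa using Finset.mem_of_mem_erase (hβm i)
  · intro i j
    induction i using Fin.cases with
    | zero =>
      simp [Matrix.mul_apply, Fin.sum_univ_succ, hp0 _ (hωV j)]
    | succ i =>
      have := hLDU i j
      simp only [Matrix.mul_apply] at this
      simp [Matrix.mul_apply, Fin.sum_univ_succ, this]
  · intro i j hij
    induction j using Fin.cases with
    | zero => simp at hij
    | succ j =>
      induction i using Fin.cases with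
      | zero => simp
      | succ i => simpa using hL i j (by simpa using hij)
  · intro i
    induction i using Fin.cases with
    | zero => simp
    | succ i => simpa using hL1 i
  · exact hD.consRow
  · intro i j
    induction j using Fin.cases with
    | zero =>
      induction i using Fin.cases with
      | zero => simp
      | succ i => simp
    | succ j =>
      induction i using Fin.cases with
      | zero => simp
      | succ i => exact hL2 i j
  · intro i j
    induction i using Fin.cases with
    | zero => simp
    | succ i => exact hD2 i j

theorem HasLDU.skipWhite {V : Finset Cell} {A : Cell → Cell → ℤ} {q : Cell}
    (hq : q ∈ whiteCells V)
    (hq0 : ∀ y ∈ V, A y q = 0) (h : HasLDU (V.erase q) A) : HasLDU V A := by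
  have hqV : q ∈ V := Finset.mem_of_mem_filter _ hq
  have hqb : ¬ IsBlackCell q := (Finset.mem_filter.1 hq).2
  have e1 : blackCells (V.erase q) = blackCells V := by
    ext x
    simp only [blackCells, Finset.mem_filter, Finset.mem_erase]
    have : x = q → ¬ IsBlackCell x := fun h => h ▸ hqb
    tauto
  have e2 : whiteCells (V.erase q) = (whiteCells V).erase q := by
    ext x
    simp only [whiteCells, Finset.mem_filter, Finset.mem_erase]
    tauto
  intro n m hn hm
  have hm' : (whiteCells (V.erase q)).card + 1 = m := by
    rw [e2, Finset.card_erase_add_one hq, hm]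
  obtain ⟨β, ω, L, D, U, hβ, hω, hβm, hωm, hLDU, hL, hL1, hU, hU1, hD, hL2, hD2, hU2⟩ :=
    h n _ (by rw [e1, hn]) rfl
  subst hm'
  replace hβm := fun i => (Finset.ext_iff.1 e1 _).1 (hβm i)
  replace hωm := fun i => (Finset.ext_iff.1 e2 _).1 (hωm i)
  have hβV : ∀ i, β i ∈ V := fun i => Finset.mem_of_mem_filter _ (hβm i)
  refine ⟨β, Fin.cons q ω, L,
    Matrix.of (fun i j => Fin.cases 0 (D i) j),
    Matrix.of (fun i j => Fin.cases (Fin.cases 1 (fun _ => 0) j)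
      (fun i' => Fin.cases 0 (fun j' => U i' j') j) i),
    hβ, injective_cons_succ hω (fun i => Finset.ne_of_mem_erase (hωm i)),
    hβm, ?_, ?_, hL, hL1, ?_, ?_, hD.consCol, hL2, ?_, ?_⟩
  · intro i
    induction i using Fin.cases with
    | zero => simpa using hq
    | succ i => simpa using Finset.mem_of_mem_erase (hωm i)
  · intro i j
    induction j using Fin.cases with
    | zero =>
      simp [Matrix.mul_apply, Fin.sum_univ_succ, hq0 _ (hβV i)]
    | succ j =>
      have := hLDU i j
      simp only [Matrix.mul_apply] at this
      simp [Matrix.mul_apply, Fin.sum_univ_succ, this]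
  · intro i j hij
    induction i using Fin.cases with
    | zero => simp at hij
    | succ i =>
      induction j using Fin.cases with
      | zero => simp
      | succ j => simpa using hU i j (by simpa using hij)
  · intro i
    induction i using Fin.cases with
    | zero => simp
    | succ i => simpa using hU1 i
  · intro i j
    induction j using Fin.cases with
    | zero => simp
    | succ j => exact hD2 i j
  · intro i j
    induction i using Fin.cases with
    | zero =>
      induction j using Fin.cases with
      | zero => simp
      | succ j => simp
    | succ i =>
      induction j using Fin.cases with
      | zero => simp
      | succ j => exact hU2 i j

theorem Fac.hasLDU {V : Finset Cell} {A : Cell → Cell → ℤ} (h : Fac V A) : HasLDU V A := by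
  induction h with
  | nil A =>
    intro n m hn hm
    have hn : n = 0 := by rw [← hn]; simp [blackCells]
    have hm : m = 0 := by rw [← hm]; simp [whiteCells]
    subst hn hm
    refine ⟨Fin.elim0, Fin.elim0, 0, 0, 0, fun i => i.elim0, fun i => i.elim0, fun i => i.elim0,
      fun i => i.elim0, fun i => i.elim0, fun i => i.elim0, fun i => i.elim0, fun i => i.elim0,
      fun i => i.elim0, ?_, fun i => i.elim0, fun i => i.elim0, fun i => i.elim0⟩
    exact ⟨0, Fin.elim0, Fin.elim0, fun i => i.elim0, fun i => i.elim0, fun i => i.elim0,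
      fun i => i.elim0⟩
  | skip V A s hs h0 h ih =>
    by_cases hb : IsBlackCell s
    · exact HasLDU.skipBlack (Finset.mem_filter.2 ⟨hs, hb⟩) (fun y hy => (h0 y hy).1) ih
    · exact HasLDU.skipWhite (Finset.mem_filter.2 ⟨hs, hb⟩) (fun y hy => (h0 y hy).2) ih
  | step V A A' s t l u hs ht hst hl hu hlt hus hlc huc hA hs0 ht0 h ih =>
    by_cases hb : IsBlackCell s
    · have hbt : ¬ IsBlackCell t := hst.1 hb
      refine HasLDU.step rfl (Finset.mem_filter.2 ⟨hs, hb⟩)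
        (Finset.mem_filter.2 ⟨ht, hbt⟩) hu hl hus hlt ?_
        (fun y hy => (hs0 y hy).1) (fun y hy => (ht0 y hy).2) ih
      intro x hx y hy
      obtain ⟨hx, hxb⟩ := Finset.mem_filter.1 hx
      obtain ⟨hy, hyb⟩ := Finset.mem_filter.1 hy
      have : l x = 0 := by
        by_contra hne
        have := hlc x hne
        tauto
      rw [hA x hx y hy, this]; ring
    · have hbt : IsBlackCell t := by tauto
      refine HasLDU.step (Finset.erase_right_comm) (Finset.mem_filter.2 ⟨ht, hbt⟩)
        (Finset.mem_filter.2 ⟨hs, hb⟩) hl hu hlt hus ?_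
        (fun y hy => (ht0 y hy).1) (fun y hy => (hs0 y hy).2) ih
      intro x hx y hy
      obtain ⟨hx, hxb⟩ := Finset.mem_filter.1 hx
      obtain ⟨hy, hyb⟩ := Finset.mem_filter.1 hy
      have : u x = 0 := by
        by_contra hne
        have := huc x hne
        tauto
      rw [hA x hx y hy, this]; ring

/-- Horizontal neighbours inside `S`. -/
def HAdj (S : Finset Cell) (x y : Cell) : Prop := x ∈ S ∧ y ∈ S ∧ y = (x.1 + 1, x.2)
/-- Vertical neighbours inside `S`. -/
def VAdj (S : Finset Cell) (x y : Cell) : Prop := x ∈ S ∧ y ∈ S ∧ y = (x.1, x.2 + 1)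

/-- Sign used to pass from the signed to the unsigned adjacency matrix. -/
def rowSign (p : Cell) : ℤ := if Even p.2 then 1 else -1

theorem rowSign_cases (p : Cell) : rowSign p = 1 ∨ rowSign p = -1 := by
  unfold rowSign; split_ifs <;> simp

theorem rowSign_succ (a b : ℤ) (c : ℤ): rowSign (c, b + 1) = - rowSign (a, b) := by
  unfold rowSign
  simp only [Int.even_add_one]
  split_ifs <;> simp

theorem adj_eq_sgnAdj (S : Finset Cell) {x y : Cell} (hx : x ∈ S) (hy : y ∈ S) :
    (if Adjacent x y then (1:ℤ) else 0) =
      rowSign x * sgnAdj (HAdj S) (VAdj S) x y * rowSign y := by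
  obtain ⟨a, b⟩ := x
  obtain ⟨c, d⟩ := y
  have hsq : ∀ p, rowSign p * rowSign p = 1 := by
    intro p; rcases rowSign_cases p with h | h <;> simp [h]
  have hr : ∀ a b c, rowSign (a, b) = rowSign (c, b) := fun a b c => rfl
  simp only [Adjacent, sgnAdj, HAdj, VAdj, hx, hy, Prod.mk_sub_mk, Prod.mk.injEq, true_and]
  by_cases h1 : c = a + 1 ∧ d = b
  · obtain ⟨rfl, rfl⟩ := h1
    have := hsq (a, d)
    simp [hr (a+1) d a, this, show ¬ (a = a+1+1) by omega]
  by_cases h2 : a = c + 1 ∧ b = d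
  · obtain ⟨rfl, rfl⟩ := h2
    have := hsq (c, b)
    simp [hr (c+1) b c, this, show ¬ (c = c+1+1) by omega]
  by_cases h3 : c = a ∧ d = b + 1
  · obtain ⟨rfl, rfl⟩ := h3
    have := hsq (c, b)
    simp [rowSign_succ c b c, this, show ¬ (b = b+1+1) by omega]
  by_cases h4 : a = c ∧ b = d + 1
  · obtain ⟨rfl, rfl⟩ := h4
    have := hsq (a, d)
    simp [rowSign_succ a d a, this, show ¬ (d = d+1+1) by omega]
  rw [if_neg (by omega), if_neg h1, if_neg h2, if_neg h3, if_neg h4]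
  simp

theorem prod_pm_one (n : ℕ) (f : Fin n → ℤ) (hf : ∀ i, f i = 1 ∨ f i = -1) :
    (∏ i, f i = 1 ∨ ∏ i, f i = -1) := by
  refine Finset.prod_induction f (fun x => x = 1 ∨ x = -1) ?_ (Or.inl rfl) (fun i _ => hf i)
  rintro a b (rfl | rfl) (rfl | rfl) <;> simp

theorem det_lower_pm_one {n : ℕ} (M : Matrix (Fin n) (Fin n) ℤ) (h : ∀ i j, i < j → M i j = 0)
    (hd : ∀ i, M i i = 1 ∨ M i i = -1) : M.det = 1 ∨ M.det = -1 := by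
  rw [Matrix.det_of_isLowerTriangular M (fun i j hij => h i j hij)]
  exact prod_pm_one _ _ hd

theorem det_upper_pm_one {n : ℕ} (M : Matrix (Fin n) (Fin n) ℤ) (h : ∀ i j, j < i → M i j = 0)
    (hd : ∀ i, M i i = 1 ∨ M i i = -1) : M.det = 1 ∨ M.det = -1 := by
  rw [Matrix.det_of_isUpperTriangular (fun i j hij => h i j hij)]
  exact prod_pm_one _ _ hd

theorem final_of_fac
    (S : Finset Cell) (hF : Fac S (sgnAdj (HAdj S) (VAdj S))) (b w : ℕ)
    (hb : (blackCells S).card = b) (hw : (whiteCells S).card = w) :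
    ∃ (β : Fin b ≃ blackCells S) (ω : Fin w ≃ whiteCells S)
      (L : Matrix (Fin b) (Fin b) ℤ) (D : Matrix (Fin b) (Fin w) ℤ)
      (U : Matrix (Fin w) (Fin w) ℤ),
      btwMatrix β ω = L * D * U ∧
      (∀ i j : Fin b, i < j → L i j = 0) ∧ (L.det = 1 ∨ L.det = -1) ∧
      (∀ i j : Fin w, j < i → U i j = 0) ∧ (U.det = 1 ∨ U.det = -1) ∧
      IsDefectiveIdentity D ∧
      (∀ i j, L i j = 0 ∨ L i j = 1 ∨ L i j = -1) ∧
      (∀ i j, D i j = 0 ∨ D i j = 1 ∨ D i j = -1) ∧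
      (∀ i j, U i j = 0 ∨ U i j = 1 ∨ U i j = -1) := by
  obtain ⟨β, ω, L, D, U, hβ, hω, hβm, hωm, hLDU, hL, hL1, hU, hU1, hD, hL2, hD2, hU2⟩ :=
    hF.hasLDU b w hb hw
  have hβb : Function.Bijective (fun i => (⟨β i, hβm i⟩ : blackCells S)) := by
    rw [Fintype.bijective_iff_injective_and_card]
    refine ⟨fun i j h => hβ (congrArg Subtype.val h), by simp [hb]⟩
  have hωb : Function.Bijective (fun i => (⟨ω i, hωm i⟩ : whiteCells S)) := by
    rw [Fintype.bijective_iff_injective_and_card]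
    refine ⟨fun i j h => hω (congrArg Subtype.val h), by simp [hw]⟩
  have hL1' : ∀ i, rowSign (β i) * L i i = 1 ∨ rowSign (β i) * L i i = -1 := by
    intro i
    rcases rowSign_cases (β i) with h | h <;> rcases hL1 i with h' | h' <;> simp [h, h']
  have hU1' : ∀ i, U i i * rowSign (ω i) = 1 ∨ U i i * rowSign (ω i) = -1 := by
    intro i
    rcases rowSign_cases (ω i) with h | h <;> rcases hU1 i with h' | h' <;> simp [h, h']
  have hLt : ∀ i j : Fin b, i < j → rowSign (β i) * L i j = 0 := by
    intro i j h; rw [hL i j h, mul_zero]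
  have hUt : ∀ i j : Fin w, j < i → U i j * rowSign (ω j) = 0 := by
    intro i j h; rw [hU i j h, zero_mul]
  refine ⟨Equiv.ofBijective _ hβb, Equiv.ofBijective _ hωb,
    Matrix.of (fun i j => rowSign (β i) * L i j), D,
    Matrix.of (fun i j => U i j * rowSign (ω j)), ?_,
    hLt, ?_, hUt, ?_, hD, ?_, hD2, ?_⟩
  · ext i j
    have h1 := adj_eq_sgnAdj S (Finset.mem_of_mem_filter _ (hβm i))
      (Finset.mem_of_mem_filter _ (hωm j))
    rw [hLDU i j] at h1
    simp only [btwMatrix, Equiv.ofBijective_apply]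
    rw [h1]
    simp only [Matrix.mul_apply, Matrix.of_apply, Finset.mul_sum, Finset.sum_mul, mul_assoc]
  · exact det_lower_pm_one _ hLt hL1'
  · exact det_upper_pm_one _ hUt hU1'
  · intro i j
    rcases rowSign_cases (β i) with h | h <;> rcases hL2 i j with h' | h' | h' <;> simp [h, h']
  · intro i j
    rcases rowSign_cases (ω j) with h | h <;> rcases hU2 i j with h' | h' | h' <;> simp [h, h']

theorem exists_corner_values (S : Finset Cell) (h v : Cell → Cell → ℤ)
    (H : ∀ a b c d, HAdj S a b → VAdj S b c → VAdj S a d → HAdj S d c →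
      h a b + v b c = v a d + h d c) (SW SE NE NW : Cell)
    (e1 : SE = (SW.1 + 1, SW.2)) (e2 : NW = (SW.1, SW.2 + 1)) (e3 : NE = (SW.1 + 1, SW.2 + 1)) :
    ∃ cSW cSE cNE cNW : ℤ,
      (SW ∈ S → SE ∈ S → h SW SE = cSE - cSW) ∧ (SE ∈ S → NE ∈ S → v SE NE = cNE - cSE) ∧
      (NW ∈ S → NE ∈ S → h NW NE = cNE - cNW) ∧ (SW ∈ S → NW ∈ S → v SW NW = cNW - cSW) := by
  by_cases h1 : SW ∈ S
  · by_cases h2 : SE ∈ S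
    · refine ⟨0, h SW SE, h SW SE + v SE NE, v SW NW, by simp, by simp, ?_, by simp⟩
      intro h3 h4
      have := H SW SE NE NW ⟨h1, h2, e1⟩ ⟨h2, h4, by rw [e3, e1]⟩ ⟨h1, h3, e2⟩
        ⟨h3, h4, by rw [e3, e2]⟩
      linarith
    · exact ⟨-h NW NE - v SW NW, 0, 0, -h NW NE, by tauto, by tauto, by simp, by simp⟩
  · exact ⟨0, 0, v SE NE, v SE NE - h NW NE, by tauto, by simp, by simp, by tauto⟩

/-- Bilinear interpolation of corner values on the square `p`. -/
noncomputable def bilin (c : Cell → Cell → ℤ) (p : Cell) (x : ℝ × ℝ) : ℝ :=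
  (1 - (x.1 - p.1)) * (1 - (x.2 - p.2)) * c p p
  + (x.1 - p.1) * (1 - (x.2 - p.2)) * c (p.1 + 1, p.2) p
  + (1 - (x.1 - p.1)) * (x.2 - p.2) * c (p.1, p.2 + 1) p
  + (x.1 - p.1) * (x.2 - p.2) * c (p.1 + 1, p.2 + 1) p

theorem bilin_continuous (c : Cell → Cell → ℤ) (p : Cell) : Continuous (bilin c p) := by
  unfold bilin; fun_prop

theorem mem_unitSquare {p : Cell} {x : ℝ × ℝ} : x ∈ unitSquare p ↔
    ((p.1 : ℝ) ≤ x.1 ∧ x.1 ≤ p.1 + 1) ∧ ((p.2 : ℝ) ≤ x.2 ∧ x.2 ≤ p.2 + 1) := by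
  simp only [unitSquare, Set.mem_prod, Set.mem_Icc]

theorem h1_of_homeo (S : Finset Cell)
    (e : (Region S) ≃ₜ (Metric.closedBall (0 : EuclideanSpace ℝ (Fin 2)) 1))
    (h v : Cell → Cell → ℤ)
    (H : ∀ a b c d, HAdj S a b → VAdj S b c → VAdj S a d → HAdj S d c →
      h a b + v b c = v a d + h d c) :
    ∃ f : Cell → ℤ, (∀ x y, HAdj S x y → h x y = f y - f x) ∧
      (∀ x y, VAdj S x y → v x y = f y - f x) := by
  classical
  choose cSW cSE cNE cNW hc1 hc2 hc3 hc4 using fun z : Cell =>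
    exists_corner_values S h v H (z.1 - 1, z.2 - 1) (z.1, z.2 - 1) z (z.1 - 1, z.2)
      (by simp) (by simp) (by ext <;> simp)
  let c : Cell → Cell → ℤ := fun z p =>
    if p = z then cNE z else if p = (z.1 - 1, z.2) then cNW z
    else if p = (z.1, z.2 - 1) then cSE z else cSW z
  have cNE' : ∀ a b, c (a, b) (a, b) = cNE (a, b) := by intro a b; simp [c]
  have cNW' : ∀ a b, c (a + 1, b) (a, b) = cNW (a + 1, b) := by
    intro a b; simp [c]
  have cSE' : ∀ a b, c (a, b + 1) (a, b) = cSE (a, b + 1) := by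
    intro a b; simp [c]
  have cSW' : ∀ a b, c (a + 1, b + 1) (a, b) = cSW (a + 1, b + 1) := by
    intro a b; simp [c]
  -- relations in normal form
  have r1 : ∀ a b, (a, b) ∈ S → (a + 1, b) ∈ S →
      h (a, b) (a + 1, b) = cNE (a + 1, b) - cNW (a + 1, b) ∧
      h (a, b) (a + 1, b) = cSE (a + 1, b + 1) - cSW (a + 1, b + 1) := by
    intro a b h1 h2
    refine ⟨?_, ?_⟩
    · simpa using hc3 (a + 1, b) (by simpa using h1) (by simpa using h2)
    · simpa using hc1 (a + 1, b + 1) (by simpa using h1) (by simpa using h2)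
  have r2 : ∀ a b, (a, b) ∈ S → (a, b + 1) ∈ S →
      v (a, b) (a, b + 1) = cNE (a, b + 1) - cSE (a, b + 1) ∧
      v (a, b) (a, b + 1) = cNW (a + 1, b + 1) - cSW (a + 1, b + 1) := by
    intro a b h1 h2
    refine ⟨?_, ?_⟩
    · simpa using hc2 (a, b + 1) (by simpa using h1) (by simpa using h2)
    · simpa using hc4 (a + 1, b + 1) (by simpa using h1) (by simpa using h2)
  have k1 : ∀ p q, HAdj S p q → ∀ x ∈ unitSquare p, x ∈ unitSquare q →
      bilin c p x - bilin c q x = ((- h p q : ℤ) : ℝ) := by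
    rintro ⟨a, b⟩ q ⟨hp, hq, rfl⟩ ⟨x, y⟩ hx hx'
    simp only [mem_unitSquare] at hx hx'
    push_cast at hx hx'
    have hxa : x = a + 1 := by linarith [hx.1.2, hx'.1.1]
    obtain ⟨h1, h2⟩ := r1 a b hp hq
    have h1' := congrArg (Int.cast : ℤ → ℝ) h1
    have h2' := congrArg (Int.cast : ℤ → ℝ) h2
    push_cast at h1' h2'
    simp only [bilin, cNE', cNW', cSE', cSW']
    rw [hxa]
    push_cast
    linear_combination (1 - (y - b)) * h1' + (y - b) * h2'
  have k2 : ∀ p q, VAdj S p q → ∀ x ∈ unitSquare p, x ∈ unitSquare q →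
      bilin c p x - bilin c q x = ((- v p q : ℤ) : ℝ) := by
    rintro ⟨a, b⟩ q ⟨hp, hq, rfl⟩ ⟨x, y⟩ hx hx'
    simp only [mem_unitSquare] at hx hx'
    push_cast at hx hx'
    have hya : y = b + 1 := by linarith [hx.2.2, hx'.2.1]
    obtain ⟨h1, h2⟩ := r2 a b hp hq
    have h1' := congrArg (Int.cast : ℤ → ℝ) h1
    have h2' := congrArg (Int.cast : ℤ → ℝ) h2
    push_cast at h1' h2'
    simp only [bilin, cNE', cNW', cSE', cSW']
    rw [hya]
    push_cast
    linear_combination (1 - (x - a)) * h1' + (x - a) * h2'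
  have kint : ∀ p ∈ S, ∀ q ∈ S, ∀ x ∈ unitSquare p, x ∈ unitSquare q →
      ∃ n : ℤ, bilin c p x - bilin c q x = n := by
    have aux : ∀ p ∈ S, ∀ q ∈ S, (p.1 < q.1 ∨ (p.1 = q.1 ∧ p.2 ≤ q.2)) →
        ∀ x ∈ unitSquare p, x ∈ unitSquare q → ∃ n : ℤ, bilin c p x - bilin c q x = n := by
      rintro ⟨a, b⟩ hp ⟨a', b'⟩ hq hlt ⟨x, y⟩ hx hx'
      have hx0 := hx
      have hx0' := hx'
      simp only [mem_unitSquare] at hx hx'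
      simp only at hlt
      have i1 : a' ≤ a + 1 := by
        have : (a' : ℝ) ≤ a + 1 := by linarith [hx.1.2, hx'.1.1]
        exact_mod_cast this
      have i2 : b' ≤ b + 1 := by
        have : (b' : ℝ) ≤ b + 1 := by linarith [hx.2.2, hx'.2.1]
        exact_mod_cast this
      have i3 : b ≤ b' + 1 := by
        have : (b : ℝ) ≤ b' + 1 := by linarith [hx'.2.2, hx.2.1]
        exact_mod_cast this
      rcases (by omega : (a' = a ∧ b' = b) ∨ (a' = a ∧ b' = b + 1) ∨ (a' = a + 1 ∧ b' = b) ∨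
        (a' = a + 1 ∧ b' = b + 1) ∨ (a' = a + 1 ∧ b = b' + 1)) with
        ⟨rfl, rfl⟩ | ⟨rfl, rfl⟩ | ⟨rfl, rfl⟩ | ⟨rfl, rfl⟩ | ⟨rfl, rfl⟩
      · exact ⟨0, by simp⟩
      · exact ⟨_, k2 _ _ ⟨hp, hq, rfl⟩ _ hx0 hx0'⟩
      · exact ⟨_, k1 _ _ ⟨hp, hq, rfl⟩ _ hx0 hx0'⟩
      · push_cast at hx hx'
        have hxa : x = a + 1 := by linarith [hx.1.2, hx'.1.1]
        have hya : y = b + 1 := by linarith [hx.2.2, hx'.2.1]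
        refine ⟨cSW (a + 1, b + 1) - cNE (a + 1, b + 1), ?_⟩
        simp only [bilin, cNE', cNW', cSE', cSW']
        rw [hxa, hya]
        push_cast
        ring
      · push_cast at hx hx'
        have hxa : x = a + 1 := by linarith [hx.1.2, hx'.1.1]
        have hya : y = b' + 1 := by linarith [hx.2.1, hx'.2.2]
        refine ⟨cNW (a + 1, b' + 1) - cSE (a + 1, b' + 1), ?_⟩
        simp only [bilin, cNE', cNW', cSE', cSW']
        rw [hxa, hya]
        push_cast
        ring
    intro p hp q hq x hx hx'
    by_cases hlt : (p.1 < q.1 ∨ (p.1 = q.1 ∧ p.2 ≤ q.2))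
    · exact aux p hp q hq hlt x hx hx'
    · obtain ⟨n, hn⟩ := aux q hq p hp (by omega) x hx' hx
      exact ⟨-n, by push_cast; linarith⟩
  have hmem : ∀ x : Region S, ∃ p ∈ S, (x : ℝ × ℝ) ∈ unitSquare p := by
    intro x
    have := x.2
    simpa [Region] using this
  choose P hPS hP using hmem
  let G : Region S → AddCircle (1 : ℝ) := fun x => ((bilin c (P x) x : ℝ) : AddCircle (1 : ℝ))
  have hG : ∀ p ∈ S, ∀ x : Region S, (x : ℝ × ℝ) ∈ unitSquare p →
      G x = ((bilin c p x : ℝ) : AddCircle (1 : ℝ)) := by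
    intro p hp x hx
    obtain ⟨n, hn⟩ := kint (P x) (hPS x) p hp x (hP x) hx
    rw [sub_eq_iff_eq_add] at hn
    simp only [G, hn, AddCircle.coe_add]
    have : ((n : ℝ) : AddCircle (1 : ℝ)) = 0 := by
      rw [AddCircle.coe_eq_zero_iff]
      exact ⟨n, by simp⟩
    rw [this, zero_add]
  have hGc : Continuous G := by
    refine LocallyFinite.continuous (f := fun p : S => {x : Region S | (x : ℝ × ℝ) ∈ unitSquare p})
      (locallyFinite_of_finite _) ?_ ?_ ?_
    · ext x
      simp only [Set.mem_iUnion, Set.mem_ofPred_eq, Set.mem_univ, iff_true]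
      exact ⟨⟨P x, hPS x⟩, hP x⟩
    · intro p
      have : IsClosed (unitSquare p) := isClosed_Icc.prod isClosed_Icc
      exact this.preimage continuous_subtype_val
    · intro p
      have : ContinuousOn (fun x : Region S => ((bilin c p x : ℝ) : AddCircle (1 : ℝ)))
          {x : Region S | (x : ℝ × ℝ) ∈ unitSquare p} := by
        apply Continuous.continuousOn
        exact (AddCircle.continuous_mk' 1).comp ((bilin_continuous c p).comp continuous_subtype_val)
      exact this.congr (fun x hx => hG p p.2 x hx)
  obtain ⟨θ, hθc, hθ⟩ := exists_lift_of_homeo e G hGc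
  have hsub : ∀ p ∈ S, unitSquare p ⊆ Region S := fun p hp =>
    Set.subset_biUnion_of_mem (u := unitSquare) hp
  have hn : ∀ p ∈ S, ∃ n : ℤ, ∀ x : Region S, (x : ℝ × ℝ) ∈ unitSquare p → θ x = bilin c p x + n := by
    intro p hp
    let ι : unitSquare p → Region S := Set.inclusion (hsub p hp)
    have hι : Continuous ι := continuous_inclusion _
    let g : unitSquare p → ℝ := fun x => θ (ι x) - bilin c p x
    have hg : Continuous g :=
      (hθc.comp hι).sub ((bilin_continuous c p).comp continuous_subtype_val)
    have hgi : ∀ x, ∃ n : ℤ, (n : ℝ) = g x := by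
      intro x
      have h1 := hθ (ι x)
      rw [hG p hp (ι x) x.2, ← sub_eq_zero, ← AddCircle.coe_sub, AddCircle.coe_eq_zero_iff] at h1
      obtain ⟨n, hn⟩ := h1
      exact ⟨n, by simpa using hn⟩
    have hpc : PreconnectedSpace (unitSquare p) := by
      apply Subtype.preconnectedSpace
      exact ((convex_Icc _ _).prod (convex_Icc _ _)).isPreconnected
    choose n hn using hgi
    have hnc : Continuous n := by
      rw [Int.isClosedEmbedding_coe_real.isEmbedding.continuous_iff]
      convert hg using 1
      ext x
      exact hn x
    have hcorner : ((p.1 : ℝ), (p.2 : ℝ)) ∈ unitSquare p := by simp [mem_unitSquare]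
    refine ⟨n ⟨_, hcorner⟩, fun x hx => ?_⟩
    have := PreconnectedSpace.constant hpc hnc (x := ⟨_, hcorner⟩) (y := ⟨x, hx⟩)
    rw [this, hn]
    simp [g, ι]
  choose! n hn using hn
  refine ⟨fun p => - n p, ?_, ?_⟩
  · intro p q hpq
    have hx : ((p.1 : ℝ) + 1, (p.2 : ℝ)) ∈ unitSquare p := by simp [mem_unitSquare]
    have hx' : ((p.1 : ℝ) + 1, (p.2 : ℝ)) ∈ unitSquare q := by
      rw [hpq.2.2]; simp [mem_unitSquare]
    have h1 := hn p hpq.1 ⟨_, hsub p hpq.1 hx⟩ hx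
    have h2 := hn q hpq.2.1 ⟨_, hsub p hpq.1 hx⟩ hx'
    have h3 := k1 p q hpq _ hx hx'
    have : ((h p q : ℤ) : ℝ) = n p - n q := by
      push_cast at h3
      simp only at h1 h2
      linarith
    have : h p q = n p - n q := by exact_mod_cast this
    linarith
  · intro p q hpq
    have hx : ((p.1 : ℝ), (p.2 : ℝ) + 1) ∈ unitSquare p := by simp [mem_unitSquare]
    have hx' : ((p.1 : ℝ), (p.2 : ℝ) + 1) ∈ unitSquare q := by
      rw [hpq.2.2]; simp [mem_unitSquare]
    have h1 := hn p hpq.1 ⟨_, hsub p hpq.1 hx⟩ hx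
    have h2 := hn q hpq.2.1 ⟨_, hsub p hpq.1 hx⟩ hx'
    have h3 := k2 p q hpq _ hx hx'
    have : ((v p q : ℤ) : ℝ) = n p - n q := by
      push_cast at h3
      simp only at h1 h2
      linarith
    have : v p q = n p - n q := by exact_mod_cast this
    linarith

theorem good_of_board {S : Finset Cell} (hS : IsBoard S) : Good S (HAdj S) (VAdj S) where
  e_mem := fun h => ⟨h.1, h.2.1⟩
  n_mem := fun h => ⟨h.1, h.2.1⟩
  e_col := by
    rintro ⟨a, b⟩ y ⟨-, -, rfl⟩
    simp only [IsBlackCell]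
    rw [show a + 1 + b = a + b + 1 by ring, Int.even_add_one, not_not]
  n_col := by
    rintro ⟨a, b⟩ y ⟨-, -, rfl⟩
    simp only [IsBlackCell]
    rw [show a + (b + 1) = a + b + 1 by ring, Int.even_add_one, not_not]
  e_fun := fun h h' => by rw [h.2.2, h'.2.2]
  e_inj := by
    rintro ⟨a, b⟩ ⟨c, d⟩ z ⟨-, -, h⟩ ⟨-, -, h'⟩
    rw [h] at h'
    simpa using h'
  n_fun := fun h h' => by rw [h.2.2, h'.2.2]
  n_inj := by
    rintro ⟨a, b⟩ ⟨c, d⟩ z ⟨-, -, h⟩ ⟨-, -, h'⟩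
    rw [h] at h'
    simpa using h'
  q1 := by
    rintro ⟨a1, a2⟩ ⟨b1, b2⟩ c d ⟨h1, h2, rfl⟩ ⟨h3, h4, rfl⟩ ⟨h5, h6, h7⟩
    refine ⟨h3, h1, ?_⟩
    simp_all
  q2 := by
    rintro a b c d ⟨h1, h2, rfl⟩ ⟨h3, h4, rfl⟩ ⟨h5, h6, rfl⟩
    exact ⟨h2, h6, rfl⟩
  q3 := by
    rintro ⟨a1, a2⟩ b c ⟨d1, d2⟩ ⟨h1, h2, rfl⟩ ⟨h3, h4, rfl⟩ ⟨h5, h6, h7⟩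
    refine ⟨h1, h5, ?_⟩
    simp_all
  q4 := by
    rintro a b c d ⟨h1, h2, rfl⟩ ⟨h3, h4, rfl⟩ ⟨h5, h6, rfl⟩
    exact ⟨h6, h4, rfl⟩
  h1 := by
    obtain ⟨-, ⟨e⟩⟩ := hS
    exact h1_of_homeo S e

/-- `y` is the bottom cell of the square with top cell `x`. -/
def SqBelow (E N : Cell → Cell → Prop) (x y : Cell) : Prop :=
  ∃ t r, E t x ∧ N r x ∧ N y t ∧ E y r

open Classical in
/-- Lower corners. -/
noncomputable def cornerDown (V : Finset Cell) (E N : Cell → Cell → Prop) : Finset Cell :=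
  V.filter fun x => (∀ y, ¬ E y x) ∧ (∀ y, ¬ N y x)

open Classical in
/-- Lower reflex cells. -/
noncomputable def reflexDown (V : Finset Cell) (E N : Cell → Cell → Prop) : Finset Cell :=
  V.filter fun x => (∃ y, E y x) ∧ (∃ y, N y x) ∧ ¬ ∃ y, SqBelow E N x y

theorem finrank_range_add_ker_int {M M' : Type*} [AddCommGroup M] [AddCommGroup M']
    [Module.Finite ℤ M] (f : M →ₗ[ℤ] M') :
    Module.finrank ℤ (LinearMap.range f) + Module.finrank ℤ (LinearMap.ker f) =
      Module.finrank ℤ M := by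
  rw [← f.quotKerEquivRange.finrank_eq]
  exact Submodule.finrank_quotient_add_finrank _

namespace Good

variable {V : Finset Cell} {E N : Cell → Cell → Prop}

theorem euler_aux (g : Good V E N) (hV : V.Nonempty) (TE TN TF : Finset Cell)
    (hTE : ∀ y, y ∈ TE ↔ ∃ x, E x y) (hTN : ∀ y, y ∈ TN ↔ ∃ x, N x y)
    (hTF : ∀ y, y ∈ TF ↔ ∃ x, SqBelow E N y x) :
    TE.card + TN.card + 1 ≤ V.card + TF.card := by
  classical
  choose! W hW using fun y => (hTE y).1
  choose! S hS using fun y => (hTN y).1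
  have vE : ∀ y ∈ TE, y ∈ V := fun y hy => (g.e_mem (hW y hy)).2
  have vN : ∀ y ∈ TN, y ∈ V := fun y hy => (g.n_mem (hS y hy)).2
  have vW : ∀ y ∈ TE, W y ∈ V := fun y hy => (g.e_mem (hW y hy)).1
  have vS : ∀ y ∈ TN, S y ∈ V := fun y hy => (g.n_mem (hS y hy)).1
  have hF : ∀ c ∈ TF, c ∈ TE ∧ c ∈ TN ∧ S c ∈ TE ∧ W c ∈ TN := by
    intro c hc
    obtain ⟨a, t, r, h1, h2, h3, h4⟩ := (hTF c).1 hc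
    have c1 : c ∈ TE := (hTE c).2 ⟨t, h1⟩
    have c2 : c ∈ TN := (hTN c).2 ⟨r, h2⟩
    have e1 : W c = t := g.e_inj (hW c c1) h1
    have e2 : S c = r := g.n_inj (hS c c2) h2
    exact ⟨c1, c2, by rw [e2]; exact (hTE r).2 ⟨a, h4⟩, by rw [e1]; exact (hTN t).2 ⟨a, h3⟩⟩
  let d0 : (V → ℤ) →ₗ[ℤ] ((TE → ℤ) × (TN → ℤ)) :=
    { toFun := fun f => (fun y => f ⟨y, vE y y.2⟩ - f ⟨W y, vW y y.2⟩,
        fun y => f ⟨y, vN y y.2⟩ - f ⟨S y, vS y y.2⟩)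
      map_add' := by intro f f'; ext y <;> simp <;> ring
      map_smul' := by intro f f'; ext y <;> simp <;> ring }
  let d1 : ((TE → ℤ) × (TN → ℤ)) →ₗ[ℤ] (TF → ℤ) :=
    { toFun := fun p c => p.1 ⟨S c, (hF c c.2).2.2.1⟩ + p.2 ⟨c, (hF c c.2).2.1⟩
        - p.2 ⟨W c, (hF c c.2).2.2.2⟩ - p.1 ⟨c, (hF c c.2).1⟩
      map_add' := by intro f f'; ext y; simp; ring
      map_smul' := by intro f f'; ext y; simp; ring }
  have hker : LinearMap.ker d1 ≤ LinearMap.range d0 := by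
    rintro ⟨h, v⟩ hp
    rw [LinearMap.mem_ker] at hp
    obtain ⟨f, hf1, hf2⟩ := g.h1 (fun _ y => if hy : y ∈ TE then h ⟨y, hy⟩ else 0)
      (fun _ y => if hy : y ∈ TN then v ⟨y, hy⟩ else 0) (by
        intro a b c d h1 h2 h3 h4
        have hc : c ∈ TF := (hTF c).2 ⟨a, d, b, h4, h2, h3, h1⟩
        obtain ⟨c1, c2, c3, c4⟩ := hF c hc
        have e1 : W c = d := g.e_inj (hW c c1) h4
        have e2 : S c = b := g.n_inj (hS c c2) h2
        have := congrFun hp ⟨c, hc⟩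
        simp only [d1, LinearMap.coe_mk, AddHom.coe_mk, e1, e2, Pi.zero_apply] at this
        rw [e1] at c4
        rw [e2] at c3
        simp only [c1, c2, c3, c4, dif_pos]
        linarith)
    refine ⟨fun x => f x, ?_⟩
    ext y
    · have := hf1 _ _ (hW y y.2)
      simp only [y.2, dif_pos] at this
      simp [d0, this]
    · have := hf2 _ _ (hS y y.2)
      simp only [y.2, dif_pos] at this
      simp [d0, this]
  have hk0 : 1 ≤ Module.finrank ℤ (LinearMap.ker d0) := by
    rw [Nat.succ_le_iff, Module.finrank_pos_iff]
    obtain ⟨x0, hx0⟩ := hV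
    refine ⟨⟨⟨fun _ => 1, ?_⟩, 0, ?_⟩⟩
    · rw [LinearMap.mem_ker]
      ext y <;> simp [d0]
    · intro h
      have := congrFun (congrArg Subtype.val h) ⟨x0, hx0⟩
      simp at this
  have r0 := finrank_range_add_ker_int d0
  have r1 := finrank_range_add_ker_int d1
  have r2 := Submodule.finrank_mono hker
  have r3 := Submodule.finrank_le (LinearMap.range d1)
  simp only [Module.finrank_prod, Module.finrank_fintype_fun_eq_card, Fintype.card_coe] at r0 r1 r3
  omega

theorem euler (g : Good V E N) (hV : V.Nonempty) :
    (reflexDown V E N).card + 1 ≤ (cornerDown V E N).card := by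
  classical
  have h := g.euler_aux hV (V.filter fun y => ∃ x, E x y) (V.filter fun y => ∃ x, N x y)
    (V.filter fun y => ∃ x, SqBelow E N y x)
    (fun y => by
      simp only [Finset.mem_filter, and_iff_right_iff_imp]
      rintro ⟨x, hx⟩; exact (g.e_mem hx).2)
    (fun y => by
      simp only [Finset.mem_filter, and_iff_right_iff_imp]
      rintro ⟨x, hx⟩; exact (g.n_mem hx).2)
    (fun y => by
      simp only [Finset.mem_filter, and_iff_right_iff_imp]
      rintro ⟨x, t, r, hx, -⟩; exact (g.e_mem hx).2)
  have key : (V.filter fun y => ∃ x, E x y).card + (V.filter fun y => ∃ x, N x y).card +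
      (cornerDown V E N).card = V.card + (V.filter fun y => ∃ x, SqBelow E N y x).card +
      (reflexDown V E N).card := by
    simp only [cornerDown, reflexDown, Finset.card_filter, Finset.card_eq_sum_ones V]
    rw [← Finset.sum_add_distrib, ← Finset.sum_add_distrib, ← Finset.sum_add_distrib,
      ← Finset.sum_add_distrib]
    refine Finset.sum_congr rfl fun x _ => ?_
    have hsq : (∃ y, SqBelow E N x y) → (∃ y, E y x) ∧ (∃ y, N y x) := by
      rintro ⟨y, t, r, h1, h2, -⟩
      exact ⟨⟨t, h1⟩, ⟨r, h2⟩⟩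
    rw [← not_exists, ← not_exists]
    by_cases h1 : ∃ y, E y x <;> by_cases h2 : ∃ y, N y x <;>
      by_cases h3 : ∃ y, SqBelow E N x y <;> simp only [h1, h2, h3, if_true, if_false, and_true,
        true_and, not_true, not_false_iff, and_false, false_and]
    all_goals exact absurd (hsq h3) (by tauto)
  omega

end Good

/-- A diagonal strip of squares starting at an upper corner and ending at a cell without
a lower vertical neighbour. -/
structure Strip (V : Finset Cell) (E N : Cell → Cell → Prop) (m : ℕ) (s t r : ℕ → Cell) :
    Prop where
  mem0 : s 0 ∈ V
  noE : ∀ y, ¬ E (s 0) y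
  noN : ∀ y, ¬ N (s 0) y
  ts : ∀ i < m, E (t i) (s i)
  rs : ∀ i < m, N (r i) (s i)
  st : ∀ i < m, N (s (i+1)) (t i)
  sr : ∀ i < m, E (s (i+1)) (r i)
  noS : ∀ x, ¬ N x (s m)

theorem chain_of_reflTransGen {R : Cell → Cell → Prop} {x e : Cell}
    (h : Relation.ReflTransGen R x e) :
    ∃ (m : ℕ) (s : ℕ → Cell), s 0 = x ∧ s m = e ∧ ∀ i < m, R (s i) (s (i+1)) := by
  induction h with
  | refl => exact ⟨0, fun _ => x, rfl, rfl, by simp⟩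
  | @tail b c _ hbc ih =>
    obtain ⟨m, s, h0, hm, hR⟩ := ih
    refine ⟨m + 1, fun i => if i ≤ m then s i else c, by simp [h0], by simp, ?_⟩
    intro i hi
    rcases Nat.lt_succ_iff_lt_or_eq.1 hi with h | rfl
    · simp only [h.le, if_true, Nat.succ_le_of_lt h]
      exact hR i h
    · simpa [hm] using hbc

theorem Good.exists_strip_of_card {V : Finset Cell} {E N : Cell → Cell → Prop} (g : Good V E N)
    (h : (reflexDown V E N).card <
      (cornerDown V (fun x y => E y x) (fun x y => N y x)).card) :
    ∃ m s t r, Strip V E N m s t r ∨ Strip V N E m s t r := by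
  classical
  obtain ⟨lv, lvE, lvN⟩ := g.exists_level
  have hlv : ∀ x y, SqBelow E N x y → lv y < lv x := by
    rintro x y ⟨t, r, h1, h2, h3, h4⟩
    have := lvE _ _ h1
    have := lvN _ _ h3
    omega
  have hinj : ∀ x x' y, SqBelow E N x y → SqBelow E N x' y → x = x' := by
    rintro x x' y ⟨t, r, h1, h2, h3, h4⟩ ⟨t', r', h1', h2', h3', h4'⟩
    have := g.n_fun h3 h3'
    subst this
    exact g.e_fun h1 h1'
  have hend : ∀ x ∈ V, ∃ e ∈ V, Relation.ReflTransGen (SqBelow E N) x e ∧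
      ¬ ∃ y, SqBelow E N e y := by
    intro x hx
    obtain ⟨e, he, hmin⟩ := Finset.exists_min_image
      (V.filter fun y => Relation.ReflTransGen (SqBelow E N) x y) lv
      ⟨x, Finset.mem_filter.2 ⟨hx, .refl⟩⟩
    obtain ⟨heV, hxe⟩ := Finset.mem_filter.1 he
    refine ⟨e, heV, hxe, ?_⟩
    rintro ⟨y, hy⟩
    have hyV : y ∈ V := by
      obtain ⟨t, r, h1, h2, h3, h4⟩ := hy
      exact (g.n_mem h3).1
    have := hmin y (Finset.mem_filter.2 ⟨hyV, hxe.tail hy⟩)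
    have := hlv _ _ hy
    omega
  choose! en hen hre hno using hend
  obtain ⟨x, hx, hxR⟩ : ∃ x ∈ cornerDown V (fun x y => E y x) (fun x y => N y x),
      en x ∉ reflexDown V E N := by
    by_contra hcon
    push Not at hcon
    refine absurd (Finset.card_le_card_of_injOn en hcon ?_) (not_le.2 h)
    intro x hx x' hx' hee
    have hx := Finset.mem_filter.1 (Finset.mem_coe.1 hx)
    have hx' := Finset.mem_filter.1 (Finset.mem_coe.1 hx')
    have r1 := hre x hx.1
    have r2 := hre x' hx'.1
    rw [← hee] at r2
    have r1' := Relation.reflTransGen_swap.2 r1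
    have r2' := Relation.reflTransGen_swap.2 r2
    have hU : Relator.RightUnique (Function.swap (SqBelow E N)) := fun a b c h h' => hinj _ _ _ h h'
    have noPred : ∀ z w, (∀ y, ¬ E w y) → ¬ SqBelow E N z w := by
      rintro z w hw ⟨t, r, h1, h2, h3, h4⟩
      exact hw _ h4
    have hfin : ∀ z w, (∀ y, ¬ E w y) → Relation.ReflTransGen (Function.swap (SqBelow E N)) w z →
        w = z := by
      intro z w hw hr
      rcases Relation.ReflTransGen.cases_head hr with h | ⟨c, hc, -⟩
      · exact h
      · exact absurd hc (noPred _ _ hw)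
    rcases Relation.ReflTransGen.total_of_right_unique hU r1' r2' with h | h
    · exact hfin _ _ hx.2.1 h
    · exact (hfin _ _ hx'.2.1 h).symm
  obtain ⟨hxV, hxE, hxN⟩ := Finset.mem_filter.1 hx
  obtain ⟨m, s, h0, hm, hs⟩ := chain_of_reflTransGen (hre x hxV)
  choose! t r h1 h2 h3 h4 using hs
  refine ⟨m, s, ?_⟩
  have hor : (∀ y, ¬ N y (en x)) ∨ (∀ y, ¬ E y (en x)) := by
    by_contra hcon
    push Not at hcon
    exact hxR (Finset.mem_filter.2 ⟨hen x hxV, hcon.2, hcon.1, hno x hxV⟩)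
  rcases hor with hor | hor
  · exact ⟨t, r, Or.inl ⟨h0 ▸ hxV, h0 ▸ hxE, h0 ▸ hxN, h1, h2, h3, h4, hm ▸ hor⟩⟩
  · exact ⟨r, t, Or.inr ⟨h0 ▸ hxV, h0 ▸ hxN, h0 ▸ hxE, h2, h1, h4, h3, hm ▸ hor⟩⟩

theorem Good.exists_strip {V : Finset Cell} {E N : Cell → Cell → Prop} (g : Good V E N)
    (hV : V.Nonempty) :
    ∃ m s t r, Strip V E N m s t r ∨ Strip V N E m s t r ∨
      Strip V (fun x y => E y x) (fun x y => N y x) m s t r ∨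
      Strip V (fun x y => N y x) (fun x y => E y x) m s t r := by
  have h1 := g.euler hV
  have h2 := g.rev.euler hV
  by_cases h : (reflexDown V E N).card <
      (cornerDown V (fun x y => E y x) (fun x y => N y x)).card
  · obtain ⟨m, s, t, r, h⟩ := g.exists_strip_of_card h
    exact ⟨m, s, t, r, by tauto⟩
  · obtain ⟨m, s, t, r, h⟩ := g.rev.exists_strip_of_card
      (show _ < (cornerDown V E N).card by omega)
    exact ⟨m, s, t, r, by tauto⟩

namespace Strip

variable {V : Finset Cell} {E N : Cell → Cell → Prop} {m : ℕ} {s t r : ℕ → Cell}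

theorem s_mem (st : Strip V E N m s t r) (g : Good V E N) {i : ℕ} (hi : i ≤ m) : s i ∈ V := by
  rcases i with _ | i
  · exact st.mem0
  · exact (g.n_mem (st.st i hi)).1

theorem t_mem (st : Strip V E N m s t r) (g : Good V E N) {i : ℕ} (hi : i < m) : t i ∈ V :=
  (g.e_mem (st.ts i hi)).1

theorem r_mem (st : Strip V E N m s t r) (g : Good V E N) {i : ℕ} (hi : i < m) : r i ∈ V :=
  (g.n_mem (st.rs i hi)).1

/-- Levels along a strip. -/
theorem levels (st : Strip V E N m s t r) (g : Good V E N) :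
    ∃ lv : Cell → ℤ, (∀ x y, E x y → lv y = lv x + 1) ∧ (∀ x y, N x y → lv y = lv x + 1) ∧
      (∀ i ≤ m, lv (s i) = - 2 * i) ∧ (∀ i < m, lv (t i) = - 2 * i - 1) ∧
      (∀ i < m, lv (r i) = - 2 * i - 1) := by
  obtain ⟨lv, lE, lN⟩ := g.exists_level
  have hs : ∀ i ≤ m, lv (s i) = lv (s 0) - 2 * i := by
    intro i
    induction i with
    | zero => intro _; simp
    | succ i ih =>
      intro hi
      have h1 := ih (by omega)
      have h2 := lE _ _ (st.ts i hi)
      have h3 := lN _ _ (st.st i hi)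
      push_cast
      omega
  refine ⟨fun x => lv x - lv (s 0), fun x y h => by have := lE x y h; simp only; omega,
    fun x y h => by have := lN x y h; simp only; omega, fun i hi => by have := hs i hi; simp only; omega,
    fun i hi => ?_, fun i hi => ?_⟩
  · have h1 := hs i hi.le
    have h2 := lE _ _ (st.ts i hi)
    simp only
    omega
  · have h1 := hs i hi.le
    have h2 := lN _ _ (st.rs i hi)
    simp only
    omega

theorem distinct (st : Strip V E N m s t r) (g : Good V E N) :
    (∀ i ≤ m, ∀ j ≤ m, s i = s j → i = j) ∧ (∀ i < m, ∀ j < m, t i = t j → i = j) ∧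
    (∀ i < m, ∀ j < m, r i = r j → i = j) ∧ (∀ i ≤ m, ∀ j < m, s i ≠ t j) ∧
    (∀ i ≤ m, ∀ j < m, s i ≠ r j) ∧ (∀ i < m, ∀ j < m, t i ≠ r j) := by
  obtain ⟨lv, lE, lN, ls, lt, lr⟩ := st.levels g
  refine ⟨?_, ?_, ?_, ?_, ?_, ?_⟩
  · intro i hi j hj h
    have h1 := ls i hi
    rw [h, ls j hj] at h1
    omega
  · intro i hi j hj h
    have h1 := lt i hi
    rw [h, lt j hj] at h1
    omega
  · intro i hi j hj h
    have h1 := lr i hi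
    rw [h, lr j hj] at h1
    omega
  · intro i hi j hj h
    have h1 := ls i hi
    rw [h, lt j hj] at h1
    omega
  · intro i hi j hj h
    have h1 := ls i hi
    rw [h, lr j hj] at h1
    omega
  · intro i hi j hj h
    have h1 := lt i hi
    rw [h, lr j hj] at h1
    obtain rfl : i = j := by omega
    have h2 := st.ts i hi
    rw [h] at h2
    exact g.en_disj h2 (st.rs i hi)

/-- out-neighbours of `s i`. -/
theorem E_s (st : Strip V E N m s t r) (g : Good V E N) {i : ℕ} (hi : i ≤ m) {y : Cell}
    (h : E (s i) y) : ∃ j, i = j + 1 ∧ y = r j := by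
  rcases i with _ | j
  · exact absurd h (st.noE y)
  · exact ⟨j, rfl, g.e_fun h (st.sr j hi)⟩

theorem N_s (st : Strip V E N m s t r) (g : Good V E N) {i : ℕ} (hi : i ≤ m) {y : Cell}
    (h : N (s i) y) : ∃ j, i = j + 1 ∧ y = t j := by
  rcases i with _ | j
  · exact absurd h (st.noN y)
  · exact ⟨j, rfl, g.n_fun h (st.st j hi)⟩

theorem to_s_N (st : Strip V E N m s t r) (g : Good V E N) {i : ℕ} (hi : i ≤ m) {x : Cell}
    (h : N x (s i)) : i < m ∧ x = r i := by
  rcases hi.lt_or_eq with h' | rfl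
  · exact ⟨h', g.n_inj h (st.rs i h')⟩
  · exact absurd h (st.noS x)

theorem to_s_E (st : Strip V E N m s t r) (g : Good V E N) (noW : ∀ x, ¬ E x (s m))
    {i : ℕ} (hi : i ≤ m) {x : Cell} (h : E x (s i)) : i < m ∧ x = t i := by
  rcases hi.lt_or_eq with h' | rfl
  · exact ⟨h', g.e_inj h (st.ts i h')⟩
  · exact absurd h (noW x)

end Strip

theorem exists_relabel {m : ℕ} (r t : ℕ → Cell) (hr : ∀ i < m, ∀ j < m, r i = r j → i = j) :
    ∃ τ : Cell → Cell, (∀ i < m, τ (r i) = t i) ∧ (∀ y, (∀ i < m, y ≠ r i) → τ y = y) := by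
  classical
  refine ⟨fun y => if h : ∃ i, i < m ∧ y = r i then t h.choose else y, ?_, ?_⟩
  · intro i hi
    have h : ∃ j, j < m ∧ r i = r j := ⟨i, hi, rfl⟩
    simp only [h, dif_pos]
    have := hr i hi _ h.choose_spec.1 h.choose_spec.2
    rw [← this]
  · intro y hy
    refine dif_neg ?_
    rintro ⟨i, hi, h⟩
    exact hy i hi h

section Collapse

variable {V : Finset Cell} {E N : Cell → Cell → Prop} {m : ℕ} {s t r : ℕ → Cell}

open Classical in
/-- Vertices remaining after collapsing a strip. -/
noncomputable def colV (V : Finset Cell) (m : ℕ) (s t : ℕ → Cell) : Finset Cell :=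
  V.filter fun x => (∀ i ≤ m, x ≠ s i) ∧ (∀ i < m, x ≠ t i)

/-- Horizontal edges after collapsing a strip. -/
def colE (V' : Finset Cell) (E : Cell → Cell → Prop) (τ : Cell → Cell) (x y : Cell) : Prop :=
  x ∈ V' ∧ y ∈ V' ∧ E x (τ y)
/-- Vertical edges after collapsing a strip. -/
def colN (V' : Finset Cell) (N : Cell → Cell → Prop) (τ : Cell → Cell) (x y : Cell) : Prop :=
  x ∈ V' ∧ y ∈ V' ∧ N (τ x) y

theorem mem_colV {x : Cell} : x ∈ colV V m s t ↔
    x ∈ V ∧ (∀ i ≤ m, x ≠ s i) ∧ (∀ i < m, x ≠ t i) := by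
  simp [colV]

theorem collapse_h1 (g : Good V E N) (st : Strip V E N m s t r) (noW : ∀ x, ¬ E x (s m))
    (τ : Cell → Cell) (hτ : ∀ i < m, τ (r i) = t i) (hτ' : ∀ y, (∀ i < m, y ≠ r i) → τ y = y)
    (h' v' : Cell → Cell → ℤ)
    (H : ∀ a b c d, colE (colV V m s t) E τ a b → colN (colV V m s t) N τ b c →
      colN (colV V m s t) N τ a d → colE (colV V m s t) E τ d c →
      h' a b + v' b c = v' a d + h' d c) :
    ∃ f : Cell → ℤ, (∀ x y, colE (colV V m s t) E τ x y → h' x y = f y - f x) ∧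
      (∀ x y, colN (colV V m s t) N τ x y → v' x y = f y - f x) := by
  classical
  obtain ⟨s_inj, t_inj, r_inj, st_ne, sr_ne, tr_ne⟩ := st.distinct g
  obtain ⟨ρ, hρ, hρ'⟩ := exists_relabel (m := m) t r t_inj
  obtain ⟨idx, hidx, -⟩ : ∃ idx : Cell → ℕ, (∀ i ≤ m, idx (s i) = i) ∧ True := by
    obtain ⟨lv, lE, lN, ls, lt, lr⟩ := st.levels g
    refine ⟨fun x => (- lv x / 2).toNat, fun i hi => ?_, trivial⟩
    have := ls i hi
    simp only [this]
    omega
  have rV : ∀ i < m, r i ∈ colV V m s t := fun i hi => mem_colV.2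
    ⟨st.r_mem g hi, fun j hj h => sr_ne j hj i hi h.symm, fun j hj h => tr_ne j hj i hi h.symm⟩
  -- a cell of V which is not an `s` relabels into V'
  have ρV : ∀ x ∈ V, (∀ i ≤ m, x ≠ s i) → ρ x ∈ colV V m s t ∧ τ (ρ x) = x ∨
      ∃ i < m, x = r i := by
    intro x hx hxs
    by_cases hxt : ∃ i, i < m ∧ x = t i
    · obtain ⟨i, hi, rfl⟩ := hxt
      left
      rw [hρ i hi]
      exact ⟨rV i hi, hτ i hi⟩
    · by_cases hxr : ∃ i, i < m ∧ x = r i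
      · exact Or.inr hxr
      · push Not at hxt hxr
        left
        rw [hρ' x hxt]
        exact ⟨mem_colV.2 ⟨hx, hxs, hxt⟩, hτ' x hxr⟩
  -- the two kinds of edges not touching `s`
  have eV : ∀ x y, E x y → (∀ i ≤ m, x ≠ s i) → (∀ i ≤ m, y ≠ s i) →
      x ∈ colV V m s t ∧ (∀ i < m, y ≠ r i) ∧ colE (colV V m s t) E τ x (ρ y) := by
    intro x y hxy hx hy
    have hx' : x ∈ colV V m s t := by
      refine mem_colV.2 ⟨(g.e_mem hxy).1, hx, ?_⟩
      rintro i hi rfl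
      exact hy i hi.le (g.e_fun hxy (st.ts i hi))
    have hyr : ∀ i < m, y ≠ r i := by
      rintro i hi rfl
      exact hx (i+1) hi (g.e_inj hxy (st.sr i hi))
    refine ⟨hx', hyr, hx', ?_⟩
    rcases ρV y (g.e_mem hxy).2 hy with ⟨h1, h2⟩ | ⟨i, hi, h⟩
    · exact ⟨h1, by rwa [h2]⟩
    · exact absurd h (hyr i hi)
  have nV : ∀ x y, N x y → (∀ i ≤ m, x ≠ s i) → (∀ i ≤ m, y ≠ s i) →
      y ∈ colV V m s t ∧ (∀ i < m, x ≠ r i) ∧ colN (colV V m s t) N τ (ρ x) y := by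
    intro x y hxy hx hy
    have hy' : y ∈ colV V m s t := by
      refine mem_colV.2 ⟨(g.n_mem hxy).2, hy, ?_⟩
      rintro i hi rfl
      exact hx (i+1) hi (g.n_inj hxy (st.st i hi))
    have hxr : ∀ i < m, x ≠ r i := by
      rintro i hi rfl
      exact hy i hi.le (g.n_fun hxy (st.rs i hi))
    refine ⟨hy', hxr, ?_⟩
    rcases ρV x (g.n_mem hxy).1 hx with ⟨h1, h2⟩ | ⟨i, hi, h⟩
    · exact ⟨h1, hy', by rwa [h2]⟩
    · exact absurd h (hxr i hi)
  have rs_ne : ∀ i < m, ∀ j ≤ m, r i ≠ s j := fun i hi j hj h => sr_ne j hj i hi h.symm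
  have ts_ne : ∀ i < m, ∀ j ≤ m, t i ≠ s j := fun i hi j hj h => st_ne j hj i hi h.symm
  -- level arguments: neighbours of t and r inside are not `s` unless forced
  have Nt_ne : ∀ i < m, ∀ X, N (t i) X → ∀ j ≤ m, X ≠ s j := by
    rintro i hi X hX j hj rfl
    obtain ⟨h1, h2⟩ := st.to_s_N g hj hX
    exact tr_ne i hi j h1 h2
  have Er_ne : ∀ i < m, ∀ X, E (r i) X → ∀ j ≤ m, X ≠ s j := by
    rintro i hi X hX j hj rfl
    obtain ⟨h1, h2⟩ := st.to_s_E g noW hj hX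
    exact tr_ne j h1 i hi h2.symm
  have hc : ∀ j : ℕ, ∃ cj : ℤ, j + 1 < m →
      (∀ X, N (t (j+1)) X → cj = v' (r (j+1)) X + h' X (r j)) ∧
      (∀ b, E (r (j+1)) b → cj = h' (r (j+1)) (ρ b) + v' (ρ b) (r j)) := by
    intro j
    by_cases hj : j + 1 < m
    swap
    · exact ⟨0, fun h => absurd h hj⟩
    by_cases hX : ∃ X, N (t (j+1)) X
    · obtain ⟨X, hX⟩ := hX
      refine ⟨v' (r (j+1)) X + h' X (r j), fun _ => ⟨?_, ?_⟩⟩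
      · intro X' hX'
        rw [g.n_fun hX hX']
      · intro b hb
        have h1 := eV _ _ hb (rs_ne _ hj) (Er_ne _ hj b hb)
        have hbr : N b (r j) := g.q2 hb (st.rs _ hj) (st.sr j (by omega))
        have h2 := nV _ _ hbr (Er_ne _ hj b hb) (rs_ne _ (by omega))
        have hXt : E X (t j) := g.q4 (st.ts _ hj) (st.st j (by omega)) hX
        have h3 := nV _ _ hX (ts_ne _ hj) (Nt_ne _ hj X hX)
        have h4 := eV _ _ hXt (Nt_ne _ hj X hX) (ts_ne _ (by omega))
        have h5 := H (r (j+1)) (ρ b) (r j) X h1.2.2 h2.2.2 (by rw [← hρ _ hj]; exact h3.2.2)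
          (by rw [← hρ j (by omega)]; exact h4.2.2)
        exact h5.symm
    · by_cases hY : ∃ b, E (r (j+1)) b
      · obtain ⟨b, hb⟩ := hY
        refine ⟨h' (r (j+1)) (ρ b) + v' (ρ b) (r j), fun _ => ⟨?_, ?_⟩⟩
        · intro X h; exact absurd ⟨X, h⟩ hX
        · intro b' hb'
          rw [g.e_fun hb hb']
      · exact ⟨0, fun _ => ⟨fun X h => absurd ⟨X, h⟩ hX, fun b h => absurd ⟨b, h⟩ hY⟩⟩
  choose c hc using hc
  let isS : Cell → Prop := fun x => ∃ i, i ≤ m ∧ x = s i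
  let h : Cell → Cell → ℤ := fun x y =>
    if isS y then 0 else if isS x then c (idx x - 1) else h' x (ρ y)
  let v : Cell → Cell → ℤ := fun x y =>
    if isS y then 0 else if isS x then c (idx x - 1) else v' (ρ x) y
  have hs0 : ∀ x i, i ≤ m → h x (s i) = 0 := fun x i hi => if_pos ⟨i, hi, rfl⟩
  have vs0 : ∀ x i, i ≤ m → v x (s i) = 0 := fun x i hi => if_pos ⟨i, hi, rfl⟩
  have hsr : ∀ i < m, h (s (i+1)) (r i) = c i := by
    intro i hi
    have h1 : ¬ isS (r i) := by rintro ⟨j, hj, h⟩; exact rs_ne i hi j hj h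
    have h2 : isS (s (i+1)) := ⟨i+1, hi, rfl⟩
    simp only [h, h1, h2, if_true, if_false, hidx (i+1) hi, Nat.add_sub_cancel]
  have vst : ∀ i < m, v (s (i+1)) (t i) = c i := by
    intro i hi
    have h1 : ¬ isS (t i) := by rintro ⟨j, hj, h⟩; exact ts_ne i hi j hj h
    have h2 : isS (s (i+1)) := ⟨i+1, hi, rfl⟩
    simp only [v, h1, h2, if_true, if_false, hidx (i+1) hi, Nat.add_sub_cancel]
  have hh : ∀ x y, (∀ i ≤ m, x ≠ s i) → (∀ i ≤ m, y ≠ s i) → h x y = h' x (ρ y) := by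
    intro x y hx hy
    have h1 : ¬ isS x := by rintro ⟨j, hj, h⟩; exact hx j hj h
    have h2 : ¬ isS y := by rintro ⟨j, hj, h⟩; exact hy j hj h
    simp only [h, h1, h2, if_false]
  have vv : ∀ x y, (∀ i ≤ m, x ≠ s i) → (∀ i ≤ m, y ≠ s i) → v x y = v' (ρ x) y := by
    intro x y hx hy
    have h1 : ¬ isS x := by rintro ⟨j, hj, h⟩; exact hx j hj h
    have h2 : ¬ isS y := by rintro ⟨j, hj, h⟩; exact hy j hj h
    simp only [v, h1, h2, if_false]
  have caseA : ∀ i ≤ m, ∀ b c d, E (s i) b → N b c → N (s i) d → E d c →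
      h (s i) b + v b c = v (s i) d + h d c := by
    intro i hi b c' d h1 h2 h3 h4
    obtain ⟨j, rfl, rfl⟩ := st.E_s g hi h1
    obtain ⟨j', hj', rfl⟩ := st.N_s g hi h3
    obtain rfl : j = j' := by omega
    have : c' = s j := g.e_fun h4 (st.ts j hi)
    subst this
    rw [hs0 _ j (by omega), vs0 _ j (by omega), hsr j hi, vst j hi]
  obtain ⟨f, hf1, hf2⟩ := g.h1 h v (by
    intro a b c' d h1 h2 h3 h4
    by_cases ha : isS a
    · obtain ⟨i, hi, rfl⟩ := ha
      exact caseA i hi b c' d h1 h2 h3 h4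
    by_cases hcs : isS c'
    · obtain ⟨i, hi, rfl⟩ := hcs
      obtain ⟨hi', rfl⟩ := st.to_s_E g noW hi h4
      have : a = s (i+1) := g.n_inj h3 (st.st i hi')
      exact absurd ⟨i+1, hi', this⟩ ha
    by_cases hb : isS b
    · obtain ⟨i, hi, rfl⟩ := hb
      obtain ⟨j, rfl, rfl⟩ := st.N_s g hi h2
      obtain ⟨hi', rfl⟩ := st.to_s_E g noW hi h1
      rw [hs0 _ _ hi, vst j (by omega), vv _ _ (ts_ne _ hi') (Nt_ne _ hi' d h3),
        hh _ _ (Nt_ne _ hi' d h3) (ts_ne _ (by omega)), hρ _ hi', hρ j (by omega), zero_add]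
      exact (hc j hi').1 d h3
    by_cases hd : isS d
    · obtain ⟨i, hi, rfl⟩ := hd
      obtain ⟨j, rfl, rfl⟩ := st.E_s g hi h4
      obtain ⟨hi', rfl⟩ := st.to_s_N g hi h3
      rw [vs0 _ _ hi, hsr j (by omega), hh _ _ (rs_ne _ hi') (Er_ne _ hi' b h1),
        vv _ _ (Er_ne _ hi' b h1) (rs_ne _ (by omega)), zero_add]
      exact ((hc j hi').2 b h1).symm
    have ha : ∀ i ≤ m, a ≠ s i := fun i hi h => ha ⟨i, hi, h⟩
    have hb : ∀ i ≤ m, b ≠ s i := fun i hi h => hb ⟨i, hi, h⟩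
    have hcs : ∀ i ≤ m, c' ≠ s i := fun i hi h => hcs ⟨i, hi, h⟩
    have hd : ∀ i ≤ m, d ≠ s i := fun i hi h => hd ⟨i, hi, h⟩
    rw [hh _ _ ha hb, hh _ _ hd hcs, vv _ _ hb hcs, vv _ _ ha hd]
    have g1 := eV _ _ h1 ha hb
    have g2 := nV _ _ h2 hb hcs
    have g3 := nV _ _ h3 ha hd
    have g4 := eV _ _ h4 hd hcs
    have e1 : ρ a = a := hρ' a (mem_colV.1 g1.1).2.2
    have e2 : ρ c' = c' := hρ' c' (mem_colV.1 g2.1).2.2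
    rw [e1] at g3 ⊢
    rw [e2] at g4 ⊢
    exact H _ _ _ _ g1.2.2 g2.2.2 g3.2.2 g4.2.2)
  have ft : ∀ i < m, f (t i) = f (s i) := by
    intro i hi
    have := hf1 _ _ (st.ts i hi)
    rw [hs0 _ _ hi.le] at this
    omega
  have fr : ∀ i < m, f (r i) = f (s i) := by
    intro i hi
    have := hf2 _ _ (st.rs i hi)
    rw [vs0 _ _ hi.le] at this
    omega
  have fτ : ∀ y, f (τ y) = f y := by
    intro y
    by_cases hy : ∃ i, i < m ∧ y = r i
    · obtain ⟨i, hi, rfl⟩ := hy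
      rw [hτ i hi, ft i hi, fr i hi]
    · push Not at hy
      rw [hτ' y hy]
  have τs : ∀ y ∈ colV V m s t, (∀ i ≤ m, τ y ≠ s i) ∧ ρ (τ y) = y := by
    intro y hy
    obtain ⟨hyV, hys, hyt⟩ := mem_colV.1 hy
    by_cases hyr : ∃ i, i < m ∧ y = r i
    · obtain ⟨i, hi, rfl⟩ := hyr
      rw [hτ i hi, hρ i hi]
      exact ⟨ts_ne i hi, rfl⟩
    · push Not at hyr
      rw [hτ' y hyr, hρ' y hyt]
      exact ⟨hys, rfl⟩
  refine ⟨f, ?_, ?_⟩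
  · rintro x y ⟨hx, hy, hxy⟩
    have h1 := hf1 _ _ hxy
    rw [hh _ _ (mem_colV.1 hx).2.1 (τs y hy).1, (τs y hy).2, fτ] at h1
    exact h1
  · rintro x y ⟨hx, hy, hxy⟩
    have h1 := hf2 _ _ hxy
    rw [vv _ _ (τs x hx).1 (mem_colV.1 hy).2.1, (τs x hx).2, fτ] at h1
    exact h1

end Collapse

section Collapse2

variable {V : Finset Cell} {E N : Cell → Cell → Prop} {m : ℕ} {s t r : ℕ → Cell}

theorem collapse_good (g : Good V E N) (st : Strip V E N m s t r) (noW : ∀ x, ¬ E x (s m))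
    (τ : Cell → Cell) (hτ : ∀ i < m, τ (r i) = t i) (hτ' : ∀ y, (∀ i < m, y ≠ r i) → τ y = y) :
    Good (colV V m s t) (colE (colV V m s t) E τ) (colN (colV V m s t) N τ) := by
  classical
  obtain ⟨s_inj, t_inj, r_inj, st_ne, sr_ne, tr_ne⟩ := st.distinct g
  -- the dichotomy for τ
  have dich : ∀ y, (∃ i < m, y = r i ∧ τ y = t i) ∨ ((∀ i < m, y ≠ r i) ∧ τ y = y) := by
    intro y
    by_cases h : ∃ i, i < m ∧ y = r i
    · obtain ⟨i, hi, rfl⟩ := h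
      exact Or.inl ⟨i, hi, rfl, hτ i hi⟩
    · push Not at h
      exact Or.inr ⟨h, hτ' y h⟩
  have τcol : ∀ y, IsBlackCell (τ y) ↔ IsBlackCell y := by
    intro y
    rcases dich y with ⟨i, hi, rfl, h⟩ | ⟨-, h⟩
    · rw [h]
      have h1 := g.e_col (st.ts i hi)
      have h2 := g.n_col (st.rs i hi)
      tauto
    · rw [h]
  have τinj : ∀ x ∈ colV V m s t, ∀ y ∈ colV V m s t, τ x = τ y → x = y := by
    intro x hx y hy h
    have hx' := (mem_colV.1 hx).2.2
    have hy' := (mem_colV.1 hy).2.2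
    rcases dich x with ⟨i, hi, rfl, h1⟩ | ⟨-, h1⟩ <;> rcases dich y with ⟨j, hj, rfl, h2⟩ | ⟨-, h2⟩
    · rw [t_inj i hi j hj (by rw [← h1, ← h2, h])]
    · exact absurd (by rw [← h2, ← h, h1]) (hy' i hi)
    · exact absurd (by rw [← h1, h, h2]) (hx' j hj)
    · rw [← h1, ← h2, h]
  have fα : ∀ i < m, ∀ b c, E (r i) b → N b c → ∃ j, i = j + 1 ∧ c = r j := fun i hi b c h1 h2 =>
    st.E_s g hi.le (g.q4 h1 h2 (st.rs i hi))
  have fβ : ∀ i < m, ∀ d c, N (t i) d → E d c → ∃ j, i = j + 1 ∧ c = t j := fun i hi d c h1 h2 =>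
    st.N_s g hi.le (g.q2 (st.ts i hi) h1 h2)
  have fγ : ∀ i < m, ∀ a b, N b (r i) → E a b → i + 1 < m ∧ a = r (i+1) := fun i hi a b h1 h2 =>
    st.to_s_N g hi (g.q3 h2 h1 (st.sr i hi))
  have fδ : ∀ i < m, ∀ a d, E d (t i) → N a d → i + 1 < m ∧ a = t (i+1) := fun i hi a d h1 h2 =>
    st.to_s_E g noW hi (g.q1 (st.st i hi) h2 h1)
  have fε : ∀ i, i + 1 < m → ∀ b, E (r (i+1)) b → N b (r i) := fun i hi b h =>
    g.q2 h (st.rs _ hi) (st.sr i (by omega))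
  have fζ : ∀ i, i + 1 < m → ∀ d, N (t (i+1)) d → E d (t i) := fun i hi d h =>
    g.q4 (st.ts _ hi) (st.st i (by omega)) h
  have fη : ∀ i, i + 1 < m → ∀ b, N b (r i) → E (r (i+1)) b := fun i hi b h =>
    g.q1 h (st.rs _ hi) (st.sr i (by omega))
  have fθ : ∀ i, i + 1 < m → ∀ d, E d (t i) → N (t (i+1)) d := fun i hi d h =>
    g.q3 (st.ts _ hi) (st.st i (by omega)) h
  refine
    { e_mem := fun h => ⟨h.1, h.2.1⟩
      n_mem := fun h => ⟨h.1, h.2.1⟩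
      e_col := fun {x y} h => by rw [← τcol y]; exact g.e_col h.2.2
      n_col := fun {x y} h => by rw [← τcol x]; exact g.n_col h.2.2
      e_fun := fun {x y z} h h' => τinj _ h.2.1 _ h'.2.1 (g.e_fun h.2.2 h'.2.2)
      e_inj := fun {x y z} h h' => g.e_inj h.2.2 h'.2.2
      n_fun := fun {x y z} h h' => g.n_fun h.2.2 h'.2.2
      n_inj := fun {x y z} h h' => τinj _ h.1 _ h'.1 (g.n_inj h.2.2 h'.2.2)
      q1 := ?_, q2 := ?_, q3 := ?_, q4 := ?_
      h1 := fun h v H => collapse_h1 g st noW τ hτ hτ' h v H }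
  · rintro a b c d ⟨hb, hc, h1⟩ ⟨ha, hd, h2⟩ ⟨-, -, h3⟩
    refine ⟨ha, hb, ?_⟩
    rcases dich a with ⟨i, hi, rfl, ea⟩ | ⟨na, ea⟩
    · rw [ea] at h2
      obtain ⟨j, rfl, ej⟩ := fβ i hi _ _ h2 h3
      rcases dich c with ⟨k, hk, rfl, ec⟩ | ⟨nc, ec⟩
      · rw [ec] at ej
        obtain rfl := t_inj k hk j (by omega) ej
        exact fη _ hi _ h1
      · rw [ec] at ej
        exact absurd ej ((mem_colV.1 hc).2.2 j (by omega))
    · rw [ea] at h2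
      rcases dich c with ⟨k, hk, rfl, ec⟩ | ⟨nc, ec⟩
      · rw [ec] at h3
        obtain ⟨hk', e⟩ := fδ k hk _ _ h3 h2
        exact absurd e ((mem_colV.1 ha).2.2 _ hk')
      · rw [ec] at h3
        exact g.q1 h1 h2 h3
  · rintro a b c d ⟨ha, hb, h1⟩ ⟨-, hd, h2⟩ ⟨-, hc, h3⟩
    refine ⟨hb, hc, ?_⟩
    rcases dich a with ⟨i, hi, rfl, ea⟩ | ⟨na, ea⟩
    · rw [ea] at h2
      obtain ⟨j, rfl, ej⟩ := fβ i hi _ _ h2 h3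
      rcases dich c with ⟨k, hk, rfl, ec⟩ | ⟨nc, ec⟩
      · rw [ec] at ej
        obtain rfl := t_inj k hk j (by omega) ej
        exact fε _ hi _ h1
      · rw [ec] at ej
        exact absurd ej ((mem_colV.1 hc).2.2 j (by omega))
    · rw [ea] at h2
      rcases dich c with ⟨k, hk, rfl, ec⟩ | ⟨nc, ec⟩
      · rw [ec] at h3
        obtain ⟨hk', e⟩ := fδ k hk _ _ h3 h2
        exact absurd e ((mem_colV.1 ha).2.2 _ hk')
      · rw [ec] at h3
        exact g.q2 h1 h2 h3
  · rintro a b c d ⟨ha, hb, h1⟩ ⟨-, hc, h2⟩ ⟨hd, -, h3⟩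
    refine ⟨ha, hd, ?_⟩
    rcases dich a with ⟨i, hi, rfl, ea⟩ | ⟨na, ea⟩
    · obtain ⟨j, rfl, rfl⟩ := fα i hi _ _ h1 h2
      rw [ea]
      rw [hτ j (by omega)] at h3
      exact fθ _ hi _ h3
    · rw [ea]
      rcases dich c with ⟨k, hk, rfl, ec⟩ | ⟨nc, ec⟩
      · obtain ⟨hk', e⟩ := fγ k hk _ _ h2 h1
        exact absurd e (na _ hk')
      · rw [ec] at h3
        exact g.q3 h1 h2 h3
  · rintro a b c d ⟨ha, hb, h1⟩ ⟨-, hc, h2⟩ ⟨-, hd, h3⟩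
    refine ⟨hd, hc, ?_⟩
    rcases dich a with ⟨i, hi, rfl, ea⟩ | ⟨na, ea⟩
    · obtain ⟨j, rfl, rfl⟩ := fα i hi _ _ h1 h2
      rw [ea] at h3
      rw [hτ j (by omega)]
      exact fζ _ hi _ h3
    · rw [ea] at h3
      rcases dich c with ⟨k, hk, rfl, ec⟩ | ⟨nc, ec⟩
      · obtain ⟨hk', e⟩ := fγ k hk _ _ h2 h1
        exact absurd e (na _ hk')
      · rw [ec]
        exact g.q4 h1 h2 h3

end Collapse2

open Classical in
/-- The column vectors used to eliminate the strip. -/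
noncomputable def stripL (t r : ℕ → Cell) (i : ℕ) (x : Cell) : ℤ :=
  (if x = t i then 1 else 0) - (if x = r i then 1 else 0)

section Collapse3

variable {V : Finset Cell} {E N : Cell → Cell → Prop} {m : ℕ} {s t r : ℕ → Cell}

theorem sgnAdj_eq_zero {x y : Cell} (h1 : ¬ E x y) (h2 : ¬ E y x) (h3 : ¬ N x y) (h4 : ¬ N y x) :
    sgnAdj E N x y = 0 := by
  simp [sgnAdj, h1, h2, h3, h4]

theorem sgnAdj_level {lv : Cell → ℤ} (lE : ∀ x y, E x y → lv y = lv x + 1)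
    (lN : ∀ x y, N x y → lv y = lv x + 1) {x y : Cell}
    (h : lv y ≠ lv x + 1) (h' : lv x ≠ lv y + 1) : sgnAdj E N x y = 0 :=
  sgnAdj_eq_zero (fun k => h (lE _ _ k)) (fun k => h' (lE _ _ k)) (fun k => h (lN _ _ k))
    (fun k => h' (lN _ _ k))

theorem sum_stripL_t (g : Good V E N) (st : Strip V E N m s t r) (f : ℕ → ℤ) {i : ℕ} (hi : i < m) :
    ∑ k ∈ Finset.range m, stripL t r k (t i) * f k = f i := by
  obtain ⟨s_inj, t_inj, r_inj, st_ne, sr_ne, tr_ne⟩ := st.distinct g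
  rw [Finset.sum_eq_single i]
  · simp [stripL, tr_ne i hi i hi]
  · intro k hk hki
    have hk := Finset.mem_range.1 hk
    have h1 : t i ≠ t k := fun h => hki (t_inj i hi k hk h).symm
    simp [stripL, h1, tr_ne i hi k hk]
  · intro h
    exact absurd (Finset.mem_range.2 hi) h

theorem sum_stripL_r (g : Good V E N) (st : Strip V E N m s t r) (f : ℕ → ℤ) {i : ℕ} (hi : i < m) :
    ∑ k ∈ Finset.range m, stripL t r k (r i) * f k = - f i := by
  obtain ⟨s_inj, t_inj, r_inj, st_ne, sr_ne, tr_ne⟩ := st.distinct g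
  rw [Finset.sum_eq_single i]
  · simp [stripL, (tr_ne i hi i hi).symm]
  · intro k hk hki
    have hk := Finset.mem_range.1 hk
    have h1 : r i ≠ r k := fun h => hki (r_inj i hi k hk h).symm
    simp [stripL, h1, (tr_ne k hk i hi).symm]
  · intro h
    exact absurd (Finset.mem_range.2 hi) h

theorem sum_stripL_other (f : ℕ → ℤ) {x : Cell} (h1 : ∀ i < m, x ≠ t i) (h2 : ∀ i < m, x ≠ r i) :
    ∑ k ∈ Finset.range m, stripL t r k x * f k = 0 := by
  refine Finset.sum_eq_zero fun k hk => ?_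
  have hk := Finset.mem_range.1 hk
  simp [stripL, h1 k hk, h2 k hk]

theorem colAdj_zero {τ : Cell → Cell} {x : Cell} (hx : x ∉ colV V m s t) (y : Cell) :
    sgnAdj (colE (colV V m s t) E τ) (colN (colV V m s t) N τ) x y = 0 :=
  sgnAdj_eq_zero (fun h => hx h.1) (fun h => hx h.2.1) (fun h => hx h.1) (fun h => hx h.2.1)

theorem collapse_identity (g : Good V E N) (st : Strip V E N m s t r) (noW : ∀ x, ¬ E x (s m))
    (τ : Cell → Cell) (hτ : ∀ i < m, τ (r i) = t i) (hτ' : ∀ y, (∀ i < m, y ≠ r i) → τ y = y)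
    (x y : Cell) (hx : x ∈ V) (hy : y ∈ V) :
    sgnAdj E N x y = (∑ i ∈ Finset.range m, (stripL t r i x * sgnAdj E N (t i) y
      + sgnAdj E N (t i) x * stripL t r i y))
      + sgnAdj (colE (colV V m s t) E τ) (colN (colV V m s t) N τ) x y := by
  classical
  obtain ⟨s_inj, t_inj, r_inj, st_ne, sr_ne, tr_ne⟩ := st.distinct g
  obtain ⟨lv, lE, lN, ls, lt, lr⟩ := st.levels g
  have A0 := fun x y => @sgnAdj_level E N lv lE lN x y
  rw [Finset.sum_add_distrib]
  simp only [mul_comm (sgnAdj E N _ x)]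
  set A := sgnAdj E N with hA
  set A' := sgnAdj (colE (colV V m s t) E τ) (colN (colV V m s t) N τ) with hA'
  set P : Cell → Cell → ℤ := fun x y => ∑ i ∈ Finset.range m, stripL t r i x * A (t i) y with hP
  have Pt : ∀ i < m, ∀ y, P (t i) y = A (t i) y := fun i hi y =>
    sum_stripL_t g st (fun k => A (t k) y) hi
  have Pr : ∀ i < m, ∀ y, P (r i) y = - A (t i) y := fun i hi y =>
    sum_stripL_r g st (fun k => A (t k) y) hi
  have Po : ∀ x, (∀ i < m, x ≠ t i) → (∀ i < m, x ≠ r i) → ∀ y, P x y = 0 := fun x h1 h2 y =>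
    sum_stripL_other (fun k => A (t k) y) h1 h2
  have Asym : ∀ x y, A x y = A y x := fun x y => sgnAdj_symm E N x y
  have Asym' : ∀ x y, A' x y = A' y x := fun x y => sgnAdj_symm _ _ x y
  change A x y = P x y + P y x + A' x y
  have dich : ∀ y, (∃ i < m, y = t i) ∨ (∃ i < m, y = r i) ∨ ((∀ i < m, y ≠ t i) ∧ ∀ i < m, y ≠ r i) := by
    intro y
    by_cases h : ∃ i, i < m ∧ y = t i
    · exact Or.inl h
    by_cases h' : ∃ i, i < m ∧ y = r i
    · exact Or.inr (Or.inl h')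
    push Not at h h'
    exact Or.inr (Or.inr ⟨h, h'⟩)
  have caseT : ∀ i < m, ∀ y, A (t i) y = P (t i) y + P y (t i) + A' (t i) y := by
    intro i hi y
    have h1 : A' (t i) y = 0 := colAdj_zero (fun h => (mem_colV.1 h).2.2 i hi rfl) y
    have h2 : ∀ k < m, A (t k) (t i) = 0 := fun k hk =>
      A0 _ _ (by rw [lt _ hi, lt _ hk]; omega) (by rw [lt _ hi, lt _ hk]; omega)
    have h3 : P y (t i) = 0 := by
      rcases dich y with ⟨k, hk, rfl⟩ | ⟨k, hk, rfl⟩ | ⟨h3, h4⟩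
      · rw [Pt k hk, h2 k hk]
      · rw [Pr k hk, h2 k hk, neg_zero]
      · exact Po y h3 h4 _
    rw [h1, h3, Pt i hi]
    ring
  have caseS : ∀ j ≤ m, ∀ y, (∀ i < m, y ≠ t i) → A (s j) y = P (s j) y + P y (s j) + A' (s j) y := by
    intro j hj y hyt
    have h1 : A' (s j) y = 0 := colAdj_zero (fun h => (mem_colV.1 h).2.1 j hj rfl) y
    have h2 : P (s j) y = 0 := Po _ (st_ne j hj) (sr_ne j hj) y
    rw [h1, h2]
    rcases dich y with ⟨k, hk, rfl⟩ | ⟨k, hk, rfl⟩ | ⟨h3, h4⟩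
    · exact absurd rfl (hyt k hk)
    · rw [Pr k hk]
      have a1 : E (s j) (r k) ↔ N (s j) (t k) := by
        constructor
        · intro h
          obtain ⟨i, rfl, e⟩ := st.E_s g hj h
          obtain rfl := r_inj k hk i hj e
          exact st.st _ hk
        · intro h
          obtain ⟨i, rfl, e⟩ := st.N_s g hj h
          obtain rfl := t_inj k hk i hj e
          exact st.sr _ hk
      have a2 : N (r k) (s j) ↔ E (t k) (s j) := by
        constructor
        · intro h
          obtain ⟨h1, e⟩ := st.to_s_N g hj h
          obtain rfl := r_inj k hk _ h1 e
          exact st.ts _ hk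
        · intro h
          obtain ⟨h1, e⟩ := st.to_s_E g noW hj h
          obtain rfl := t_inj k hk _ h1 e
          exact st.rs _ hk
      have a3 : ¬ E (r k) (s j) := fun h => by
        obtain ⟨h1, e⟩ := st.to_s_E g noW hj h
        exact tr_ne _ h1 k hk e.symm
      have a4 : ¬ N (s j) (r k) := fun h => by
        obtain ⟨i, rfl, e⟩ := st.N_s g hj h
        exact tr_ne _ hj k hk e.symm
      have a5 : ¬ E (s j) (t k) := fun h => by
        obtain ⟨i, rfl, e⟩ := st.E_s g hj h
        exact tr_ne k hk _ hj e
      have a6 : ¬ N (t k) (s j) := fun h => by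
        obtain ⟨h1, e⟩ := st.to_s_N g hj h
        exact tr_ne k hk _ h1 e
      simp only [hA, sgnAdj, a1, a2, a3, a4, a5, a6, if_false]
      ring
    · rw [Po y h3 h4]
      have : A (s j) y = 0 := by
        refine sgnAdj_eq_zero (fun h => ?_) (fun h => ?_) (fun h => ?_) (fun h => ?_)
        · obtain ⟨i, rfl, e⟩ := st.E_s g hj h
          exact h4 i hj e
        · obtain ⟨h1, e⟩ := st.to_s_E g noW hj h
          exact h3 _ h1 e
        · obtain ⟨i, rfl, e⟩ := st.N_s g hj h
          exact h3 i hj e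
        · obtain ⟨h1, e⟩ := st.to_s_N g hj h
          exact h4 _ h1 e
      rw [this]
      ring
  have rV : ∀ i < m, r i ∈ colV V m s t := fun i hi => mem_colV.2
    ⟨st.r_mem g hi, fun j hj h => sr_ne j hj i hi h.symm, fun j hj h => tr_ne j hj i hi h.symm⟩
  have A'V : ∀ x ∈ colV V m s t, ∀ y ∈ colV V m s t, A' x y =
      (if E x (τ y) then 1 else 0) + (if E y (τ x) then 1 else 0)
      - (if N (τ x) y then 1 else 0) - (if N (τ y) x then 1 else 0) := by
    intro x hx y hy
    simp only [hA', sgnAdj, colE, colN, hx, hy, true_and]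
  have caseR : ∀ i < m, ∀ y ∈ colV V m s t, A (r i) y = P (r i) y + P y (r i) + A' (r i) y := by
    intro i hi y hy
    rw [A'V _ (rV i hi) y hy, hτ i hi, Pr i hi]
    obtain ⟨-, hys, hyt⟩ := mem_colV.1 hy
    rcases dich y with ⟨k, hk, rfl⟩ | ⟨k, hk, rfl⟩ | ⟨h3, h4⟩
    · exact absurd rfl (hyt k hk)
    · have l1 := lt i hi
      have l2 := lt k hk
      have l3 := lr i hi
      have l4 := lr k hk
      rw [Pr k hk, hτ k hk]
      rw [A0 (r i) (r k) (by omega) (by omega), A0 (t i) (r k) (by omega) (by omega),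
        A0 (t k) (r i) (by omega) (by omega), if_neg, if_neg, if_neg, if_neg]
      · ring
      · intro h; have := lN _ _ h; omega
      · intro h; have := lN _ _ h; omega
      · intro h; have := lE _ _ h; omega
      · intro h; have := lE _ _ h; omega
    · rw [Po y h3 h4, hτ' y h4]
      have a1 : ¬ E y (r i) := fun h => hys (i+1) hi (g.e_inj h (st.sr i hi))
      have a2 : ¬ N (r i) y := fun h => hys i hi.le (g.n_fun h (st.rs i hi))
      have a3 : ¬ E (t i) y := fun h => hys i hi.le (g.e_fun h (st.ts i hi))
      have a4 : ¬ N y (t i) := fun h => hys (i+1) hi (g.n_inj h (st.st i hi))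
      simp only [hA, sgnAdj, a1, a2, a3, a4, if_false]
      ring
  have sym : ∀ x y, A y x = P y x + P x y + A' y x → A x y = P x y + P y x + A' x y := by
    intro x y h
    rw [Asym x y, h, Asym' x y]
    ring
  rcases dich x with ⟨i, hi, rfl⟩ | hx1
  · exact caseT i hi y
  rcases dich y with ⟨i, hi, rfl⟩ | hy1
  · exact sym _ _ (caseT i hi x)
  have hxt : ∀ i < m, x ≠ t i := by
    rcases hx1 with ⟨k, hk, rfl⟩ | h
    · exact fun i hi h => tr_ne i hi k hk h.symm
    · exact h.1
  have hyt : ∀ i < m, y ≠ t i := by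
    rcases hy1 with ⟨k, hk, rfl⟩ | h
    · exact fun i hi h => tr_ne i hi k hk h.symm
    · exact h.1
  by_cases hxs : ∃ j, j ≤ m ∧ x = s j
  · obtain ⟨j, hj, rfl⟩ := hxs
    exact caseS j hj y hyt
  by_cases hys : ∃ j, j ≤ m ∧ y = s j
  · obtain ⟨j, hj, rfl⟩ := hys
    exact sym _ _ (caseS j hj x hxt)
  push Not at hxs hys
  have hxV : x ∈ colV V m s t := mem_colV.2 ⟨hx, hxs, hxt⟩
  have hyV : y ∈ colV V m s t := mem_colV.2 ⟨hy, hys, hyt⟩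
  rcases hx1 with ⟨i, hi, rfl⟩ | hx1
  · exact caseR i hi y hyV
  rcases hy1 with ⟨i, hi, rfl⟩ | hy1
  · exact sym _ _ (caseR i hi x hxV)
  rw [A'V x hxV y hyV, Po x hx1.1 hx1.2, Po y hy1.1 hy1.2, hτ' x hx1.2, hτ' y hy1.2]
  simp only [hA, sgnAdj]
  ring

end Collapse3

/-- Deleting a vertex from a relation. -/
def delR (R : Cell → Cell → Prop) (p : Cell) (x y : Cell) : Prop := R x y ∧ x ≠ p ∧ y ≠ p

theorem exists_common_value {ι : Type*} (Q : ι → Prop) (F : ι → ℤ)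
    (h : ∀ i j, Q i → Q j → i = j) : ∃ c : ℤ, ∀ i, Q i → c = F i := by
  by_cases H : ∃ i, Q i
  · obtain ⟨i, hi⟩ := H
    exact ⟨F i, fun j hj => by rw [h i j hi hj]⟩
  · exact ⟨0, fun i hi => absurd ⟨i, hi⟩ H⟩

section Del

variable {V : Finset Cell} {E N : Cell → Cell → Prop}

theorem delete_good (g : Good V E N) {p S : Cell} (hpS : E p S) (noS : ∀ x, ¬ N x S) :
    Good (V.erase p) (delR E p) (delR N p) := by
  classical
  refine
    { e_mem := fun h => ⟨Finset.mem_erase.2 ⟨h.2.1, (g.e_mem h.1).1⟩,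
        Finset.mem_erase.2 ⟨h.2.2, (g.e_mem h.1).2⟩⟩
      n_mem := fun h => ⟨Finset.mem_erase.2 ⟨h.2.1, (g.n_mem h.1).1⟩,
        Finset.mem_erase.2 ⟨h.2.2, (g.n_mem h.1).2⟩⟩
      e_col := fun h => g.e_col h.1
      n_col := fun h => g.n_col h.1
      e_fun := fun h h' => g.e_fun h.1 h'.1
      e_inj := fun h h' => g.e_inj h.1 h'.1
      n_fun := fun h h' => g.n_fun h.1 h'.1
      n_inj := fun h h' => g.n_inj h.1 h'.1
      q1 := fun h1 h2 h3 => ⟨g.q1 h1.1 h2.1 h3.1, h2.2.1, h1.2.1⟩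
      q2 := fun h1 h2 h3 => ⟨g.q2 h1.1 h2.1 h3.1, h1.2.2, h3.2.2⟩
      q3 := fun h1 h2 h3 => ⟨g.q3 h1.1 h2.1 h3.1, h1.2.1, h3.2.1⟩
      q4 := fun h1 h2 h3 => ⟨g.q4 h1.1 h2.1 h3.1, h3.2.2, h2.2.2⟩
      h1 := ?_ }
  intro h' v' H
  obtain ⟨vX, hvX⟩ := exists_common_value (fun z : Cell × Cell => N p z.1 ∧ N S z.2)
    (fun z => v' S z.2 - h' z.1 z.2) (by
      rintro ⟨a, b⟩ ⟨c, d⟩ ⟨h1, h2⟩ ⟨h3, h4⟩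
      exact Prod.ext (g.n_fun h1 h3) (g.n_fun h2 h4))
  obtain ⟨hW, hhW⟩ := exists_common_value (fun z : Cell × Cell × Cell => E z.1 p ∧ N p z.2.1 ∧ N z.1 z.2.2)
    (fun z => v' z.1 z.2.2 + h' z.2.2 z.2.1 - vX) (by
      rintro ⟨a, b, c⟩ ⟨a', b', c'⟩ ⟨h1, h2, h3⟩ ⟨h4, h5, h6⟩
      obtain rfl := g.e_inj h1 h4
      exact Prod.ext rfl (Prod.ext (g.n_fun h2 h5) (g.n_fun h3 h6)))
  obtain ⟨vS, hvS⟩ := exists_common_value (fun z : Cell × Cell × Cell => N z.1 p ∧ E z.2.1 p ∧ N z.2.2 z.2.1)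
    (fun z => v' z.2.2 z.2.1 + hW - h' z.2.2 z.1) (by
      rintro ⟨a, b, c⟩ ⟨a', b', c'⟩ ⟨h1, h2, h3⟩ ⟨h4, h5, h6⟩
      obtain rfl := g.e_inj h2 h5
      exact Prod.ext (g.n_inj h1 h4) (Prod.ext rfl (g.n_inj h3 h6)))
  obtain ⟨lv, lE, lN⟩ := g.exists_level
  let h : Cell → Cell → ℤ := fun x y => if x = p then 0 else if y = p then hW else h' x y
  let v : Cell → Cell → ℤ := fun x y => if x = p then vX else if y = p then vS else v' x y
  have h_1 : ∀ y, h p y = 0 := fun y => if_pos rfl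
  have v_1 : ∀ y, v p y = vX := fun y => if_pos rfl
  have h_2 : ∀ x, x ≠ p → h x p = hW := fun x hx => by simp [h, hx]
  have v_2 : ∀ x, x ≠ p → v x p = vS := fun x hx => by simp [v, hx]
  have h_3 : ∀ x y, x ≠ p → y ≠ p → h x y = h' x y := fun x y hx hy => by simp [h, hx, hy]
  have v_3 : ∀ x y, x ≠ p → y ≠ p → v x y = v' x y := fun x y hx hy => by simp [v, hx, hy]
  obtain ⟨f, hf1, hf2⟩ := g.h1 h v (by
    intro a b c d h1 h2 h3 h4
    have l1 := lE _ _ h1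
    have l2 := lN _ _ h2
    have l3 := lN _ _ h3
    have l4 := lE _ _ h4
    have ab : a ≠ b := by rintro rfl; omega
    have bc : b ≠ c := by rintro rfl; omega
    have ad : a ≠ d := by rintro rfl; omega
    have dc : d ≠ c := by rintro rfl; omega
    have ac : a ≠ c := by rintro rfl; omega
    have bd : b ≠ d := by rintro rfl; exact g.en_disj h1 h3
    by_cases ea : a = p
    · subst ea
      obtain rfl := g.e_fun hpS h1
      rw [h_1, v_1, v_3 _ _ ab.symm ac.symm, h_3 _ _ ad.symm ac.symm, hvX (d, c) ⟨h3, h2⟩]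
      ring
    by_cases eb : b = p
    · subst eb
      rw [h_2 _ ea, v_1, v_3 _ _ ea bd.symm, h_3 _ _ bd.symm bc.symm, hhW (a, c, d) ⟨h1, h2, h3⟩]
      ring
    by_cases ec : c = p
    · subst ec
      rw [h_3 _ _ ea eb, v_2 _ eb, v_3 _ _ ea dc, h_2 _ dc, hvS (b, d, a) ⟨h2, h4, h3⟩]
      ring
    by_cases ed : d = p
    · subst ed
      obtain rfl := g.e_fun hpS h4
      exact absurd h2 (noS b)
    rw [h_3 _ _ ea eb, v_3 _ _ eb ec, v_3 _ _ ea ed, h_3 _ _ ed ec]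
    exact H a b c d ⟨h1, ea, eb⟩ ⟨h2, eb, ec⟩ ⟨h3, ea, ed⟩ ⟨h4, ed, ec⟩)
  refine ⟨f, ?_, ?_⟩
  · rintro x y ⟨h1, h2, h3⟩
    rw [← hf1 x y h1, h_3 _ _ h2 h3]
  · rintro x y ⟨h1, h2, h3⟩
    rw [← hf2 x y h1, v_3 _ _ h2 h3]

variable {m : ℕ} {s t r : ℕ → Cell}

theorem Strip.delete (st : Strip V E N m s t r) (g : Good V E N) {p : Cell} (hp : E p (s m)) :
    Strip (V.erase p) (delR E p) (delR N p) m s t r ∧ (∀ i ≤ m, s i ≠ p) ∧ (∀ i < m, t i ≠ p) ∧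
      (∀ i < m, r i ≠ p) := by
  obtain ⟨lv, lE, lN, ls, lt, lr⟩ := st.levels g
  have lp : lv p = - 2 * m - 1 := by
    have := lE _ _ hp
    rw [ls m le_rfl] at this
    omega
  have sp : ∀ i ≤ m, s i ≠ p := by
    rintro i hi rfl
    have := ls i hi
    omega
  have tp : ∀ i < m, t i ≠ p := by
    rintro i hi rfl
    have := lt i hi
    omega
  have rp : ∀ i < m, r i ≠ p := by
    rintro i hi rfl
    have := lr i hi
    omega
  exact ⟨⟨Finset.mem_erase.2 ⟨sp 0 (Nat.zero_le _), st.mem0⟩, fun y h => st.noE y h.1,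
    fun y h => st.noN y h.1, fun i hi => ⟨st.ts i hi, tp i hi, sp i hi.le⟩,
    fun i hi => ⟨st.rs i hi, rp i hi, sp i hi.le⟩, fun i hi => ⟨st.st i hi, sp _ hi, tp i hi⟩,
    fun i hi => ⟨st.sr i hi, sp _ hi, rp i hi⟩, fun x h => st.noS x h.1⟩, sp, tp, rp⟩

theorem sgnAdj_delR {p x y : Cell} (hx : x ≠ p) (hy : y ≠ p) :
    sgnAdj (delR E p) (delR N p) x y = sgnAdj E N x y := by
  have hE : ∀ R : Cell → Cell → Prop, ∀ a b : Cell, a ≠ p → b ≠ p → (delR R p a b ↔ R a b) :=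
    fun R a b ha hb => ⟨fun h => h.1, fun h => ⟨h, ha, hb⟩⟩
  unfold sgnAdj
  rw [propext (hE E x y hx hy), propext (hE E y x hy hx), propext (hE N x y hx hy),
    propext (hE N y x hy hx)]

theorem sgnAdj_vals (g : Good V E N) (x y : Cell) :
    sgnAdj E N x y = 0 ∨ sgnAdj E N x y = 1 ∨ sgnAdj E N x y = -1 := by
  classical
  obtain ⟨lv, lE, lN⟩ := g.exists_level
  have h1 : E x y → ¬ E y x := fun h h' => by have := lE _ _ h; have := lE _ _ h'; omega
  have h2 : E x y → ¬ N y x := fun h h' => by have := lE _ _ h; have := lN _ _ h'; omega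
  have h3 : E x y → ¬ N x y := fun h h' => g.en_disj h h'
  have h4 : E y x → ¬ N y x := fun h h' => g.en_disj h h'
  have h5 : E y x → ¬ N x y := fun h h' => by have := lE _ _ h; have := lN _ _ h'; omega
  have h6 : N x y → ¬ N y x := fun h h' => by have := lN _ _ h; have := lN _ _ h'; omega
  unfold sgnAdj
  by_cases a : E x y
  · simp [a, h1 a, h2 a, h3 a]
  by_cases b : E y x
  · simp [a, b, h4 b, h5 b]
  by_cases c : N x y
  · simp [a, b, c, h6 c]
  by_cases d : N y x <;> simp [a, b, c, d]

theorem sgnAdj_col (g : Good V E N) {x y : Cell} (h : sgnAdj E N x y ≠ 0) :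
    IsBlackCell x ↔ ¬ IsBlackCell y := by
  by_contra hc
  refine h (sgnAdj_eq_zero (fun k => hc (g.e_col k)) (fun k => hc ?_) (fun k => hc (g.n_col k))
    (fun k => hc ?_))
  · have := g.e_col k; tauto
  · have := g.n_col k; tauto

theorem stripL_vals (i : ℕ) (x : Cell) :
    stripL t r i x = 0 ∨ stripL t r i x = 1 ∨ stripL t r i x = -1 := by
  unfold stripL
  split_ifs <;> simp

theorem sgnAdj_E (g : Good V E N) {x y : Cell} (h : E x y) : sgnAdj E N x y = 1 := by
  obtain ⟨lv, lE, lN⟩ := g.exists_level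
  have h0 := lE _ _ h
  have h1 : ¬ E y x := fun h' => by have := lE _ _ h'; omega
  have h2 : ¬ N y x := fun h' => by have := lN _ _ h'; omega
  have h3 : ¬ N x y := fun h' => g.en_disj h h'
  simp [sgnAdj, h, h1, h2, h3]

/-- The elimination of the pivots of a strip, in terms of a general remainder. -/
theorem strip_multi (g : Good V E N) (st : Strip V E N m s t r) (A' : Cell → Cell → ℤ)
    (hA : ∀ x ∈ V, ∀ y ∈ V, sgnAdj E N x y = (∑ i ∈ Finset.range m,
      (stripL t r i x * sgnAdj E N (t i) y + sgnAdj E N (t i) x * stripL t r i y)) + A' x y)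
    (h6 : ∀ i < m, ∀ y ∈ V, A' (s i) y = 0 ∧ A' y (s i) = 0 ∧ A' (t i) y = 0 ∧ A' y (t i) = 0)
    (hF : Fac (V.filter fun x => ∀ i < m, x ≠ s i ∧ x ≠ t i) A') : Fac V (sgnAdj E N) := by
  obtain ⟨s_inj, t_inj, r_inj, st_ne, sr_ne, tr_ne⟩ := st.distinct g
  obtain ⟨lv, lE, lN, ls, lt, lr⟩ := st.levels g
  refine Fac.multi m V _ A' s t (stripL t r) (fun i x => sgnAdj E N (t i) x) ?_ ?_ ?_ ?_ ?_ hA h6 hF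
  · intro i hi
    refine ⟨st.s_mem g hi.le, st.t_mem g hi, ?_⟩
    have := g.e_col (st.ts i hi)
    tauto
  · exact fun i hi x => ⟨stripL_vals i x, sgnAdj_vals g _ _⟩
  · intro i hi
    exact ⟨Or.inl (by simp [stripL, tr_ne i hi i hi]), Or.inl (sgnAdj_E g (st.ts i hi))⟩
  · intro i hi x
    have c1 := g.e_col (st.ts i hi)
    have c2 := g.n_col (st.rs i hi)
    constructor
    · intro h
      by_cases h1 : x = t i
      · rw [h1]
      by_cases h2 : x = r i
      · rw [h2]; tauto
      · exact absurd (by simp [stripL, h1, h2]) h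
    · intro h
      have := sgnAdj_col g h
      tauto
  · intro i hi j hj hij
    refine ⟨?_, ?_, ?_, ?_⟩
    · simp [stripL, st_ne i hi.le j hj, sr_ne i hi.le j hj]
    · have : t i ≠ t j := fun h => by have := t_inj i hi j hj h; omega
      simp [stripL, this, tr_ne i hi j hj]
    · have l1 := lt j hj
      have l2 := ls i hi.le
      exact sgnAdj_level lE lN (by omega) (by omega)
    · have l1 := lt j hj
      have l2 := lt i hi
      exact sgnAdj_level lE lN (by omega) (by omega)

theorem colAdj_zero' {τ : Cell → Cell} {x : Cell} (hx : x ∉ colV V m s t) (y : Cell) :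
    sgnAdj (colE (colV V m s t) E τ) (colN (colV V m s t) N τ) y x = 0 := by
  rw [sgnAdj_symm]
  exact colAdj_zero hx y

theorem fac_of_strip (ih : ∀ V' : Finset Cell, V'.card < V.card → ∀ E' N' : Cell → Cell → Prop,
      Good V' E' N' → Fac V' (sgnAdj E' N'))
    (g : Good V E N) (st : Strip V E N m s t r) : Fac V (sgnAdj E N) := by
  classical
  obtain ⟨s_inj, t_inj, r_inj, st_ne, sr_ne, tr_ne⟩ := st.distinct g
  obtain ⟨τ, hτ, hτ'⟩ := exists_relabel (m := m) r t r_inj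
  obtain ⟨lv, lE, lN, ls, lt, lr⟩ := st.levels g
  have sV : ∀ W : Finset Cell, ∀ i ≤ m, s i ∉ colV W m s t := fun W i hi h =>
    (mem_colV.1 h).2.1 i hi rfl
  have tV : ∀ W : Finset Cell, ∀ i < m, t i ∉ colV W m s t := fun W i hi h =>
    (mem_colV.1 h).2.2 i hi rfl
  have smF : s m ∈ V.filter fun x => ∀ i < m, x ≠ s i ∧ x ≠ t i := by
    refine Finset.mem_filter.2 ⟨st.s_mem g le_rfl, fun i hi => ⟨fun h => ?_, st_ne m le_rfl i hi⟩⟩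
    have := s_inj m le_rfl i hi.le h
    omega
  have key : ∀ x, ((∀ i < m, x ≠ s i ∧ x ≠ t i) ∧ x ≠ s m) ↔ ((∀ i ≤ m, x ≠ s i) ∧ ∀ i < m, x ≠ t i) := by
    intro x
    constructor
    · rintro ⟨h1, h2⟩
      refine ⟨fun i hi => ?_, fun i hi => (h1 i hi).2⟩
      rcases hi.lt_or_eq with h | rfl
      · exact (h1 i h).1
      · exact h2
    · rintro ⟨h1, h2⟩
      exact ⟨fun i hi => ⟨h1 i hi.le, h2 i hi⟩, h1 m le_rfl⟩
  by_cases noW : ∀ x, ¬ E x (s m)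
  · refine strip_multi g st (sgnAdj (colE (colV V m s t) E τ) (colN (colV V m s t) N τ))
      (fun x hx y hy => collapse_identity g st noW τ hτ hτ' x y hx hy)
      (fun i hi y _ => ⟨colAdj_zero (sV V i hi.le) y, colAdj_zero' (sV V i hi.le) y,
        colAdj_zero (tV V i hi) y, colAdj_zero' (tV V i hi) y⟩) ?_
    refine Fac.skip _ _ (s m) smF
      (fun y _ => ⟨colAdj_zero (sV V m le_rfl) y, colAdj_zero' (sV V m le_rfl) y⟩) ?_
    have e : (V.filter fun x => ∀ i < m, x ≠ s i ∧ x ≠ t i).erase (s m) = colV V m s t := by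
      ext x
      rw [mem_colV, Finset.mem_erase, Finset.mem_filter, ← key x]
      tauto
    rw [e]
    refine ih _ (Finset.card_lt_card ?_) _ _ (collapse_good g st noW τ hτ hτ')
    refine Finset.ssubset_iff_subset_ne.2 ⟨fun x hx => (mem_colV.1 hx).1, fun h => ?_⟩
    exact sV V 0 (Nat.zero_le _) (by rw [h]; exact st.mem0)
  · push Not at noW
    obtain ⟨p, hp⟩ := noW
    have g1 := delete_good g hp st.noS
    obtain ⟨st1, sp, tp, rp⟩ := st.delete g hp
    have noW1 : ∀ x, ¬ delR E p x (s m) := fun x h => h.2.1 (g.e_inj h.1 hp)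
    have lp : lv p = - 2 * m - 1 := by
      have := lE _ _ hp
      rw [ls m le_rfl] at this
      omega
    have hpV : p ∈ V := (g.e_mem hp).1
    have pF : p ∈ V.filter fun x => ∀ i < m, x ≠ s i ∧ x ≠ t i :=
      Finset.mem_filter.2 ⟨hpV, fun i hi => ⟨(sp i hi.le).symm, (tp i hi).symm⟩⟩
    have pV : p ∉ colV (V.erase p) m s t := fun h => Finset.notMem_erase p V (mem_colV.1 h).1
    have Aps : ∀ i < m, sgnAdj E N p (s i) = 0 := fun i hi => by
      have := ls i hi.le
      exact sgnAdj_level lE lN (by omega) (by omega)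
    have Apt : ∀ i < m, sgnAdj E N p (t i) = 0 := fun i hi => by
      have := lt i hi
      exact sgnAdj_level lE lN (by omega) (by omega)
    have App : sgnAdj E N p p = 0 := sgnAdj_level lE lN (by omega) (by omega)
    have Lp : ∀ i < m, stripL t r i p = 0 := fun i hi => by
      simp [stripL, (tp i hi).symm, (rp i hi).symm]
    let e : Cell → ℤ := fun x => if x = p then 1 else 0
    have ep : e p = 1 := if_pos rfl
    have en : ∀ x, x ≠ p → e x = 0 := fun x hx => if_neg hx
    set A' := sgnAdj (colE (colV (V.erase p) m s t) (delR E p) τ)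
      (colN (colV (V.erase p) m s t) (delR N p) τ) with hA'
    have z1 : ∀ x, x ∉ colV (V.erase p) m s t → ∀ y, A' x y = 0 := fun x hx y => colAdj_zero hx y
    have z2 : ∀ x, x ∉ colV (V.erase p) m s t → ∀ y, A' y x = 0 := fun x hx y => colAdj_zero' hx y
    refine strip_multi g st (fun x y => e x * sgnAdj E N p y + sgnAdj E N p x * e y + A' x y) ?_ ?_ ?_
    · intro x hx y hy
      by_cases hxp : x = p
      · subst hxp
        rw [Finset.sum_eq_zero, z1 _ pV, ep, App]
        · ring
        · intro i hi
          have hi := Finset.mem_range.1 hi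
          rw [Lp i hi, sgnAdj_symm E N (t i) x, Apt i hi]
          ring
      by_cases hyp : y = p
      · subst hyp
        rw [Finset.sum_eq_zero, z2 _ pV, ep, App, sgnAdj_symm]
        · ring
        · intro i hi
          have hi := Finset.mem_range.1 hi
          rw [Lp i hi, sgnAdj_symm E N (t i) y, Apt i hi]
          ring
      have := collapse_identity g1 st1 noW1 τ hτ hτ' x y (Finset.mem_erase.2 ⟨hxp, hx⟩)
        (Finset.mem_erase.2 ⟨hyp, hy⟩)
      rw [sgnAdj_delR hxp hyp] at this
      rw [en x hxp, en y hyp, this]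
      simp only [zero_mul, mul_zero, zero_add]
      congr 1
      refine Finset.sum_congr rfl fun i hi => ?_
      have hi := Finset.mem_range.1 hi
      rw [sgnAdj_delR (tp i hi) hyp, sgnAdj_delR (tp i hi) hxp]
    · intro i hi y _
      have a1 := sV (V.erase p) i hi.le
      have a2 := tV (V.erase p) i hi
      simp only [z1 _ a1, z2 _ a1, z1 _ a2, z2 _ a2, en _ (sp i hi.le), en _ (tp i hi), Aps i hi,
        Apt i hi]
      simp
    · have c0 := g.e_col hp
      refine Fac.step _ _ A' (s m) p e (fun x => sgnAdj E N p x) smF pF (by tauto) ?_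
        (fun x => sgnAdj_vals g _ _) (Or.inl ep) (Or.inl (sgnAdj_E g hp)) ?_ ?_ ?_
        (fun y _ => ⟨z1 _ (sV _ m le_rfl) y, z2 _ (sV _ m le_rfl) y⟩)
        (fun y _ => ⟨z1 _ pV y, z2 _ pV y⟩) ?_
      · intro x
        by_cases hx : x = p
        · rw [hx, ep]; simp
        · rw [en x hx]; simp
      · intro x hx
        by_cases h : x = p
        · rw [h]
        · exact absurd (en x h) hx
      · intro x hx
        have := sgnAdj_col g hx
        tauto
      · intro x _ y _
        rfl
      · have e : ((V.filter fun x => ∀ i < m, x ≠ s i ∧ x ≠ t i).erase (s m)).erase p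
            = colV (V.erase p) m s t := by
          ext x
          rw [mem_colV, Finset.mem_erase, Finset.mem_erase, Finset.mem_erase, Finset.mem_filter,
            ← key x]
          tauto
        rw [e]
        refine ih _ (Finset.card_lt_card ?_) _ _ (collapse_good g1 st1 noW1 τ hτ hτ')
        refine Finset.ssubset_iff_subset_ne.2
          ⟨fun x hx => Finset.mem_of_mem_erase (mem_colV.1 hx).1, fun h => ?_⟩
        exact pV (by rw [h]; exact hpV)

end Del

theorem Good.fac : ∀ (n : ℕ) (V : Finset Cell), V.card = n → ∀ E N : Cell → Cell → Prop,
    Good V E N → Fac V (sgnAdj E N) := by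
  intro n
  induction n using Nat.strong_induction_on with
  | _ n IH =>
    intro V hV E N g
    have ih : ∀ V' : Finset Cell, V'.card < V.card → ∀ E' N' : Cell → Cell → Prop,
        Good V' E' N' → Fac V' (sgnAdj E' N') := fun V' h E' N' g' =>
      IH V'.card (by omega) V' rfl E' N' g'
    rcases V.eq_empty_or_nonempty with rfl | hne
    · exact Fac.nil _
    obtain ⟨m, s, t, r, h | h | h | h⟩ := g.exists_strip hne
    · exact fac_of_strip ih g h
    · refine Fac.congr (Fac.neg (fac_of_strip ih g.swap h)) fun x _ y _ => ?_
      exact sgnAdj_swap N E x y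
    · refine Fac.congr (fac_of_strip ih g.rev h) fun x _ y _ => ?_
      rw [sgnAdj_rev]
    · refine Fac.congr (Fac.neg (fac_of_strip ih g.swap.rev h)) fun x _ y _ => ?_
      have h1 := sgnAdj_rev N E x y
      have h2 := sgnAdj_swap N E x y
      rw [h2, ← h1]

/-- **Theorem.** For a board with at least two cells there is a labeling of its
black and white cells for which the black-to-white matrix admits an `L·D̃·U`
decomposition with `L` lower triangular, `U` upper triangular, both of
determinant `±1`, `D̃` a defective identity, and all entries of `L`, `D̃`, `U`
equal to `0`, `1` or `-1`. -/
theorem btwMatrix_exists_LDU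
    (S : Finset Cell) (hS : IsBoard S) (h2 : 2 ≤ S.card) (b w : ℕ)
    (hb : (blackCells S).card = b) (hw : (whiteCells S).card = w) :
    ∃ (β : Fin b ≃ blackCells S) (ω : Fin w ≃ whiteCells S)
      (L : Matrix (Fin b) (Fin b) ℤ) (D : Matrix (Fin b) (Fin w) ℤ)
      (U : Matrix (Fin w) (Fin w) ℤ),
      btwMatrix β ω = L * D * U ∧
      (∀ i j : Fin b, i < j → L i j = 0) ∧ (L.det = 1 ∨ L.det = -1) ∧
      (∀ i j : Fin w, j < i → U i j = 0) ∧ (U.det = 1 ∨ U.det = -1) ∧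
      IsDefectiveIdentity D ∧
      (∀ i j, L i j = 0 ∨ L i j = 1 ∨ L i j = -1) ∧
      (∀ i j, D i j = 0 ∨ D i j = 1 ∨ D i j = -1) ∧
      (∀ i j, U i j = 0 ∨ U i j = 1 ∨ U i j = -1) := by
  exact final_of_fac S (Good.fac _ S rfl _ _ (good_of_board hS)) b w hb hw
end

section
/- Let S be a board and let v₀ be a corner of S. Then there is exactly one diagonal of S starting at v₀, and its final vertex v_k is a boundary vertex of S. -/
open scoped Matrix

/-- The four vertices of a cell. -/
def cellVerts (p : Cell) : Finset Cell := {p, p + (1, 0), p + (0, 1), p + (1, 1)}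

/-- `v` is a vertex of `S` if it is a vertex of some cell of `S`. -/
def IsVertex (S : Finset Cell) (v : Cell) : Prop := ∃ p ∈ S, v ∈ cellVerts p

/-- The cells of `S` incident to the vertex `v`. -/
def incidentCells (S : Finset Cell) (v : Cell) : Finset Cell :=
  S.filter fun p => v ∈ cellVerts p

/-- The point of `ℝ²` corresponding to a grid point. -/
def toR (v : Cell) : ℝ × ℝ := ((v.1 : ℝ), (v.2 : ℝ))

/-- A boundary vertex of `S`: a vertex lying in the topological frontier of the
region of `S`. -/
def IsBoundaryVertex (S : Finset Cell) (v : Cell) : Prop :=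
  IsVertex S v ∧ toR v ∈ frontier (Region S)

/-- An interior vertex of `S`: a vertex not lying in the frontier of the region
of `S`. -/
def IsInteriorVertex (S : Finset Cell) (v : Cell) : Prop :=
  IsVertex S v ∧ toR v ∉ frontier (Region S)

/-- A corner of `S`: a vertex incident to exactly one cell of `S`. -/
def IsBoardCorner (S : Finset Cell) (v : Cell) : Prop := (incidentCells S v).card = 1

/-- `a` and `b` are opposite vertices of the cell `q`. -/
def OppositeVerts (q a b : Cell) : Prop :=
  ({a, b} : Finset Cell) = {q, q + (1, 1)} ∨
    ({a, b} : Finset Cell) = {q + (1, 0), q + (0, 1)}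

/-- A pre-diagonal of `S` of length `k`: vertices `v 0, …, v k` and cells
`s 0, …, s (k-1)` as in the definition of a diagonal.  (The values of `v` at
indices `> k` and of `s` at indices `≥ k` are irrelevant.) -/
def IsPreDiagonal (S : Finset Cell) (k : ℕ) (v : ℕ → Cell) (s : ℕ → Cell) : Prop :=
  1 ≤ k ∧
  IsBoardCorner S (v 0) ∧
  (∀ i, 0 < i → i < k → IsInteriorVertex S (v i)) ∧
  (∀ i, i < k → s i ∈ S) ∧
  (∀ i, i < k → OppositeVerts (s i) (v i) (v (i + 1))) ∧
  (∀ i, i + 1 < k → (cellVerts (s i) ∩ cellVerts (s (i + 1))).card = 1) ∧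
  (∀ i j, i ≤ k → j ≤ k → i ≠ j → v i ≠ v j) ∧
  (∀ i j, i < k → j < k → i ≠ j → s i ≠ s j)

/-- The pre-diagonal `(k', v', s')` extends the pre-diagonal `(k, v, s)`. -/
def PreDiagExtends (k' : ℕ) (v' s' : ℕ → Cell) (k : ℕ) (v s : ℕ → Cell) : Prop :=
  k ≤ k' ∧ (∀ i ≤ k, v' i = v i) ∧ (∀ i < k, s' i = s i)

/-- A diagonal: a pre-diagonal that is maximal under extension. -/
def IsDiagonal (S : Finset Cell) (k : ℕ) (v s : ℕ → Cell) : Prop :=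
  IsPreDiagonal S k v s ∧
    ∀ k' v' s', IsPreDiagonal S k' v' s' → PreDiagExtends k' v' s' k v s → k' = k

/-- A good diagonal: at least one of the two unit edges of the last cell
`s (k-1)` containing the final vertex `v k` is contained in the frontier of the
region of `S`. -/
def IsGoodDiagonal (S : Finset Cell) (k : ℕ) (v s : ℕ → Cell) : Prop :=
  IsDiagonal S k v s ∧
    ∃ a ∈ cellVerts (s (k - 1)),
      (a - v k = (1, 0) ∨ a - v k = (0, 1) ∨ a - v k = (-1, 0) ∨ a - v k = (0, -1)) ∧
      segment ℝ (toR (v k)) (toR a) ⊆ frontier (Region S)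

theorem mem_cellVerts_iff (p x : Cell) :
    x ∈ cellVerts p ↔ (x.1 = p.1 ∨ x.1 = p.1 + 1) ∧ (x.2 = p.2 ∨ x.2 = p.2 + 1) := by
  obtain ⟨p1, p2⟩ := p
  obtain ⟨x1, x2⟩ := x
  simp only [cellVerts, Finset.mem_insert, Finset.mem_singleton, Prod.mk_add_mk, Prod.mk.injEq]
  omega

/-- The cell having `v` and `v + (a, b)` as opposite vertices (`a, b = ±1`). -/
def diagCell (a b : ℤ) (v : Cell) : Cell := (min v.1 (v.1 + a), min v.2 (v.2 + b))

/-- `a` is a sign. -/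
def IsSgn (a : ℤ) : Prop := a = 1 ∨ a = -1

theorem opposite_imp (q u w : Cell) (h : OppositeVerts q u w) :
    ∃ a b, IsSgn a ∧ IsSgn b ∧ w = u + (a, b) ∧ q = diagCell a b u := by
  obtain ⟨q1, q2⟩ := q
  obtain ⟨u1, u2⟩ := u
  obtain ⟨w1, w2⟩ := w
  refine ⟨w1 - u1, w2 - u2, ?_⟩
  rcases h with h | h <;>
  · have h1 := congrArg (fun s => (u1, u2) ∈ s) h
    have h2 := congrArg (fun s => (w1, w2) ∈ s) h
    have h3 := congrArg (fun s => (q1, q2) ∈ s) h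
    have h4 := congrArg (fun s => (q1 + 1, q2) ∈ s) h
    have h5 := congrArg (fun s => (q1, q2 + 1) ∈ s) h
    have h6 := congrArg (fun s => (q1 + 1, q2 + 1) ∈ s) h
    simp at h1 h2 h3 h4 h5 h6
    simp only [IsSgn, diagCell, Prod.mk_add_mk, Prod.mk.injEq]
    clear h
    omega

theorem opposite_diagCell (a b : ℤ) (ha : IsSgn a) (hb : IsSgn b) (u : Cell) :
    OppositeVerts (diagCell a b u) u (u + (a, b)) := by
  obtain ⟨u1, u2⟩ := u
  unfold OppositeVerts diagCell
  rcases ha with rfl | rfl <;> rcases hb with rfl | rfl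
  · left
    ext ⟨x, y⟩; simp
  · right
    ext ⟨x, y⟩; simp
    omega
  · right
    ext ⟨x, y⟩; simp
  · left
    ext ⟨x, y⟩; simp
    omega

theorem mem_diagCell (a b : ℤ) (ha : IsSgn a) (hb : IsSgn b) (u x : Cell) :
    x ∈ cellVerts (diagCell a b u) ↔
      (x.1 = u.1 ∨ x.1 = u.1 + a) ∧ (x.2 = u.2 ∨ x.2 = u.2 + b) := by
  rw [mem_cellVerts_iff]
  unfold IsSgn at ha hb
  simp only [diagCell]
  omega

theorem exists_diagCell (q u : Cell) (h : u ∈ cellVerts q) :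
    ∃ a b, IsSgn a ∧ IsSgn b ∧ q = diagCell a b u := by
  rw [mem_cellVerts_iff] at h
  obtain ⟨q1, q2⟩ := q
  obtain ⟨u1, u2⟩ := u
  refine ⟨2 * (q1 - u1) + 1, 2 * (q2 - u2) + 1, ?_⟩
  simp only [IsSgn, diagCell, Prod.mk.injEq] at *
  omega

theorem diagCell_inj (a b a' b' : ℤ) (ha : IsSgn a) (hb : IsSgn b) (ha' : IsSgn a')
    (hb' : IsSgn b') (u : Cell) (h : diagCell a b u = diagCell a' b' u) : a' = a ∧ b' = b := by
  simp only [IsSgn, diagCell, Prod.mk.injEq] at *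
  omega

theorem card_inter_same (a b : ℤ) (ha : IsSgn a) (hb : IsSgn b) (u : Cell) :
    (cellVerts (diagCell a b u) ∩ cellVerts (diagCell a b (u + (a, b)))).card = 1 := by
  rw [Finset.card_eq_one]
  refine ⟨u + (a, b), ?_⟩
  ext ⟨x, y⟩
  rw [Finset.mem_inter, mem_diagCell a b ha hb, mem_diagCell a b ha hb, Finset.mem_singleton]
  obtain ⟨u1, u2⟩ := u
  simp only [IsSgn, Prod.mk_add_mk, Prod.mk.injEq] at *
  omega

theorem same_of_card_inter (a b a' b' : ℤ) (ha : IsSgn a) (hb : IsSgn b) (ha' : IsSgn a')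
    (hb' : IsSgn b') (u : Cell)
    (h : (cellVerts (diagCell a b u) ∩ cellVerts (diagCell a' b' (u + (a, b)))).card = 1) :
    a' = a ∧ b' = b := by
  rw [Finset.card_eq_one] at h
  obtain ⟨z, hz⟩ := h
  have key : ∀ x, x ∈ cellVerts (diagCell a b u) → x ∈ cellVerts (diagCell a' b' (u + (a, b))) →
      x = z := by
    intro x h1 h2
    rw [← Finset.mem_singleton, ← hz, Finset.mem_inter]
    exact ⟨h1, h2⟩
  simp only [mem_diagCell a b ha hb, mem_diagCell a' b' ha' hb'] at key
  have k0 := key (u + (a, b)) (by simp) (by simp)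
  have k1 := key (u + (0, b))
  have k2 := key (u + (a, 0))
  obtain ⟨u1, u2⟩ := u
  obtain ⟨z1, z2⟩ := z
  simp only [IsSgn, Prod.mk_add_mk, Prod.mk.injEq, or_true, true_or, and_true, true_and] at *
  clear key hz
  refine ⟨?_, ?_⟩
  · by_contra hne
    have := k1 (by omega) (by omega)
    omega
  · by_contra hne
    have := k2 (by omega) (by omega)
    omega

theorem interior_cell (S : Finset Cell) (v : Cell) (hv : IsInteriorVertex S v)
    (a b : ℤ) (ha : IsSgn a) (hb : IsSgn b) : diagCell a b v ∈ S := by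
  obtain ⟨⟨p, hp, hpv⟩, hf⟩ := hv
  have hmem : toR v ∈ Region S := by
    rw [mem_cellVerts_iff] at hpv
    simp only [Region, Set.mem_iUnion]
    refine ⟨p, hp, ?_⟩
    obtain ⟨h1, h2⟩ := hpv
    simp only [unitSquare, toR, Set.mem_prod, Set.mem_Icc]
    rcases h1 with h1 | h1 <;> rcases h2 with h2 | h2 <;> rw [h1, h2] <;> push_cast <;> simp
  have hint : Region S ∈ nhds (toR v) := by
    rw [← mem_interior_iff_mem_nhds]
    by_contra hcon
    exact hf ⟨subset_closure hmem, hcon⟩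
  obtain ⟨ε, hε, hball⟩ := Metric.mem_nhds_iff.mp hint
  obtain ⟨t, ht0, htε, ht1⟩ : ∃ t : ℝ, 0 < t ∧ t < ε ∧ t < 1 :=
    ⟨min (ε / 2) (1 / 2), by positivity,
      lt_of_le_of_lt (min_le_left _ _) (by linarith),
      lt_of_le_of_lt (min_le_right _ _) (by norm_num)⟩
  have haabs : |(a : ℝ)| = 1 := by rcases ha with rfl | rfl <;> simp
  have hbabs : |(b : ℝ)| = 1 := by rcases hb with rfl | rfl <;> simp
  have hx : ((v.1 : ℝ) + a * t, (v.2 : ℝ) + b * t) ∈ Region S := by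
    apply hball
    rw [Metric.mem_ball, Prod.dist_eq, max_lt_iff]
    simp only [toR, Real.dist_eq, add_sub_cancel_left, abs_mul, haabs, hbabs, abs_of_pos ht0]
    constructor <;> linarith
  simp only [Region, Set.mem_iUnion] at hx
  obtain ⟨q, hq, hxq⟩ := hx
  simp only [unitSquare, Set.mem_prod, Set.mem_Icc] at hxq
  obtain ⟨⟨h1, h2⟩, h3, h4⟩ := hxq
  have aux : ∀ (c m n : ℤ), IsSgn c → (m : ℝ) ≤ n + c * t → (n : ℝ) + c * t ≤ m + 1 →
      m = min n (n + c) := by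
    intro c m n hc h h'
    rcases hc with rfl | rfl
    · have e1 : (m : ℝ) < (n + 1 : ℤ) := by push_cast at *; linarith
      have e2 : (n : ℝ) < (m + 1 : ℤ) := by push_cast at *; linarith
      have e1 := Int.cast_lt.mp e1
      have e2 := Int.cast_lt.mp e2
      omega
    · have e1 : (m : ℝ) < (n : ℤ) := by push_cast at *; linarith
      have e2 : (n : ℝ) < (m + 2 : ℤ) := by push_cast at *; linarith
      have e1 := Int.cast_lt.mp e1
      have e2 := Int.cast_lt.mp e2
      omega
  have : q = diagCell a b v := Prod.ext (aux a q.1 v.1 ha h1 h2) (aux b q.2 v.2 hb h3 h4)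
  rwa [← this]

/-- The grid points on the line through `u` in direction `(a, b)`. -/
def diagPt (a b : ℤ) (u : Cell) (i : ℕ) : Cell := (u.1 + i * a, u.2 + i * b)

theorem diagPt_zero (a b : ℤ) (u : Cell) : diagPt a b u 0 = u := by
  simp [diagPt]

theorem diagPt_succ (a b : ℤ) (u : Cell) (i : ℕ) :
    diagPt a b u (i + 1) = diagPt a b u i + (a, b) := by
  simp only [diagPt, Prod.mk_add_mk, Prod.mk.injEq]
  push_cast
  constructor <;> ring

theorem diagPt_inj (a b : ℤ) (ha : IsSgn a) (u : Cell) (i j : ℕ)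
    (h : diagPt a b u i = diagPt a b u j) : i = j := by
  simp only [diagPt, Prod.mk.injEq] at h
  rcases ha with rfl | rfl <;> omega

theorem diagCell_diagPt_inj (a b : ℤ) (ha : IsSgn a) (u : Cell) (i j : ℕ)
    (h : diagCell a b (diagPt a b u i) = diagCell a b (diagPt a b u j)) : i = j := by
  simp only [diagCell, diagPt, Prod.mk.injEq] at h
  rcases ha with rfl | rfl <;> omega

theorem preDiagonal_eq (S : Finset Cell) (v₀ : Cell) (a b : ℤ) (ha : IsSgn a) (hb : IsSgn b)
    (hinc : incidentCells S v₀ = {diagCell a b v₀}) (k : ℕ) (v s : ℕ → Cell)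
    (h : IsPreDiagonal S k v s) (h0 : v 0 = v₀) :
    (∀ i ≤ k, v i = diagPt a b v₀ i) ∧ (∀ i < k, s i = diagCell a b (diagPt a b v₀ i)) := by
  obtain ⟨_, _, _, hsS, hopp, hcard, _, _⟩ := h
  have main : ∀ i, i < k → v i = diagPt a b v₀ i ∧ s i = diagCell a b (diagPt a b v₀ i) ∧
      v (i + 1) = diagPt a b v₀ (i + 1) := by
    intro i
    induction i with
    | zero =>
      intro hi
      obtain ⟨a', b', ha', hb', hw, hq⟩ := opposite_imp _ _ _ (hopp 0 hi)
      have hm : s 0 ∈ incidentCells S v₀ := by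
        rw [incidentCells, Finset.mem_filter]
        refine ⟨hsS 0 hi, ?_⟩
        rw [hq, h0, mem_diagCell a' b' ha' hb']
        simp
      rw [hinc, Finset.mem_singleton, hq, h0] at hm
      obtain ⟨rfl, rfl⟩ := diagCell_inj _ _ _ _ ha' hb' ha hb _ hm
      rw [diagPt_succ, diagPt_zero, hq, hw, h0]
      exact ⟨rfl, rfl, rfl⟩
    | succ i ih =>
      intro hi
      obtain ⟨_, e2, e3⟩ := ih (by omega)
      obtain ⟨a', b', ha', hb', hw, hq⟩ := opposite_imp _ _ _ (hopp (i + 1) hi)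
      have hc := hcard i hi
      rw [hq, e2, e3, diagPt_succ] at hc
      obtain ⟨rfl, rfl⟩ := same_of_card_inter _ _ _ _ ha hb ha' hb' _ hc
      refine ⟨e3, by rw [hq, e3], ?_⟩
      rw [hw, e3, ← diagPt_succ]
  refine ⟨?_, fun i hi => (main i hi).2.1⟩
  intro i hi
  rcases i with _ | i
  · rw [h0, diagPt_zero]
  · exact (main i hi).2.2

/-- **Proposition.** Given a corner `v₀` of a board there is exactly one
diagonal starting at `v₀`, and its final vertex is a boundary vertex. -/
theorem existsUnique_diagonal_from_corner
    (S : Finset Cell) (hS : IsBoard S) (v₀ : Cell) (hv₀ : IsBoardCorner S v₀) :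
    ∃ (k : ℕ) (v s : ℕ → Cell),
      IsDiagonal S k v s ∧ v 0 = v₀ ∧ IsBoundaryVertex S (v k) ∧
      ∀ (k' : ℕ) (v' s' : ℕ → Cell), IsDiagonal S k' v' s' → v' 0 = v₀ →
        k' = k ∧ (∀ i ≤ k, v' i = v i) ∧ (∀ i < k, s' i = s i) := by
  obtain ⟨q, hq⟩ := Finset.card_eq_one.mp hv₀
  have hqm : q ∈ incidentCells S v₀ := by rw [hq]; simp
  rw [incidentCells, Finset.mem_filter] at hqm
  obtain ⟨hqS, hqv⟩ := hqm
  obtain ⟨a, b, ha, hb, rfl⟩ := exists_diagCell q v₀ hqv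
  have hex : ∃ i, 0 < i ∧ ¬ IsInteriorVertex S (diagPt a b v₀ i) := by
    by_contra! hcon
    have hinj : Function.Injective (fun i : ℕ =>
        (⟨diagCell a b (diagPt a b v₀ (i + 1)),
          interior_cell S _ (hcon (i + 1) (Nat.succ_pos i)) a b ha hb⟩ : {x // x ∈ S})) := by
      intro i j hij
      have := diagCell_diagPt_inj a b ha v₀ _ _ (congrArg Subtype.val hij)
      omega
    exact not_injective_infinite_finite _ hinj
  classical
  obtain ⟨hk0, hkni⟩ := Nat.find_spec hex
  have hmin : ∀ i, 0 < i → i < Nat.find hex → IsInteriorVertex S (diagPt a b v₀ i) := by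
    intro i h0 hi
    by_contra hcon
    exact Nat.find_min hex hi ⟨h0, hcon⟩
  generalize Nat.find hex = k at hk0 hkni hmin
  have hcell : ∀ i, i < k → diagCell a b (diagPt a b v₀ i) ∈ S := by
    intro i hi
    rcases Nat.eq_zero_or_pos i with rfl | h0
    · rwa [diagPt_zero]
    · exact interior_cell S _ (hmin i h0 hi) a b ha hb
  have hpre : IsPreDiagonal S k (diagPt a b v₀) (fun i => diagCell a b (diagPt a b v₀ i)) := by
    refine ⟨hk0, by rwa [diagPt_zero], hmin, hcell, ?_, ?_, ?_, ?_⟩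
    · intro i _
      rw [diagPt_succ]
      exact opposite_diagCell a b ha hb _
    · intro i _
      simp only [diagPt_succ]
      exact card_inter_same a b ha hb _
    · intro i j _ _ hij h
      exact hij (diagPt_inj a b ha v₀ i j h)
    · intro i j _ _ hij h
      exact hij (diagCell_diagPt_inj a b ha v₀ i j h)
  have hle : ∀ k' v' s', IsPreDiagonal S k' v' s' → v' 0 = v₀ → k' ≤ k := by
    intro k' v' s' h h0
    by_contra! hlt
    have e := (preDiagonal_eq S v₀ a b ha hb hq k' v' s' h h0).1 k hlt.le
    have := h.2.2.1 k hk0 hlt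
    rw [e] at this
    exact hkni this
  refine ⟨k, diagPt a b v₀, fun i => diagCell a b (diagPt a b v₀ i), ⟨hpre, ?_⟩,
    diagPt_zero a b v₀, ?_, ?_⟩
  · intro k' v' s' h hext
    have h0 : v' 0 = v₀ := by rw [hext.2.1 0 (Nat.zero_le _), diagPt_zero]
    exact le_antisymm (hle k' v' s' h h0) hext.1
  · have hvert : IsVertex S (diagPt a b v₀ k) := by
      obtain ⟨j, rfl⟩ : ∃ j, k = j + 1 := ⟨k - 1, by omega⟩
      refine ⟨_, hcell j (Nat.lt_succ_self j), ?_⟩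
      rw [mem_diagCell a b ha hb, diagPt_succ]
      simp
    refine ⟨hvert, ?_⟩
    by_contra hcon
    exact hkni ⟨hvert, hcon⟩
  · intro k' v' s' h h0
    obtain ⟨e1, e2⟩ := preDiagonal_eq S v₀ a b ha hb hq k' v' s' h.1 h0
    have hkk : k ≤ k' := by
      have hk' := hle k' v' s' h.1 h0
      exact (h.2 k _ _ hpre ⟨hk', fun i hi => (e1 i hi).symm, fun i hi => (e2 i hi).symm⟩).le
    have hkk' : k' = k := le_antisymm (hle k' v' s' h.1 h0) hkk
    subst hkk'
    exact ⟨rfl, e1, e2⟩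
end

section
/- Let S be a board. For r ≥ 1, let V_r denote the number of boundary vertices of S that are incident to exactly r cells of S. Then V₁ − V₃ − 2·V₄ = 4. -/
open scoped Matrix

theorem disk_lift (f : Metric.closedBall (0 : EuclideanSpace ℝ (Fin 2)) 1 → ℂ)
    (hf : Continuous f) (h0 : ∀ x, f x ≠ 0) :
    ∃ F : Metric.closedBall (0 : EuclideanSpace ℝ (Fin 2)) 1 → ℂ, Continuous F ∧
      ∀ x, Complex.exp (F x) = f x := by
  let r : EuclideanSpace ℝ (Fin 2) → Metric.closedBall (0 : EuclideanSpace ℝ (Fin 2)) 1 :=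
    fun x => ⟨(max 1 ‖x‖)⁻¹ • x, by
      have h1 : 0 < max 1 ‖x‖ := lt_of_lt_of_le one_pos (le_max_left _ _)
      rw [mem_closedBall_zero_iff, norm_smul, Real.norm_of_nonneg (by positivity),
        inv_mul_le_iff₀ h1, mul_one]
      exact le_max_right _ _⟩
  have hr : Continuous r := by
    refine Continuous.subtype_mk ?_ _
    refine Continuous.smul (Continuous.inv₀ (continuous_const.max continuous_norm) ?_) continuous_id
    intro x
    exact (lt_of_lt_of_le one_pos (le_max_left _ _)).ne'
  have hrx : ∀ x : Metric.closedBall (0 : EuclideanSpace ℝ (Fin 2)) 1, r x = x := by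
    intro x
    apply Subtype.ext
    have : ‖(x : EuclideanSpace ℝ (Fin 2))‖ ≤ 1 := mem_closedBall_zero_iff.1 x.2
    simp [r, max_eq_left this]
  obtain ⟨F, ⟨-, hF⟩, -⟩ := Complex.isCoveringMapOn_exp.existsUnique_continuousMap_lifts
    (⟨fun x => f (r x), hf.comp hr⟩ : C(EuclideanSpace ℝ (Fin 2), ℂ)) (a₀ := 0)
    (e₀ := Complex.log (f (r 0))) (by simp [Complex.exp_log (h0 _)]) (fun a => h0 _)
  refine ⟨fun x => F x, F.continuous.comp continuous_subtype_val, fun x => ?_⟩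
  have := congrFun hF x
  simpa [hrx] using this

theorem region_lift {S : Finset Cell} (hS : IsBoard S) (f : ℝ × ℝ → ℂ)
    (hf : ContinuousOn f (Region S)) (h0 : ∀ x ∈ Region S, f x ≠ 0) :
    ∃ F : ℝ × ℝ → ℂ, ContinuousOn F (Region S) ∧
      ∀ x ∈ Region S, Complex.exp (F x) = f x := by
  classical
  obtain ⟨-, ⟨e⟩⟩ := hS
  obtain ⟨F, hF, hFe⟩ := disk_lift (fun x => f (e.symm x))
    ((continuousOn_iff_continuous_domRestrict.1 hf).comp e.symm.continuous)
    (fun x => h0 _ (e.symm x).2)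
  refine ⟨fun x => if h : x ∈ Region S then F (e ⟨x, h⟩) else 0, ?_, ?_⟩
  · rw [continuousOn_iff_continuous_domRestrict]
    convert hF.comp e.continuous using 1
    ext x
    simp
  · intro x hx
    simp [hx, hFe]

theorem disk_diff_preconnected (x : EuclideanSpace ℝ (Fin 2)) :
    IsPreconnected (Metric.closedBall (0 : EuclideanSpace ℝ (Fin 2)) 1 \ {x}) := by
  have hrank : 1 < Module.rank ℝ (EuclideanSpace ℝ (Fin 2)) := by
    rw [← Module.finrank_eq_rank]; simp
  have hb : IsPreconnected (Metric.ball (0 : EuclideanSpace ℝ (Fin 2)) 1 ∩ {x}ᶜ) := by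
    by_cases hx : x ∈ Metric.ball (0 : EuclideanSpace ℝ (Fin 2)) 1
    · let e : EuclideanSpace ℝ (Fin 2) ≃ₜ Metric.ball (0 : EuclideanSpace ℝ (Fin 2)) 1 :=
        Homeomorph.unitBall
      have h1 := (isConnected_compl_singleton_of_one_lt_rank hrank (e.symm ⟨x, hx⟩)).isPreconnected
      have h2 := h1.image (fun z => (e z : EuclideanSpace ℝ (Fin 2)))
        (continuous_subtype_val.comp e.continuous).continuousOn
      convert h2 using 1
      ext z
      simp only [Set.mem_inter_iff, Set.mem_compl_iff, Set.mem_singleton_iff, Set.mem_image]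
      constructor
      · rintro ⟨hz, hne⟩
        refine ⟨e.symm ⟨z, hz⟩, ?_, by simp⟩
        intro h
        exact hne (congrArg Subtype.val (e.symm.injective h))
      · rintro ⟨y, hy, rfl⟩
        refine ⟨(e y).2, ?_⟩
        intro h
        apply hy
        rw [Homeomorph.eq_symm_apply]
        exact Subtype.ext h
    · have : Metric.ball (0 : EuclideanSpace ℝ (Fin 2)) 1 ∩ {x}ᶜ = Metric.ball 0 1 := by
        apply Set.inter_eq_left.2
        intro y hy h
        exact hx (h ▸ hy)
      rw [this]
      exact Metric.isPreconnected_ball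
  refine hb.subset_closure ?_ ?_
  · rintro z ⟨hz, hne⟩
    exact ⟨Metric.ball_subset_closedBall hz, hne⟩
  · rintro z ⟨hz, -⟩
    have hd : Dense ({x}ᶜ : Set (EuclideanSpace ℝ (Fin 2))) := dense_compl_singleton x
    have h1 := hd.open_subset_closure_inter
      (Metric.isOpen_ball (x := (0 : EuclideanSpace ℝ (Fin 2))) (ε := 1))
    have h2 := closure_mono h1
    rw [closure_closure, closure_ball _ one_ne_zero] at h2
    exact h2 hz

theorem region_diff_preconnected {S : Finset Cell} (hS : IsBoard S) (x : ℝ × ℝ)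
    (hx : x ∈ Region S) : IsPreconnected (Region S \ {x}) := by
  obtain ⟨-, ⟨e⟩⟩ := hS
  have h1 := disk_diff_preconnected (e ⟨x, hx⟩ : EuclideanSpace ℝ (Fin 2))
  have h2 : IsPreconnected
      ({e ⟨x, hx⟩}ᶜ : Set (Metric.closedBall (0 : EuclideanSpace ℝ (Fin 2)) 1)) := by
    rw [← Topology.IsInducing.subtypeVal.isPreconnected_image]
    convert h1 using 1
    ext z
    simp only [Set.mem_image, Set.mem_sdiff, Set.mem_compl_iff, Set.mem_singleton_iff]
    constructor
    · rintro ⟨y, hy, rfl⟩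
      exact ⟨y.2, fun h => hy (Subtype.ext h)⟩
    · rintro ⟨hz, hne⟩
      exact ⟨⟨z, hz⟩, fun h => hne (congrArg Subtype.val h), rfl⟩
  have h3 := h2.image (fun z => (e.symm z : ℝ × ℝ))
    (continuous_subtype_val.comp e.symm.continuous).continuousOn
  convert h3 using 1
  ext z
  simp only [Set.mem_image, Set.mem_sdiff, Set.mem_compl_iff, Set.mem_singleton_iff]
  constructor
  · rintro ⟨hz, hne⟩
    refine ⟨e ⟨z, hz⟩, fun h => hne (congrArg Subtype.val (e.injective h)), by simp⟩
  · rintro ⟨y, hy, rfl⟩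
    refine ⟨(e.symm y).2, fun h => hy ?_⟩
    rw [← Homeomorph.symm_apply_eq]
    exact Subtype.ext h

theorem region_preconnected {S : Finset Cell} (hS : IsBoard S) : IsPreconnected (Region S) := by
  obtain ⟨-, ⟨e⟩⟩ := hS
  have h2 : IsPreconnected
      (Set.univ : Set (Metric.closedBall (0 : EuclideanSpace ℝ (Fin 2)) 1)) := by
    have : PreconnectedSpace (Metric.closedBall (0 : EuclideanSpace ℝ (Fin 2)) 1) :=
      isPreconnected_iff_preconnectedSpace.1 Metric.isPreconnected_closedBall
    exact isPreconnected_univ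
  have h3 := h2.image (fun z => (e.symm z : ℝ × ℝ))
    (continuous_subtype_val.comp e.symm.continuous).continuousOn
  convert h3 using 1
  ext z
  simp only [Set.mem_image, Set.mem_univ, true_and]
  constructor
  · intro hz
    exact ⟨e ⟨z, hz⟩, by simp⟩
  · rintro ⟨y, rfl⟩
    exact (e.symm y).2

theorem isClosed_unitSquare (p : Cell) : IsClosed (unitSquare p) :=
  isClosed_Icc.prod isClosed_Icc

theorem mem_region {S : Finset Cell} {x : ℝ × ℝ} :
    x ∈ Region S ↔ ∃ p ∈ S, x ∈ unitSquare p := by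
  simp [Region]

theorem isClosed_region (S : Finset Cell) : IsClosed (Region S) :=
  S.finite_toSet.isClosed_biUnion fun p _ => isClosed_unitSquare p

theorem continuousOn_region {S : Finset Cell} {Y : Type*} [TopologicalSpace Y] {g : ℝ × ℝ → Y}
    (h : ∀ p ∈ S, ContinuousOn g (unitSquare p)) : ContinuousOn g (Region S) := by
  have : Region S = ⋃ p : S, unitSquare p := by
    ext x; simp [Region]
  rw [this]
  exact (locallyFinite_of_finite _).continuousOn_iUnion (fun p => isClosed_unitSquare p)
    (fun p => h p p.2)

theorem exp_const_of_preconnected {s : Set (ℝ × ℝ)} (hs : IsPreconnected s) {g : ℝ × ℝ → ℂ}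
    (hg : ContinuousOn g s) (c : ℂ) (he : ∀ x ∈ s, Complex.exp (g x) = c)
    {x y : ℝ × ℝ} (hx : x ∈ s) (hy : y ∈ s) : g x = g y :=
  Complex.isCoveringMap_exp.constOn_of_comp hs hg
    (fun a ha b hb => Subtype.ext ((he a ha).trans (he b hb).symm)) hx hy

theorem log_I_ne : Complex.log Complex.I - Complex.log (-Complex.I) ≠
    Complex.log (-Complex.I) - Complex.log Complex.I := by
  rw [Complex.log_I, Complex.log_neg_I]
  intro h
  have := congrArg Complex.im h
  simp at this
  linarith [Real.pi_pos]

theorem no_pinch {S : Finset Cell} (hS : IsBoard S) (v : ℝ × ℝ) (d : ℂ) (hd : d ≠ 0)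
    (h1 : ∀ t : ℝ, -1 ≤ t → t ≤ 1 → t ≠ 0 → (v.1 + t * d.re, v.2 + t * d.im) ∉ Region S)
    (h2 : ∀ t : ℝ, -1 ≤ t → t ≤ 1 → (v.1 - t * d.im, v.2 + t * d.re) ∈ Region S) : False := by
  let w : ℝ × ℝ → ℂ := fun x => ⟨x.1 - v.1, x.2 - v.2⟩
  have hwc : Continuous w := by
    have : w = fun x => ((x.1 - v.1 : ℝ) : ℂ) + ((x.2 - v.2 : ℝ) : ℂ) * Complex.I := by
      ext x; simp [w, Complex.mk_eq_add_mul_I]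
    rw [this]; fun_prop
  have hwt : ∀ x, x ∈ Region S → ∀ t : ℝ, -1 ≤ t → t ≤ 1 → w x = t * d → x = v := by
    intro x hx t ht1 ht2 hw
    have hre := congrArg Complex.re hw
    have him := congrArg Complex.im hw
    simp only [w, Complex.mul_re, Complex.mul_im, Complex.ofReal_re, Complex.ofReal_im, zero_mul,
      sub_zero, add_zero] at hre him
    by_cases h0 : t = 0
    · subst h0
      ext
      · linarith
      · linarith
    · refine absurd hx ?_
      have : x = (v.1 + t * d.re, v.2 + t * d.im) := by
        ext
        · simp; linarith
        · simp; linarith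
      rw [this]
      exact h1 t ht1 ht2 h0
  have hwv : w v = 0 := by
    apply Complex.ext <;> simp [w]
  have hplus : ∀ x ∈ Region S, w x + d ≠ 0 := by
    intro x hx h
    have hw : w x = ((-1 : ℝ) : ℂ) * d := by push_cast; linear_combination h
    have := hwt x hx (-1) (by norm_num) (by norm_num) hw
    subst this
    rw [hwv, zero_add] at h
    exact hd h
  have hminus : ∀ x ∈ Region S, w x - d ≠ 0 := by
    intro x hx h
    have hw : w x = ((1 : ℝ) : ℂ) * d := by push_cast; linear_combination h
    have := hwt x hx (1) (by norm_num) (by norm_num) hw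
    subst this
    rw [hwv, zero_sub, neg_eq_zero] at h
    exact hd h
  let f : ℝ × ℝ → ℂ := fun x => (w x - d) / (w x + d)
  have hfc : ContinuousOn f (Region S) :=
    ContinuousOn.div (by fun_prop) (by fun_prop) hplus
  have hf0 : ∀ x ∈ Region S, f x ≠ 0 := fun x hx => div_ne_zero (hminus x hx) (hplus x hx)
  obtain ⟨F, hF, hFe⟩ := region_lift hS f hfc hf0
  have hslit : ∀ x ∈ Region S \ {v}, f x ∈ Complex.slitPlane := by
    rintro x ⟨hx, hne⟩
    rw [Complex.mem_slitPlane_iff_not_le_zero]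
    intro hle
    apply hne
    obtain ⟨hre, him⟩ := Complex.le_def.1 hle
    simp only [Complex.zero_re, Complex.zero_im] at hre him
    set r : ℝ := -(f x).re with hr
    have hr0 : 0 ≤ r := by linarith
    have hfr : f x = -(r : ℂ) := by
      apply Complex.ext <;> simp [hr, him]
    have hmul : w x - d = -(r : ℂ) * (w x + d) := by
      rw [← hfr]; exact (div_mul_cancel₀ _ (hplus x hx)).symm
    have h1r : (1 + r : ℂ) ≠ 0 := by
      have : (1 + r : ℝ) ≠ 0 := by positivity
      exact_mod_cast this
    refine hwt x hx ((1 - r) / (1 + r)) ?_ ?_ ?_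
    · rw [le_div_iff₀ (by positivity)]; linarith
    · rw [div_le_iff₀ (by positivity)]; linarith
    · push_cast
      field_simp
      linear_combination hmul
  have hfp : ∀ t : ℝ, f (v.1 - t * d.im, v.2 + t * d.re) =
      (t * Complex.I - 1) / (t * Complex.I + 1) := by
    intro t
    have : w (v.1 - t * d.im, v.2 + t * d.re) = t * Complex.I * d := by
      apply Complex.ext <;> simp [w]
    simp only [f, this]
    rw [show (t * Complex.I * d - d : ℂ) = (t * Complex.I - 1) * d by ring,
      show (t * Complex.I * d + d : ℂ) = (t * Complex.I + 1) * d by ring]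
    exact mul_div_mul_right _ _ hd
  have hI1 : (Complex.I + 1 : ℂ) ≠ 0 := by
    intro h; have := congrArg Complex.im h; simp at this
  have hI2 : (-Complex.I + 1 : ℂ) ≠ 0 := by
    intro h; have := congrArg Complex.im h; simp at this
  have hfpos : f (v.1 - (1 : ℝ) * d.im, v.2 + (1 : ℝ) * d.re) = Complex.I := by
    rw [hfp, Complex.ofReal_one, one_mul, div_eq_iff hI1]
    linear_combination -Complex.I_sq
  have hfneg : f (v.1 - (-1 : ℝ) * d.im, v.2 + (-1 : ℝ) * d.re) = -Complex.I := by
    rw [hfp, Complex.ofReal_neg, Complex.ofReal_one, neg_one_mul, div_eq_iff hI2]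
    linear_combination -Complex.I_sq
  have hvR : v ∈ Region S := by simpa using h2 0 (by norm_num) (by norm_num)
  have hne : ∀ t : ℝ, t ≠ 0 → (v.1 - t * d.im, v.2 + t * d.re) ≠ v := by
    intro t ht h
    apply hd
    have e1 := congrArg Prod.fst h
    have e2 := congrArg Prod.snd h
    simp only [sub_eq_self, add_eq_left, mul_eq_zero, ht, false_or] at e1 e2
    exact Complex.ext e2 e1
  -- constancy off the pinch point
  have hA := exp_const_of_preconnected (region_diff_preconnected hS v hvR)
    (g := fun x => F x - Complex.log (f x))
    ((hF.mono Set.sdiff_subset).sub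
      (ContinuousOn.clog (hfc.mono Set.sdiff_subset) hslit)) 1
    (by
      rintro x hx
      rw [Complex.exp_sub, hFe x hx.1, Complex.exp_log (hf0 x hx.1), div_self (hf0 x hx.1)])
    (x := (v.1 - (1 : ℝ) * d.im, v.2 + (1 : ℝ) * d.re))
    (y := (v.1 - (-1 : ℝ) * d.im, v.2 + (-1 : ℝ) * d.re))
    ⟨h2 _ (by norm_num) (by norm_num), hne 1 (by norm_num)⟩
    ⟨h2 _ (by norm_num) (by norm_num), hne (-1) (by norm_num)⟩
  -- constancy along the segment through the pinch point
  let T : Set (ℝ × ℝ) := (fun t : ℝ => (v.1 - t * d.im, v.2 + t * d.re)) '' Set.Icc (-1) 1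
  have hT : IsPreconnected T := isPreconnected_Icc.image _ (by fun_prop)
  have hTR : T ⊆ Region S := by
    rintro _ ⟨t, ht, rfl⟩
    exact h2 t ht.1 ht.2
  have hB := exp_const_of_preconnected hT
    (g := fun x => F x - Complex.log (- f x))
    ((hF.mono hTR).sub
      (ContinuousOn.clog (hfc.mono hTR).neg (by
        rintro _ ⟨t, ht, rfl⟩
        simp only [hfp]
        have hval : -((t * Complex.I - 1) / (t * Complex.I + 1) : ℂ) =
            ⟨(1 - t ^ 2) / (1 + t ^ 2), -(2 * t) / (1 + t ^ 2)⟩ := by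
          have hn : (t * Complex.I + 1 : ℂ) ≠ 0 := by
            intro h; have := congrArg Complex.re h; simp at this
          have hn2 : (1 + t ^ 2 : ℂ) ≠ 0 := by
            have : (1 + t ^ 2 : ℝ) ≠ 0 := by positivity
            exact_mod_cast this
          rw [Complex.mk_eq_add_mul_I]
          push_cast
          field_simp
          linear_combination (2 * t ^ 2 : ℂ) * Complex.I_sq
        rw [hval, Complex.mem_slitPlane_iff]
        by_cases h0 : t = 0
        · left; simp [h0]
        · right
          have : (1 + t ^ 2 : ℝ) ≠ 0 := by positivity
          simp [h0, this]))) (-1)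
    (by
      rintro x hx
      rw [Complex.exp_sub, hFe x (hTR hx), Complex.exp_log (neg_ne_zero.2 (hf0 x (hTR hx))),
        div_neg, div_self (hf0 x (hTR hx))])
    (x := (v.1 - (1 : ℝ) * d.im, v.2 + (1 : ℝ) * d.re))
    (y := (v.1 - (-1 : ℝ) * d.im, v.2 + (-1 : ℝ) * d.re))
    ⟨1, by simp, rfl⟩ ⟨-1, by simp, rfl⟩
  simp only [hfpos, hfneg, neg_neg] at hA hB
  exact log_I_ne (by linear_combination hB - hA)

theorem open_cell_unique {S : Finset Cell} {q : Cell} {x : ℝ × ℝ} (hx : x ∈ Region S)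
    (h1 : (q.1 : ℝ) < x.1) (h2 : x.1 < q.1 + 1) (h3 : (q.2 : ℝ) < x.2) (h4 : x.2 < q.2 + 1) :
    q ∈ S := by
  obtain ⟨p, hp, hx⟩ := mem_region.1 hx
  rw [mem_unitSquare] at hx
  obtain ⟨⟨a, b⟩, c, d⟩ := hx
  have e1 : (p.1 : ℝ) < q.1 + 1 := by linarith
  have e2 : (q.1 : ℝ) < p.1 + 1 := by linarith
  have e3 : (p.2 : ℝ) < q.2 + 1 := by linarith
  have e4 : (q.2 : ℝ) < p.2 + 1 := by linarith
  norm_cast at e1 e2 e3 e4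
  have : p = q := by
    ext
    · omega
    · omega
  exact this ▸ hp

theorem no_diag_one {S : Finset Cell} (hS : IsBoard S) (v : Cell) (ha : v ∈ S)
    (hb : v - (1, 1) ∈ S) (hc : v - (1, 0) ∉ S) (hd : v - (0, 1) ∉ S) : False := by
  refine no_pinch hS (toR v) ⟨-1 / 2, 1 / 2⟩ ?_ ?_ ?_
  · intro h; have := congrArg Complex.re h; norm_num at this
  · intro t ht1 ht2 h0 hmem
    rcases lt_or_gt_of_ne h0 with h | h
    · apply hd
      apply open_cell_unique hmem <;> simp [toR] <;> linarith
    · apply hc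
      apply open_cell_unique hmem <;> simp [toR] <;> linarith
  · intro t ht1 ht2
    rw [mem_region]
    rcases le_total t 0 with h | h
    · refine ⟨_, ha, mem_unitSquare.2 ?_⟩
      simp only [toR]
      refine ⟨⟨?_, ?_⟩, ?_, ?_⟩ <;> linarith
    · refine ⟨_, hb, mem_unitSquare.2 ?_⟩
      simp [toR]
      refine ⟨⟨?_, ?_⟩, ?_, ?_⟩ <;> linarith

theorem no_diag_two {S : Finset Cell} (hS : IsBoard S) (v : Cell) (ha : v ∉ S)
    (hb : v - (1, 1) ∉ S) (hc : v - (1, 0) ∈ S) (hd : v - (0, 1) ∈ S) : False := by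
  refine no_pinch hS (toR v) ⟨1 / 2, 1 / 2⟩ ?_ ?_ ?_
  · intro h; have := congrArg Complex.re h; norm_num at this
  · intro t ht1 ht2 h0 hmem
    rcases lt_or_gt_of_ne h0 with h | h
    · apply hb
      apply open_cell_unique hmem <;> simp [toR] <;> linarith
    · apply ha
      apply open_cell_unique hmem <;> simp [toR] <;> linarith
  · intro t ht1 ht2
    rw [mem_region]
    rcases le_total t 0 with h | h
    · refine ⟨_, hd, mem_unitSquare.2 ?_⟩
      simp [toR]
      refine ⟨⟨?_, ?_⟩, ?_, ?_⟩ <;> linarith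
    · refine ⟨_, hc, mem_unitSquare.2 ?_⟩
      simp [toR]
      refine ⟨⟨?_, ?_⟩, ?_, ?_⟩ <;> linarith

theorem preconnected_unitSquare (p : Cell) : IsPreconnected (unitSquare p) :=
  isPreconnected_Icc.prod isPreconnected_Icc

theorem floor_cases {m : ℤ} {a : ℝ} (h1 : (m : ℝ) ≤ a) (h2 : a ≤ m + 1) :
    ⌊a⌋ = m ∨ (⌊a⌋ = m + 1 ∧ a = m + 1) := by
  rcases h2.lt_or_eq with h | h
  · left; exact Int.floor_eq_iff.2 ⟨h1, h⟩
  · right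
    refine ⟨?_, h⟩
    rw [h, Int.floor_add_one, Int.floor_intCast]

theorem toR_mem_of_cell {p : Cell} :
    toR p ∈ unitSquare p ∧ toR (p + (1, 0)) ∈ unitSquare p ∧ toR (p + (0, 1)) ∈ unitSquare p ∧
      toR (p + (1, 1)) ∈ unitSquare p := by
  refine ⟨?_, ?_, ?_, ?_⟩ <;> rw [mem_unitSquare] <;> simp [toR]

theorem square_subset {S : Finset Cell} {p : Cell} (hp : p ∈ S) : unitSquare p ⊆ Region S :=
  fun _ hx => mem_region.2 ⟨p, hp, hx⟩

/-- Connectedness: a vertex function constant along edges is constant. -/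
theorem vertex_const {S : Finset Cell} (hS : IsBoard S) (u : Cell → ℤ)
    (hu : ∀ p ∈ S, u (p + (1, 0)) = u p ∧ u (p + (0, 1)) = u p ∧ u (p + (1, 1)) = u p)
    {p q : Cell} (hp : p ∈ S) (hq : q ∈ S) : u p = u q := by
  let g : ℝ × ℝ → ℤ := fun x => u (⌊x.1⌋, ⌊x.2⌋)
  have hg : ∀ p ∈ S, ∀ x ∈ unitSquare p, g x = u p := by
    intro p hp x hx
    obtain ⟨⟨a, b⟩, c, d⟩ := mem_unitSquare.1 hx
    obtain ⟨h1, h2, h3⟩ := hu p hp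
    have e1 : p + (1, 0) = (p.1 + 1, p.2) := by ext <;> simp
    have e2 : p + (0, 1) = (p.1, p.2 + 1) := by ext <;> simp
    have e3 : p + (1, 1) = (p.1 + 1, p.2 + 1) := by ext <;> simp
    rw [e1] at h1
    rw [e2] at h2
    rw [e3] at h3
    rcases floor_cases a b with h | ⟨h, -⟩ <;> rcases floor_cases c d with h' | ⟨h', -⟩ <;>
      simp only [g, h, h'] <;> assumption
  have hc : ContinuousOn g (Region S) := by
    apply continuousOn_region
    intro p hp
    exact continuousOn_const.congr (hg p hp)
  have := (region_preconnected hS).constant hc (square_subset hp (toR_mem_of_cell (p := p)).1)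
    (square_subset hq (toR_mem_of_cell (p := q)).1)
  rwa [hg p hp _ toR_mem_of_cell.1, hg q hq _ toR_mem_of_cell.1] at this

/-- Bilinear interpolation of a cocycle on a cell. -/
noncomputable def interp (ch cv : Cell → ℤ) (p : Cell) (x : ℝ × ℝ) : ℝ :=
  (x.1 - p.1) * ch p + (x.2 - p.2) * cv p +
    (x.1 - p.1) * (x.2 - p.2) * (cv (p + (1, 0)) - cv p)

theorem interp_floor (ch cv : Cell → ℤ) (p : Cell)
    (hc : ch p + cv (p + (1, 0)) = cv p + ch (p + (0, 1))) (x : ℝ × ℝ) (hx : x ∈ unitSquare p) :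
    ∃ n : ℤ, interp ch cv (⌊x.1⌋, ⌊x.2⌋) x = interp ch cv p x + n := by
  obtain ⟨⟨a, b⟩, c, d⟩ := mem_unitSquare.1 hx
  have hc' : (ch p + cv (p + (1, 0)) : ℝ) = cv p + ch (p + (0, 1)) := by exact_mod_cast hc
  rcases floor_cases a b with h | ⟨h, e⟩ <;> rcases floor_cases c d with h' | ⟨h', e'⟩ <;>
    rw [h, h']
  · exact ⟨0, by simp⟩
  · refine ⟨- cv p, ?_⟩
    have : ((p.1, p.2 + 1) : Cell) = p + (0, 1) := by ext <;> simp
    rw [this]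
    simp only [interp, e', Prod.fst_add, Prod.snd_add, Int.cast_add, Int.cast_one, Int.cast_zero,
      Int.cast_neg]
    linear_combination (p.1 - x.1) * hc'
  · refine ⟨- ch p, ?_⟩
    have : ((p.1 + 1, p.2) : Cell) = p + (1, 0) := by ext <;> simp
    rw [this]
    simp only [interp, e, Prod.fst_add, Prod.snd_add, Int.cast_add, Int.cast_one, Int.cast_zero,
      Int.cast_neg]
    ring
  · refine ⟨- ch p - cv (p + (1, 0)), ?_⟩
    simp only [interp, e, e', Int.cast_add, Int.cast_one, Int.cast_sub,
      Int.cast_neg]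
    ring

/-- Vanishing of the first cohomology of a board, in cellular form. -/
theorem cocycle_exact {S : Finset Cell} (hS : IsBoard S) (ch cv : Cell → ℤ)
    (hc : ∀ p ∈ S, ch p + cv (p + (1, 0)) = cv p + ch (p + (0, 1))) :
    ∃ u : Cell → ℤ, ∀ p ∈ S, u (p + (1, 0)) - u p = ch p ∧ u (p + (0, 1)) - u p = cv p ∧
      u (p + (1, 1)) - u (p + (0, 1)) = ch (p + (0, 1)) ∧
      u (p + (1, 1)) - u (p + (1, 0)) = cv (p + (1, 0)) := by
  let T : ℂ := 2 * Real.pi * Complex.I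
  have hT : T ≠ 0 := Complex.two_pi_I_ne_zero
  let g : ℝ × ℝ → ℂ := fun x => Complex.exp ((interp ch cv (⌊x.1⌋, ⌊x.2⌋) x : ℝ) * T)
  have hg : ∀ p ∈ S, ∀ x ∈ unitSquare p, g x = Complex.exp ((interp ch cv p x : ℝ) * T) := by
    intro p hp x hx
    obtain ⟨n, hn⟩ := interp_floor ch cv p (hc p hp) x hx
    simp only [g, hn]
    rw [Complex.exp_eq_exp_iff_exists_int]
    exact ⟨n, by push_cast; simp only [T]; ring⟩
  have hcont : ∀ p : Cell, Continuous (fun x : ℝ × ℝ => ((interp ch cv p x : ℝ) : ℂ) * T) := by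
    intro p
    unfold interp
    fun_prop
  have hgc : ContinuousOn g (Region S) := by
    apply continuousOn_region
    intro p hp
    exact (Complex.continuous_exp.comp (hcont p)).continuousOn.congr (hg p hp)
  obtain ⟨F, hF, hFe⟩ := region_lift hS g hgc (fun x _ => Complex.exp_ne_zero _)
  have hint : ∀ v : Cell, ∃ n : ℤ, toR v ∈ Region S → F (toR v) = n * T := by
    intro v
    by_cases hv : toR v ∈ Region S
    · have := hFe _ hv
      have hg1 : g (toR v) = 1 := by simp [g, toR, interp]
      rw [hg1, Complex.exp_eq_one_iff] at this
      obtain ⟨n, hn⟩ := this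
      exact ⟨n, fun _ => hn⟩
    · exact ⟨0, fun h => absurd h hv⟩
  choose u hu using hint
  refine ⟨u, fun p hp => ?_⟩
  have hconst : ∀ v : Cell, toR v ∈ unitSquare p →
      (u v : ℝ) - interp ch cv p (toR v) = u p := by
    intro v hv
    have h1 := exp_const_of_preconnected (preconnected_unitSquare p)
      (g := fun x => F x - ((interp ch cv p x : ℝ) : ℂ) * T)
      ((hF.mono (square_subset hp)).sub (hcont p).continuousOn) 1
      (by
        intro x hx
        rw [Complex.exp_sub, hFe x (square_subset hp hx), hg p hp x hx,
          div_self (Complex.exp_ne_zero _)])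
      hv (toR_mem_of_cell (p := p)).1
    simp only [hu v (square_subset hp hv), hu p (square_subset hp toR_mem_of_cell.1)] at h1
    have h0 : interp ch cv p (toR p) = 0 := by simp [interp, toR]
    rw [h0] at h1
    have h2 : ((u v : ℂ) - (interp ch cv p (toR v) : ℝ)) * T = u p * T := by
      rw [sub_mul, h1]; simp
    have h3 := mul_right_cancel₀ hT h2
    exact_mod_cast h3
  obtain ⟨-, m1, m2, m3⟩ := toR_mem_of_cell (p := p)
  have k1 := hconst _ m1
  have k2 := hconst _ m2
  have k3 := hconst _ m3
  have hcp := hc p hp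
  simp only [interp, toR, Prod.fst_add, Prod.snd_add, Int.cast_add, Int.cast_one,
    add_sub_cancel_left, add_zero, sub_self, zero_mul, one_mul, mul_zero, zero_add] at k1 k2 k3
  norm_cast at k1 k2 k3
  refine ⟨?_, ?_, ?_, ?_⟩ <;> linarith

def boardV (S : Finset Cell) : Finset Cell := S.biUnion cellVerts
def boardEh (S : Finset Cell) : Finset Cell := S ∪ S.image (· + (0, 1))
def boardEv (S : Finset Cell) : Finset Cell := S ∪ S.image (· + (1, 0))

theorem mem_image_shift {A : Finset Cell} {t v : Cell} :
    v ∈ A.image (· + t) ↔ v - t ∈ A := by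
  simp only [Finset.mem_image]
  constructor
  · rintro ⟨a, ha, rfl⟩; simpa using ha
  · intro h; exact ⟨_, h, by simp⟩

theorem mem_boardEh {S : Finset Cell} {v : Cell} :
    v ∈ boardEh S ↔ v ∈ S ∨ v - (0, 1) ∈ S := by
  rw [boardEh, Finset.mem_union, mem_image_shift]

theorem mem_boardEv {S : Finset Cell} {v : Cell} :
    v ∈ boardEv S ↔ v ∈ S ∨ v - (1, 0) ∈ S := by
  rw [boardEv, Finset.mem_union, mem_image_shift]

theorem mem_cellVerts {p v : Cell} :
    v ∈ cellVerts p ↔ p = v ∨ p = v - (1, 0) ∨ p = v - (0, 1) ∨ p = v - (1, 1) := by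
  simp only [cellVerts, Finset.mem_insert, Finset.mem_singleton, eq_sub_iff_add_eq, eq_comm]

theorem mem_boardV {S : Finset Cell} {v : Cell} :
    v ∈ boardV S ↔ v ∈ S ∨ v - (1, 0) ∈ S ∨ v - (0, 1) ∈ S ∨ v - (1, 1) ∈ S := by
  simp only [boardV, Finset.mem_biUnion, mem_cellVerts]
  constructor
  · rintro ⟨p, hp, rfl | rfl | rfl | rfl⟩ <;> tauto
  · rintro (h | h | h | h)
    · exact ⟨_, h, by tauto⟩
    · exact ⟨_, h, by tauto⟩
    · exact ⟨_, h, by tauto⟩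
    · exact ⟨_, h, by tauto⟩

theorem Eh_left {S : Finset Cell} {e : Cell} (h : e ∈ boardEh S) : e ∈ boardV S := by
  rw [mem_boardEh] at h; rw [mem_boardV]; tauto

theorem Eh_right {S : Finset Cell} {e : Cell} (h : e ∈ boardEh S) : e + (1, 0) ∈ boardV S := by
  rw [mem_boardEh] at h; rw [mem_boardV]
  have e1 : e + (1, 0) - (1, 0) = e := by simp
  have e2 : e + (1, 0) - (1, 1) = e - (0, 1) := by ext <;> simp
  rw [e1, e2]; tauto

theorem Ev_left {S : Finset Cell} {e : Cell} (h : e ∈ boardEv S) : e ∈ boardV S := by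
  rw [mem_boardEv] at h; rw [mem_boardV]; tauto

theorem Ev_right {S : Finset Cell} {e : Cell} (h : e ∈ boardEv S) : e + (0, 1) ∈ boardV S := by
  rw [mem_boardEv] at h; rw [mem_boardV]
  have e1 : e + (0, 1) - (0, 1) = e := by simp
  have e2 : e + (0, 1) - (1, 1) = e - (1, 0) := by ext <;> simp
  rw [e1, e2]; tauto

theorem cell_Eh {S : Finset Cell} {p : Cell} (h : p ∈ S) :
    p ∈ boardEh S ∧ p + (0, 1) ∈ boardEh S := by
  simp [mem_boardEh, h]

theorem cell_Ev {S : Finset Cell} {p : Cell} (h : p ∈ S) :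
    p ∈ boardEv S ∧ p + (1, 0) ∈ boardEv S := by
  simp [mem_boardEv, h]

def dZero (S : Finset Cell) :
    (boardV S → ℤ) →ₗ[ℤ] (boardEh S → ℤ) × (boardEv S → ℤ) where
  toFun u := (fun e => u ⟨e.1 + (1, 0), Eh_right e.2⟩ - u ⟨e.1, Eh_left e.2⟩,
    fun e => u ⟨e.1 + (0, 1), Ev_right e.2⟩ - u ⟨e.1, Ev_left e.2⟩)
  map_add' u v := by
    ext e <;> simp <;> ring
  map_smul' c u := by
    ext e <;> simp <;> ring

def dOne (S : Finset Cell) :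
    (boardEh S → ℤ) × (boardEv S → ℤ) →ₗ[ℤ] (S → ℤ) where
  toFun c p := c.1 ⟨p.1, (cell_Eh p.2).1⟩ + c.2 ⟨p.1 + (1, 0), (cell_Ev p.2).2⟩
    - c.2 ⟨p.1, (cell_Ev p.2).1⟩ - c.1 ⟨p.1 + (0, 1), (cell_Eh p.2).2⟩
  map_add' u v := by
    ext e; simp; ring
  map_smul' c u := by
    ext e; simp; ring

theorem dOne_surj (S : Finset Cell) : Function.Surjective (dOne S) := by
  intro g
  let cv : Cell → ℤ := fun v => ∑ q : S, if q.1.2 = v.2 ∧ q.1.1 < v.1 then g q else 0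
  refine ⟨(0, fun e => cv e.1), ?_⟩
  ext p
  simp only [dOne, LinearMap.coe_mk, AddHom.coe_mk, Pi.zero_apply, zero_add, sub_zero, cv]
  rw [← Finset.sum_sub_distrib, Finset.sum_eq_single p]
  · simp
  · intro q _ hq
    have : ¬ (q.1.2 = p.1.2 ∧ q.1.1 = p.1.1) := by
      rintro ⟨h1, h2⟩
      exact hq (Subtype.ext (Prod.ext h2 h1))
    simp only [Prod.fst_add, Prod.snd_add, add_zero]
    split_ifs with h1 h2 h2
    · simp
    · exfalso; omega
    · exfalso; omega
    · simp
  · simp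

theorem dOne_exact {S : Finset Cell} (hS : IsBoard S) :
    LinearMap.ker (dOne S) = LinearMap.range (dZero S) := by
  apply le_antisymm
  · rintro ⟨a, b⟩ hc
    let ch : Cell → ℤ := fun e => if h : e ∈ boardEh S then a ⟨e, h⟩ else 0
    let cv : Cell → ℤ := fun e => if h : e ∈ boardEv S then b ⟨e, h⟩ else 0
    have hch : ∀ e (h : e ∈ boardEh S), ch e = a ⟨e, h⟩ := fun e h => by simp [ch, h]
    have hcv : ∀ e (h : e ∈ boardEv S), cv e = b ⟨e, h⟩ := fun e h => by simp [cv, h]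
    obtain ⟨u, hu⟩ := cocycle_exact hS ch cv (by
      intro p hp
      have := congrFun (LinearMap.mem_ker.1 hc) ⟨p, hp⟩
      simp only [dOne, LinearMap.coe_mk, AddHom.coe_mk, Pi.zero_apply] at this
      rw [hch p (cell_Eh hp).1, hch _ (cell_Eh hp).2, hcv p (cell_Ev hp).1, hcv _ (cell_Ev hp).2]
      linarith)
    refine ⟨fun v => u v.1, ?_⟩
    simp only [dZero, LinearMap.coe_mk, AddHom.coe_mk]
    refine Prod.ext (funext ?_) (funext ?_)
    · rintro ⟨e, he⟩
      simp only
      rw [← hch e he]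
      rcases mem_boardEh.1 he with h | h
      · exact (hu e h).1
      · have := (hu _ h).2.2.1
        have e1 : e - (0, 1) + (1, 1) = e + (1, 0) := by ext <;> simp
        rwa [e1, sub_add_cancel] at this
    · rintro ⟨e, he⟩
      simp only
      rw [← hcv e he]
      rcases mem_boardEv.1 he with h | h
      · exact (hu e h).2.1
      · have := (hu _ h).2.2.2
        have e1 : e - (1, 0) + (1, 1) = e + (0, 1) := by ext <;> simp
        rwa [e1, sub_add_cancel] at this
  · rintro _ ⟨u, rfl⟩
    rw [LinearMap.mem_ker]
    ext p
    simp only [dOne, dZero, LinearMap.coe_mk, AddHom.coe_mk, Pi.zero_apply]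
    have e1 : p.1 + (1, 0) + (0, 1) = p.1 + (0, 1) + (1, 0) := by abel
    simp only [e1]
    ring

theorem finrank_ker_dZero {S : Finset Cell} (hS : IsBoard S) :
    Module.finrank ℤ (LinearMap.ker (dZero S)) = 1 := by
  obtain ⟨p0, hp0⟩ := hS.1
  have hv0 : p0 ∈ boardV S := mem_boardV.2 (Or.inl hp0)
  let φ : LinearMap.ker (dZero S) →ₗ[ℤ] ℤ :=
    (LinearMap.proj (⟨p0, hv0⟩ : boardV S)).comp (LinearMap.ker (dZero S)).subtype
  have hval : ∀ w ∈ LinearMap.ker (dZero S), ∀ v, w v = w ⟨p0, hv0⟩ := by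
    intro w hw
    rw [LinearMap.mem_ker] at hw
    let u : Cell → ℤ := fun v => if h : v ∈ boardV S then w ⟨v, h⟩ else 0
    have hu : ∀ v (h : v ∈ boardV S), u v = w ⟨v, h⟩ := fun v h => by simp [u, h]
    have hh : ∀ e, e ∈ boardEh S → u (e + (1, 0)) = u e := by
      intro e he
      have := congrFun (congrArg Prod.fst hw) ⟨e, he⟩
      simp only [dZero, LinearMap.coe_mk, AddHom.coe_mk, Prod.fst_zero, Pi.zero_apply] at this
      rw [hu _ (Eh_right he), hu _ (Eh_left he)]
      linarith
    have hv : ∀ e, e ∈ boardEv S → u (e + (0, 1)) = u e := by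
      intro e he
      have := congrFun (congrArg Prod.snd hw) ⟨e, he⟩
      simp only [dZero, LinearMap.coe_mk, AddHom.coe_mk, Prod.snd_zero, Pi.zero_apply] at this
      rw [hu _ (Ev_right he), hu _ (Ev_left he)]
      linarith
    have hcell : ∀ p ∈ S, u (p + (1, 0)) = u p ∧ u (p + (0, 1)) = u p ∧ u (p + (1, 1)) = u p := by
      intro p hp
      have h1 := hh p (cell_Eh hp).1
      have h2 := hv p (cell_Ev hp).1
      have h3 := hh _ (cell_Eh hp).2
      have e1 : p + (0, 1) + (1, 0) = p + (1, 1) := by ext <;> simp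
      rw [e1] at h3
      exact ⟨h1, h2, h3.trans h2⟩
    rintro ⟨v, hvV⟩
    rw [← hu v hvV, ← hu p0 hv0]
    rcases mem_boardV.1 hvV with h | h | h | h
    · exact vertex_const hS u hcell h hp0
    · have := (hcell _ h).1
      rw [sub_add_cancel] at this
      rw [this]; exact vertex_const hS u hcell h hp0
    · have := (hcell _ h).2.1
      rw [sub_add_cancel] at this
      rw [this]; exact vertex_const hS u hcell h hp0
    · have := (hcell _ h).2.2
      rw [sub_add_cancel] at this
      rw [this]; exact vertex_const hS u hcell h hp0
  have hbij : Function.Bijective φ := by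
    constructor
    · rw [injective_iff_map_eq_zero]
      rintro ⟨w, hw⟩ h
      apply Subtype.ext
      funext v
      exact (hval w hw v).trans h
    · intro n
      refine ⟨⟨fun _ => n, ?_⟩, rfl⟩
      rw [LinearMap.mem_ker]
      simp only [dZero, LinearMap.coe_mk, AddHom.coe_mk, sub_self]
      rfl
  rw [(LinearEquiv.ofBijective φ hbij).finrank_eq]
  simp

theorem int_rank_nullity {M N : Type*} [AddCommGroup M] [AddCommGroup N] [Module.Finite ℤ M]
    (f : M →ₗ[ℤ] N) : Module.finrank ℤ (LinearMap.range f) + Module.finrank ℤ (LinearMap.ker f) =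
      Module.finrank ℤ M := by
  rw [← f.quotKerEquivRange.finrank_eq]
  exact Submodule.finrank_quotient_add_finrank _

theorem euler_char {S : Finset Cell} (hS : IsBoard S) :
    ((boardV S).card : ℤ) + S.card = (boardEh S).card + (boardEv S).card + 1 := by
  have h0 := int_rank_nullity (dZero S)
  have h1 := int_rank_nullity (dOne S)
  rw [dOne_exact hS, LinearMap.range_eq_top.2 (dOne_surj S), finrank_top] at h1
  rw [finrank_ker_dZero hS] at h0
  rw [Module.finrank_prod] at h1
  simp only [Module.finrank_fintype_fun_eq_card, Fintype.card_coe] at h0 h1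
  omega

theorem sum_shift (A V : Finset Cell) (t : Cell) (h : ∀ a ∈ A, a + t ∈ V) :
    ∑ v ∈ V, (if v - t ∈ A then (1 : ℤ) else 0) = A.card := by
  rw [Finset.sum_boole]
  congr 1
  have : V.filter (fun v => v - t ∈ A) = A.image (· + t) := by
    ext v
    rw [mem_image_shift, Finset.mem_filter]
    refine ⟨fun h => h.2, fun hv => ⟨?_, hv⟩⟩
    simpa using h _ hv
  rw [this, Finset.card_image_of_injective _ (add_left_injective t)]

theorem incident_card (S : Finset Cell) (v : Cell) :
    (incidentCells S v).card = (if v ∈ S then 1 else 0) + (if v - (1, 0) ∈ S then 1 else 0) +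
      (if v - (0, 1) ∈ S then 1 else 0) + (if v - (1, 1) ∈ S then 1 else 0) := by
  have : incidentCells S v =
      ({v, v - (1, 0), v - (0, 1), v - (1, 1)} : Finset Cell).filter (· ∈ S) := by
    ext p
    simp only [incidentCells, Finset.mem_filter, mem_cellVerts, Finset.mem_insert,
      Finset.mem_singleton]
    tauto
  rw [this, Finset.card_filter, Finset.sum_insert, Finset.sum_insert, Finset.sum_insert,
    Finset.sum_singleton]
  · ring
  · simp [Prod.ext_iff]
  · simp [Prod.ext_iff]
  · simp [Prod.ext_iff]
    exact ⟨fun h => by linarith, fun h => by linarith, fun h => by linarith⟩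

theorem isVertex_iff {S : Finset Cell} {v : Cell} : IsVertex S v ↔ v ∈ boardV S := by
  simp [IsVertex, boardV]

theorem mem_interior_iff (S : Finset Cell) (v : Cell) :
    toR v ∈ interior (Region S) ↔ v ∈ S ∧ v - (1, 0) ∈ S ∧ v - (0, 1) ∈ S ∧ v - (1, 1) ∈ S := by
  constructor
  · intro h
    rw [mem_interior_iff_mem_nhds, Metric.mem_nhds_iff] at h
    obtain ⟨ε, hε, hb⟩ := h
    obtain ⟨δ, hδ0, hδ1, hδε⟩ : ∃ δ : ℝ, 0 < δ ∧ δ < 1 ∧ δ < ε := by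
      refine ⟨min (ε / 2) (1 / 2), by positivity, ?_, ?_⟩
      · exact lt_of_le_of_lt (min_le_right _ _) (by norm_num)
      · exact lt_of_le_of_lt (min_le_left _ _) (by linarith)
    have key : ∀ a b : ℝ, |a| = δ → |b| = δ → ((v.1 : ℝ) + a, (v.2 : ℝ) + b) ∈ Region S := by
      intro a b ha hb'
      apply hb
      rw [Metric.mem_ball, Prod.dist_eq, toR, Real.dist_eq, Real.dist_eq]
      simp [ha, hb', hδε]
    have habs : |δ| = δ := abs_of_pos hδ0
    have habs' : |-δ| = δ := by rw [abs_neg, habs]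
    refine ⟨?_, ?_, ?_, ?_⟩
    · apply open_cell_unique (key δ δ habs habs) <;> simp <;> linarith
    · apply open_cell_unique (key (-δ) δ habs' habs) <;> simp <;> linarith
    · apply open_cell_unique (key δ (-δ) habs habs') <;> simp <;> linarith
    · apply open_cell_unique (key (-δ) (-δ) habs' habs') <;> simp <;> linarith
  · rintro ⟨h1, h2, h3, h4⟩
    rw [mem_interior_iff_mem_nhds, Metric.mem_nhds_iff]
    refine ⟨1, one_pos, ?_⟩
    rintro ⟨x, y⟩ hx
    rw [Metric.mem_ball, Prod.dist_eq, toR, Real.dist_eq, Real.dist_eq, max_lt_iff, abs_lt,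
      abs_lt] at hx
    obtain ⟨⟨a, b⟩, c, d⟩ := hx
    simp only at a b c d
    rw [mem_region]
    rcases le_total x v.1 with hx | hx <;> rcases le_total y v.2 with hy | hy
    · refine ⟨_, h4, mem_unitSquare.2 ?_⟩
      simp only [Prod.fst_sub, Prod.snd_sub, Int.cast_sub, Int.cast_one]
      refine ⟨⟨?_, ?_⟩, ?_, ?_⟩ <;> linarith
    · refine ⟨_, h2, mem_unitSquare.2 ?_⟩
      simp only [Prod.fst_sub, Prod.snd_sub, Int.cast_sub, Int.cast_one, Int.cast_zero]
      refine ⟨⟨?_, ?_⟩, ?_, ?_⟩ <;> linarith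
    · refine ⟨_, h3, mem_unitSquare.2 ?_⟩
      simp only [Prod.fst_sub, Prod.snd_sub, Int.cast_sub, Int.cast_one, Int.cast_zero]
      refine ⟨⟨?_, ?_⟩, ?_, ?_⟩ <;> linarith
    · refine ⟨_, h1, mem_unitSquare.2 ?_⟩
      refine ⟨⟨?_, ?_⟩, ?_, ?_⟩ <;> simp only <;> linarith

theorem interior_iff_card (S : Finset Cell) (v : Cell) :
    toR v ∈ interior (Region S) ↔ (incidentCells S v).card = 4 := by
  rw [mem_interior_iff, incident_card]
  split_ifs <;> simp_all

theorem boundary_iff (S : Finset Cell) (v : Cell) :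
    IsBoundaryVertex S v ↔ v ∈ boardV S ∧ (incidentCells S v).card ≠ 4 := by
  rw [IsBoundaryVertex, isVertex_iff, (isClosed_region S).frontier_eq, Set.mem_sdiff,
    interior_iff_card]
  constructor
  · rintro ⟨h1, -, h2⟩; exact ⟨h1, h2⟩
  · rintro ⟨h1, h2⟩
    refine ⟨h1, ?_, h2⟩
    obtain ⟨p, hp, hv⟩ := isVertex_iff.2 h1
    refine square_subset hp ?_
    rcases mem_cellVerts.1 hv with rfl | rfl | rfl | rfl
    · exact toR_mem_of_cell.1
    · have := (toR_mem_of_cell (p := v - (1, 0))).2.1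
      rwa [sub_add_cancel] at this
    · have := (toR_mem_of_cell (p := v - (0, 1))).2.2.1
      rwa [sub_add_cancel] at this
    · have := (toR_mem_of_cell (p := v - (1, 1))).2.2.2
      rwa [sub_add_cancel] at this

theorem boundary_ncard (S : Finset Cell) (r : ℕ) (hr : r ≠ 4) :
    ({v : Cell | IsBoundaryVertex S v ∧ (incidentCells S v).card = r}.ncard : ℤ) =
      ∑ v ∈ boardV S, (if (incidentCells S v).card = r then (1 : ℤ) else 0) := by
  rw [Finset.sum_boole]
  congr 1
  rw [← Set.ncard_coe_finset]
  congr 1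
  ext v
  simp only [Set.mem_ofPred_eq, boundary_iff, Finset.coe_filter]
  constructor
  · rintro ⟨⟨h1, -⟩, h2⟩; exact ⟨h1, h2⟩
  · rintro ⟨h1, h2⟩; exact ⟨⟨h1, h2 ▸ hr⟩, h2⟩

theorem local_count {S : Finset Cell} (hS : IsBoard S) (v : Cell) (hv : v ∈ boardV S) :
    (if (incidentCells S v).card = 1 then (1 : ℤ) else 0)
      - (if (incidentCells S v).card = 3 then (1 : ℤ) else 0) =
    4 * 1 - 2 * ((if v - 0 ∈ boardEh S then (1 : ℤ) else 0)
      + (if v - (1, 0) ∈ boardEh S then (1 : ℤ) else 0)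
      + (if v - 0 ∈ boardEv S then (1 : ℤ) else 0)
      + (if v - (0, 1) ∈ boardEv S then (1 : ℤ) else 0))
      + ((if v - 0 ∈ S then (1 : ℤ) else 0) + (if v - (1, 0) ∈ S then (1 : ℤ) else 0)
      + (if v - (0, 1) ∈ S then (1 : ℤ) else 0) + (if v - (1, 1) ∈ S then (1 : ℤ) else 0)) := by
  have e1 : v - (1, 0) - (0, 1) = v - (1, 1) := by ext <;> simp
  have e2 : v - (0, 1) - (1, 0) = v - (1, 1) := by ext <;> simp
  rw [mem_boardV] at hv
  have d1 := no_diag_one hS v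
  have d2 := no_diag_two hS v
  simp only [incident_card, mem_boardEh, mem_boardEv, sub_zero, e1, e2]
  by_cases h1 : v ∈ S <;> by_cases h2 : v - (1, 0) ∈ S <;> by_cases h3 : v - (0, 1) ∈ S <;>
    by_cases h4 : v - (1, 1) ∈ S <;>
    first
    | exact (d1 h1 h4 h2 h3).elim
    | exact (d2 h1 h4 h2 h3).elim
    | exact (not_or.2 ⟨h1, not_or.2 ⟨h2, not_or.2 ⟨h3, h4⟩⟩⟩ hv).elim
    | simp [h1, h2, h3, h4]

/-- **Lemma (Gauss–Bonnet for boards).** If `V r` denotes the number of boundary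
vertices incident to exactly `r` cells, then `V 1 - V 3 - 2 * V 4 = 4`. -/
theorem boundary_vertex_count
    (S : Finset Cell) (hS : IsBoard S) :
    (({v : Cell | IsBoundaryVertex S v ∧ (incidentCells S v).card = 1}.ncard : ℤ)
      - {v : Cell | IsBoundaryVertex S v ∧ (incidentCells S v).card = 3}.ncard
      - 2 * {v : Cell | IsBoundaryVertex S v ∧ (incidentCells S v).card = 4}.ncard) = 4 := by

  have h4 : {v : Cell | IsBoundaryVertex S v ∧ (incidentCells S v).card = 4} = ∅ := by
    ext v
    simp only [Set.mem_ofPred_eq, boundary_iff, Set.mem_empty_iff_false, iff_false]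
    tauto
  rw [h4, Set.ncard_empty, boundary_ncard S 1 (by norm_num), boundary_ncard S 3 (by norm_num),
    ← Finset.sum_sub_distrib, Finset.sum_congr rfl (local_count hS), Finset.sum_add_distrib,
    Finset.sum_sub_distrib, ← Finset.mul_sum, ← Finset.mul_sum]
  simp only [Finset.sum_add_distrib]
  rw [sum_shift (boardEh S) _ 0 (fun a ha => by simpa using Eh_left ha),
    sum_shift (boardEh S) _ (1, 0) (fun a ha => Eh_right ha),
    sum_shift (boardEv S) _ 0 (fun a ha => by simpa using Ev_left ha),
    sum_shift (boardEv S) _ (0, 1) (fun a ha => Ev_right ha),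
    sum_shift S _ 0 (fun a ha => by simp [mem_boardV, ha]),
    sum_shift S _ (1, 0) (fun a ha => by simp [mem_boardV, ha]),
    sum_shift S _ (0, 1) (fun a ha => by simp [mem_boardV, ha]),
    sum_shift S _ (1, 1) (fun a ha => by simp [mem_boardV, ha])]
  have := euler_char hS
  simp only [Finset.sum_const, nsmul_eq_mul, mul_one]
  push_cast
  linarith
end
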